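/- Let δ > 0 and let (u,p) be a C² (−1)-homogeneous solution of the stationary Navier–Stokes equations on S² ∩ B_δ(S) \ {S}. If lim_{x∈S², x→S} |u(x)| / ln(dist(x,S)) = 0, then (u,p) extends to a C² (−1)-homogeneous solution of the stationary Navier–Stokes equations on all of S² ∩ B_δ(S); that is, the homogeneous extension of (u,p) extends as a C² solution across the ray {t·S : t > 0}, away from the origin. -/

import Mathlib

noncomputable section

open Real Filter MeasureTheory Metric Topology
open scoped ENNReal InnerProductSpace

abbrev V3 := EuclideanSpace ℝ (Fin 3)
abbrev V2 := EuclideanSpace ℝ (Fin 2)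

/-- standard basis vector in `ℝ³` -/
def e3 (j : Fin 3) : V3 := EuclideanSpace.single j 1

/-- partial derivative `∂_j f` -/
def pd (j : Fin 3) (f : V3 → ℝ) (x : V3) : ℝ := fderiv ℝ f x (e3 j)

/-- Laplacian on `ℝ³` -/
def lap3 (f : V3 → ℝ) (x : V3) : ℝ := ∑ j, pd j (fun y => pd j f y) x

/-- stationary Navier–Stokes equations `-Δu + (u·∇)u + ∇p = 0`, `div u = 0` at `x` -/
def NSEq (u : V3 → V3) (p : V3 → ℝ) (x : V3) : Prop :=
  (∀ i, - lap3 (fun z => u z i) x + (∑ j, u x j * pd j (fun z => u z i) x) + pd i p x = 0)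
  ∧ (∑ j, pd j (fun z => u z j) x) = 0

/-- stationary Euler equations `(u·∇)u + ∇p = 0`, `div u = 0` at `x` -/
def EulerEq (u : V3 → V3) (p : V3 → ℝ) (x : V3) : Prop :=
  (∀ i, (∑ j, u x j * pd j (fun z => u z i) x) + pd i p x = 0)
  ∧ (∑ j, pd j (fun z => u z j) x) = 0

/-- south pole -/
def S3 : V3 := EuclideanSpace.single 2 (-1)
/-- north pole -/
def N3 : V3 := EuclideanSpace.single 2 1

/-- the unit sphere `S²` -/
def sphere2 : Set V3 := Metric.sphere (0 : V3) 1

/-- the open cone over a subset of the unit sphere -/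
def cone3 (Ω : Set V3) : Set V3 := {x : V3 | x ≠ 0 ∧ (‖x‖⁻¹ • x) ∈ Ω}

/-- `|x'| = √(x₁² + x₂²)` -/
def rho (x : V3) : ℝ := Real.sqrt ((x 0) ^ 2 + (x 1) ^ 2)

/-- the `x₃`-axis `{x' = 0}` -/
def axis3 : Set V3 := {x : V3 | x 0 = 0 ∧ x 1 = 0}

/-- `Ω_{a,b,R} = {a < x₃ < b, |x'| < R}` -/
def OmegaR (a b R : ℝ) : Set V3 := {x : V3 | a < x 2 ∧ x 2 < b ∧ rho x < R}

/-- build a point of `ℝ³` from `x' ∈ ℝ²` and `x₃ ∈ ℝ` -/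
def emb (y : V2) (t : ℝ) : V3 := (EuclideanSpace.equiv (Fin 3) ℝ).symm ![y 0, y 1, t]

/-- spherical component `u_r = u · e_r` -/
def uRc (u : V3 → V3) (x : V3) : ℝ := (u x 0 * x 0 + u x 1 * x 1 + u x 2 * x 2) / ‖x‖

/-- spherical component `u_θ = u · e_θ` -/
def uTc (u : V3 → V3) (x : V3) : ℝ :=
  (u x 0 * x 0 * x 2 + u x 1 * x 1 * x 2) / (‖x‖ * rho x) - u x 2 * rho x / ‖x‖

/-- spherical component `u_φ = u · e_φ` -/
def uPc (u : V3 → V3) (x : V3) : ℝ := (-(u x 0) * x 1 + u x 1 * x 0) / rho x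

/-- axisymmetry on a set: the spherical components are independent of the meridian angle -/
def AxisymOn (u : V3 → V3) (Ω : Set V3) : Prop :=
  ∀ x ∈ Ω, ∀ y ∈ Ω, ‖x‖ = ‖y‖ → x 2 = y 2 →
    uRc u x = uRc u y ∧ uTc u x = uTc u y ∧ uPc u x = uPc u y

/-- spherical frame vector `e_r` -/
def eRv (x : V3) : V3 := ‖x‖⁻¹ • x

/-- spherical frame vector `e_θ` -/
def eThv (x : V3) : V3 := (EuclideanSpace.equiv (Fin 3) ℝ).symm
  ![x 2 * x 0 / (‖x‖ * rho x), x 2 * x 1 / (‖x‖ * rho x), -(rho x) / ‖x‖]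

/-- spherical frame vector `e_φ` -/
def ePhv (x : V3) : V3 := (EuclideanSpace.equiv (Fin 3) ℝ).symm ![-(x 1) / rho x, x 0 / rho x, 0]

/-- the spherical cap `S² ∩ B_δ(S) \ {S}` -/
def NSCap (δ : ℝ) : Set V3 := (sphere2 ∩ Metric.ball S3 δ) \ {S3}

/-- the spherical cap `S² ∩ B_δ(S)` -/
def NSCapFull (δ : ℝ) : Set V3 := sphere2 ∩ Metric.ball S3 δ

open scoped ComplexConjugate

/-- the Cauchy-Riemann operator -/
def dbar (F : ℂ → ℂ) (z : ℂ) : ℂ :=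
  (fderiv ℝ F z 1 + Complex.I * fderiv ℝ F z Complex.I) / 2

lemma HasFDerivAt.dbar_eq {F : ℂ → ℂ} {F' : ℂ →L[ℝ] ℂ} {z : ℂ} (h : HasFDerivAt F F' z) :
    dbar F z = (F' 1 + Complex.I * F' Complex.I) / 2 := by
  simp [dbar, h.fderiv]

lemma dbar_mul {F G : ℂ → ℂ} {z : ℂ} (hF : DifferentiableAt ℝ F z) (hG : DifferentiableAt ℝ G z) :
    dbar (fun x => F x * G x) z = dbar F z * G z + F z * dbar G z := by
  refine (hF.hasFDerivAt.mul hG.hasFDerivAt).dbar_eq.trans ?_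
  simp [dbar]; ring

lemma dbar_add {F G : ℂ → ℂ} {z : ℂ} (hF : DifferentiableAt ℝ F z) (hG : DifferentiableAt ℝ G z) :
    dbar (fun x => F x + G x) z = dbar F z + dbar G z := by
  refine (hF.hasFDerivAt.add hG.hasFDerivAt).dbar_eq.trans ?_
  simp [dbar]; ring

lemma dbar_sub {F G : ℂ → ℂ} {z : ℂ} (hF : DifferentiableAt ℝ F z) (hG : DifferentiableAt ℝ G z) :
    dbar (fun x => F x - G x) z = dbar F z - dbar G z := by
  refine (hF.hasFDerivAt.sub hG.hasFDerivAt).dbar_eq.trans ?_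
  simp [dbar]; ring

lemma dbar_const_mul {F : ℂ → ℂ} {z : ℂ} (c : ℂ) (hF : DifferentiableAt ℝ F z) :
    dbar (fun x => c * F x) z = c * dbar F z := by
  rw [(hF.hasFDerivAt.const_mul c).dbar_eq]
  simp [dbar]; ring

lemma dbar_const (c : ℂ) (z : ℂ) : dbar (fun _ => c) z = 0 := by
  simp [dbar]

lemma dbar_congr {F G : ℂ → ℂ} {z : ℂ} (h : F =ᶠ[𝓝 z] G) : dbar F z = dbar G z := by
  simp [dbar, h.fderiv_eq]

lemma dbar_holo {F : ℂ → ℂ} {z : ℂ} (h : DifferentiableAt ℂ F z) : dbar F z = 0 := by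
  have := h.hasFDerivAt.restrictScalars ℝ
  rw [this.dbar_eq]
  have e : fderiv ℂ F z Complex.I = Complex.I * fderiv ℂ F z 1 := by
    simp
  simp only [ContinuousLinearMap.coe_restrictScalars', e, ← mul_assoc, Complex.I_mul_I]
  ring

lemma dbar_conj (z : ℂ) : dbar (fun x => conj x) z = 1 := by
  have : HasFDerivAt (fun x : ℂ => conj x) (Complex.conjCLE : ℂ →L[ℝ] ℂ) z :=
    Complex.conjCLE.hasFDerivAt
  rw [this.dbar_eq]
  simp

lemma dbar_comp_conj {F : ℂ → ℂ} {z : ℂ} (h : DifferentiableAt ℂ F (conj z)) :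
    dbar (fun x => F (conj x)) z = deriv F (conj z) := by
  have h1 : HasFDerivAt (fun x : ℂ => conj x) (Complex.conjCLE : ℂ →L[ℝ] ℂ) z :=
    Complex.conjCLE.hasFDerivAt
  have h2 := (h.hasFDerivAt.restrictScalars ℝ).comp z h1
  have h3 : HasFDerivAt (fun x => F (conj x)) _ z := h2
  rw [h3.dbar_eq]
  have e : fderiv ℂ F (conj z) (-Complex.I) = - Complex.I * fderiv ℂ F (conj z) 1 := by
    simp
  have e1 : fderiv ℂ F (conj z) 1 = deriv F (conj z) := by simp
  simp only [ContinuousLinearMap.comp_apply, ContinuousLinearMap.coe_restrictScalars',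
    ContinuousLinearEquiv.coe_coe, Complex.conjCLE_apply, map_one, Complex.conj_I, e, e1]
  linear_combination (-(1/2) * deriv F (conj z)) * Complex.I_mul_I

lemma dbar_affine {F : ℂ → ℂ} {z ξ : ℂ} (ρ : ℝ) (h : DifferentiableAt ℝ F (z + ρ * ξ)) :
    dbar (fun x => F (z + ρ * x)) ξ = ρ * dbar F (z + ρ * ξ) := by
  have h1 : HasFDerivAt (fun x : ℂ => z + (ρ : ℂ) * x) ((ρ : ℂ) • ContinuousLinearMap.id ℝ ℂ) ξ := by
    have := ((hasFDerivAt_id (𝕜 := ℝ) ξ).const_mul (ρ : ℂ)).const_add z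
    exact this
  have h2 : HasFDerivAt (fun x => F (z + ρ * x)) _ ξ := h.hasFDerivAt.comp ξ h1
  rw [h2.dbar_eq]
  have e : ∀ v : ℂ, fderiv ℝ F (z + ρ * ξ) ((ρ : ℂ) * v) = ρ * fderiv ℝ F (z + ρ * ξ) v := by
    intro v
    have := (fderiv ℝ F (z + ρ * ξ)).map_smul ρ v
    simpa using this
  simp only [ContinuousLinearMap.comp_apply, smul_apply,
    ContinuousLinearMap.id_apply, smul_eq_mul, e, dbar]
  ring

lemma dbar_eq_zero_of_notMem {F : ℂ → ℂ} {z : ℂ} (h : z ∉ tsupport F) : dbar F z = 0 := by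
  have : F =ᶠ[𝓝 z] fun _ => 0 := notMem_tsupport_iff_eventuallyEq.mp h
  rw [dbar_congr this, dbar_const]

lemma tsupport_dbar_subset (F : ℂ → ℂ) : tsupport (dbar F) ⊆ tsupport F := by
  apply closure_minimal _ (isClosed_tsupport F)
  intro z hz
  by_contra h
  exact hz (dbar_eq_zero_of_notMem h)

lemma HasCompactSupport.dbar' {F : ℂ → ℂ} (h : HasCompactSupport F) :
    HasCompactSupport (dbar F) :=
  h.of_isClosed_subset (isClosed_tsupport _) (tsupport_dbar_subset F)

lemma ContDiffOn.dbar' {F : ℂ → ℂ} {s : Set ℂ} (hs : IsOpen s) {n m : WithTop ℕ∞}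
    (h : ContDiffOn ℝ n F s) (hmn : m + 1 ≤ n) :
    ContDiffOn ℝ m (dbar F) s := by
  have h1 : ContDiffOn ℝ m (fderiv ℝ F) s := h.fderiv_of_isOpen hs hmn
  unfold dbar
  exact ((h1.clm_apply contDiffOn_const).add
    (contDiffOn_const.mul (h1.clm_apply contDiffOn_const))).div_const 2

lemma ContDiff.dbar' {F : ℂ → ℂ} {n m : WithTop ℕ∞}
    (h : ContDiff ℝ n F) (hmn : m + 1 ≤ n) :
    ContDiff ℝ m (dbar F) := by
  rw [← contDiffOn_univ] at *
  exact ContDiffOn.dbar' isOpen_univ h hmn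

lemma continuousOn_dbar {F : ℂ → ℂ} {s : Set ℂ} (hs : IsOpen s)
    (h : ContDiffOn ℝ 1 F s) : ContinuousOn (dbar F) s :=
  (ContDiffOn.dbar' (m := 0) hs h (by norm_num)).continuousOn

lemma continuous_dbar {F : ℂ → ℂ} (h : ContDiff ℝ 1 F) : Continuous (dbar F) :=
  (ContDiff.dbar' (m := 0) h (by norm_num)).continuous

lemma integral_fderiv_zero {F : ℂ → ℂ} (h : ContDiff ℝ 1 F) (hc : HasCompactSupport F) (v : ℂ) :
    ∫ z, fderiv ℝ F z v = 0 := by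
  have h0 : Continuous (fderiv ℝ F) := h.continuous_fderiv one_ne_zero
  have key := integral_mul_fderiv_eq_neg_fderiv_mul_of_integrable (μ := (volume : Measure ℂ))
    (f := fun _ : ℂ => (1 : ℂ)) (g := F) (v := v) (by simp)
    (by
      simp only [one_mul]
      exact (h0.clm_apply continuous_const).integrable_of_hasCompactSupport (hc.fderiv_apply ℝ v))
    (by simpa using h.continuous.integrable_of_hasCompactSupport hc)
    (by intro x _; fun_prop) (by intro x _; exact h.differentiable one_ne_zero x)
  simpa using key

lemma integral_dbar_zero {F : ℂ → ℂ} (h : ContDiff ℝ 1 F) (hc : HasCompactSupport F) :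
    ∫ z, dbar F z = 0 := by
  have h0 : Continuous (fderiv ℝ F) := h.continuous_fderiv one_ne_zero
  have i : ∀ v, Integrable (fun z => fderiv ℝ F z v) := fun v =>
    (h0.clm_apply continuous_const).integrable_of_hasCompactSupport (hc.fderiv_apply ℝ v)
  unfold dbar
  rw [integral_div, integral_add (i 1) ((i _).const_mul _), integral_const_mul,
    integral_fderiv_zero h hc, integral_fderiv_zero h hc]
  simp

/-- integration by parts on compactly supported C¹ functions -/
lemma integral_mul_dbar {k F : ℂ → ℂ} (hk : ContDiff ℝ 1 k) (hkc : HasCompactSupport k)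
    {s : Set ℂ} (hs : IsOpen s) (hks : tsupport k ⊆ s) (hF : ContDiffOn ℝ 1 F s) :
    ∫ z, k z * dbar F z = - ∫ z, dbar k z * F z := by
  have hcd : ContDiff ℝ 1 (fun z => k z * F z) := by
    rw [contDiff_iff_contDiffAt]
    intro z
    by_cases hz : z ∈ tsupport k
    · exact hk.contDiffAt.mul (hF.contDiffAt (hs.mem_nhds (hks hz)))
    · have : (fun z => k z * F z) =ᶠ[𝓝 z] fun _ => 0 := by
        filter_upwards [notMem_tsupport_iff_eventuallyEq.mp hz] with y hy
        simp [hy]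
      exact contDiffAt_const.congr_of_eventuallyEq this
  have hcs : HasCompactSupport (fun z => k z * F z) := hkc.mul_right
  have hz := integral_dbar_zero hcd hcs
  have e : ∀ z, dbar (fun z => k z * F z) z = dbar k z * F z + k z * dbar F z := by
    intro z
    by_cases hz : z ∈ tsupport k
    · exact dbar_mul (hk.differentiable one_ne_zero z)
        ((hF.contDiffAt (hs.mem_nhds (hks hz))).differentiableAt one_ne_zero)
    · have h1 : (fun z => k z * F z) =ᶠ[𝓝 z] fun _ => 0 := by
        filter_upwards [notMem_tsupport_iff_eventuallyEq.mp hz] with y hy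
        simp [hy]
      rw [dbar_congr h1, dbar_const, dbar_eq_zero_of_notMem hz, image_eq_zero_of_notMem_tsupport hz]
      simp
  have contmul : ∀ (a b : ℂ → ℂ), Continuous a → tsupport a ⊆ tsupport k → ContinuousOn b s →
      Integrable (fun z => a z * b z) := by
    intro a b ha has hb
    apply Continuous.integrable_of_hasCompactSupport
    · rw [continuous_iff_continuousAt]
      intro z
      by_cases hz : z ∈ tsupport k
      · exact ha.continuousAt.mul (hb.continuousAt (hs.mem_nhds (hks hz)))
      · have : (fun z => a z * b z) =ᶠ[𝓝 z] fun _ => 0 := by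
          filter_upwards [notMem_tsupport_iff_eventuallyEq.mp (fun h => hz (has h))] with y hy
          simp [hy]
        exact continuousAt_const.congr this.symm
    · have : HasCompactSupport a := hkc.of_isClosed_subset (isClosed_tsupport _) has
      exact this.mul_right
  simp_rw [e] at hz
  rw [integral_add (contmul _ _ (continuous_dbar hk) (tsupport_dbar_subset k) hF.continuousOn)
    (contmul _ _ hk.continuous subset_rfl (continuousOn_dbar hs hF))] at hz
  linear_combination hz

lemma rpow_mul_le_add {X Y a b : ℝ} (hX : 0 ≤ X) (hY : 0 ≤ Y) (ha : 0 ≤ a) (hb : 0 ≤ b) :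
    X ^ (-a) * Y ^ (-b) ≤ X ^ (-(a + b)) + Y ^ (-(a + b)) := by
  rcases hX.eq_or_lt with rfl | hX
  · rcases ha.eq_or_lt with rfl | ha
    · simp; positivity
    · rw [Real.zero_rpow (by linarith)]; simp; positivity
  rcases hY.eq_or_lt with rfl | hY
  · rcases hb.eq_or_lt with rfl | hb
    · simp; positivity
    · rw [Real.zero_rpow (x := -b) (by linarith)]; simp; positivity
  rcases le_total X Y with h | h
  · calc X ^ (-a) * Y ^ (-b) ≤ X ^ (-a) * X ^ (-b) := by
          gcongr ?_ * ?_
          exact Real.rpow_le_rpow_of_nonpos hX h (by linarith)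
      _ = X ^ (-(a + b)) := by rw [← Real.rpow_add hX]; ring_nf
      _ ≤ _ := by have := Real.rpow_nonneg hY.le (-(a+b)); linarith
  · calc X ^ (-a) * Y ^ (-b) ≤ Y ^ (-a) * Y ^ (-b) := by
          gcongr ?_ * ?_
          exact Real.rpow_le_rpow_of_nonpos hY h (by linarith)
      _ = Y ^ (-(a + b)) := by rw [← Real.rpow_add hY]; ring_nf
      _ ≤ _ := by have := Real.rpow_nonneg hX.le (-(a+b)); linarith

lemma rpow_mul3_le_add {X Y Z a b c : ℝ} (hX : 0 ≤ X) (hY : 0 ≤ Y) (hZ : 0 ≤ Z)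
    (ha : 0 ≤ a) (hb : 0 ≤ b) (hc : 0 ≤ c) :
    X ^ (-a) * (Y ^ (-b) * Z ^ (-c)) ≤
      2 * (X ^ (-(a + b + c)) + Y ^ (-(a + b + c)) + Z ^ (-(a + b + c))) := by
  have h1 := rpow_mul_le_add hY hZ hb hc
  have h2 := rpow_mul_le_add hX hY ha (add_nonneg hb hc)
  have h3 := rpow_mul_le_add hX hZ ha (add_nonneg hb hc)
  have h0 := Real.rpow_nonneg hX (-a)
  have := mul_le_mul_of_nonneg_left h1 h0
  have e : a + (b + c) = a + b + c := by ring
  rw [e] at h2 h3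
  have := Real.rpow_nonneg hY (-(a+b+c))
  have := Real.rpow_nonneg hZ (-(a+b+c))
  linarith

lemma locInt_norm_rpow {σ : ℝ} (hσ : σ < 2) : LocallyIntegrable (fun ζ : ℂ => ‖ζ‖ ^ (-σ)) := by
  apply locallyIntegrable_of_norm_le_rpow (C := 1) (α := σ)
  · simpa using hσ
  · apply Eventually.of_forall
    intro x
    rw [Real.norm_of_nonneg (by positivity), one_mul]
  · exact (measurable_norm.pow_const _).aestronglyMeasurable
  · simp

lemma sing_bound {σ : ℝ} (hσ : σ < 2) (R : ℝ) : ∃ M, 0 ≤ M ∧ ∀ z ∈ closedBall (0:ℂ) R,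
    IntegrableOn (fun ζ : ℂ => ‖z - ζ‖ ^ (-σ)) (closedBall 0 R) ∧
    ∫ ζ in closedBall (0:ℂ) R, ‖z - ζ‖ ^ (-σ) ≤ M := by
  have h0 : IntegrableOn (fun ζ : ℂ => ‖ζ‖ ^ (-σ)) (closedBall 0 (2 * R)) :=
    (locInt_norm_rpow hσ).integrableOn_isCompact (isCompact_closedBall _ _)
  set g : ℂ → ℝ := (closedBall (0:ℂ) (2 * R)).indicator (fun ζ : ℂ => ‖ζ‖ ^ (-σ)) with hg
  have hgi : Integrable g := h0.integrable_indicator measurableSet_closedBall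
  have hg0 : ∀ x, 0 ≤ g x := fun x => Set.indicator_nonneg (fun _ _ => by positivity) _
  refine ⟨∫ x, g x, integral_nonneg hg0, fun z hz => ?_⟩
  have h1 : Integrable (fun ζ => g (z - ζ)) := hgi.comp_sub_left z
  have e : Set.EqOn (fun ζ => g (z - ζ)) (fun ζ : ℂ => ‖z - ζ‖ ^ (-σ)) (closedBall 0 R) := by
    intro ζ hζ
    simp only [hg]
    rw [Set.indicator_of_mem]
    rw [mem_closedBall_zero_iff] at *
    calc ‖z - ζ‖ ≤ ‖z‖ + ‖ζ‖ := norm_sub_le _ _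
      _ ≤ _ := by linarith
  refine ⟨(h1.integrableOn).congr_fun e measurableSet_closedBall, ?_⟩
  rw [← setIntegral_congr_fun measurableSet_closedBall e]
  calc ∫ ζ in closedBall (0:ℂ) R, g (z - ζ) ≤ ∫ ζ, g (z - ζ) :=
        setIntegral_le_integral h1 (Eventually.of_forall fun _ => hg0 _)
    _ = ∫ x, g x := integral_sub_left_eq_self g volume z

lemma three_sing {a b c : ℝ} (ha : 0 ≤ a) (hb : 0 ≤ b) (hc : 0 ≤ c) (habc : a + b + c < 2)
    (R : ℝ) (hR : 0 ≤ R) : ∃ M, 0 ≤ M ∧ ∀ z ∈ closedBall (0:ℂ) R, ∀ z' ∈ closedBall (0:ℂ) R,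
    IntegrableOn (fun ζ : ℂ => ‖ζ‖ ^ (-a) * (‖z - ζ‖ ^ (-b) * ‖z' - ζ‖ ^ (-c))) (closedBall 0 R) ∧
    ∫ ζ in closedBall (0:ℂ) R, ‖ζ‖ ^ (-a) * (‖z - ζ‖ ^ (-b) * ‖z' - ζ‖ ^ (-c)) ≤ M := by
  obtain ⟨M, hM, h⟩ := sing_bound habc R
  refine ⟨2 * (M + M + M), by positivity, fun z hz z' hz' => ?_⟩
  have h1 := h z hz
  have h2 := h z' hz'
  have h3 := h 0 (by simpa using hR)
  simp only [zero_sub, norm_neg] at h3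
  have hi := ((h3.1.add h1.1).add h2.1).const_mul 2
  have hb : ∀ ζ : ℂ, ‖ζ‖ ^ (-a) * (‖z - ζ‖ ^ (-b) * ‖z' - ζ‖ ^ (-c)) ≤
    2 * (‖ζ‖ ^ (-(a+b+c)) + ‖z - ζ‖ ^ (-(a+b+c)) + ‖z' - ζ‖ ^ (-(a+b+c))) := fun ζ =>
    rpow_mul3_le_add (norm_nonneg _) (norm_nonneg _) (norm_nonneg _) ha hb hc
  have hint : IntegrableOn (fun ζ : ℂ => ‖ζ‖ ^ (-a) * (‖z - ζ‖ ^ (-b) * ‖z' - ζ‖ ^ (-c)))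
      (closedBall 0 R) := by
    refine Integrable.mono' hi ?_ (Eventually.of_forall fun ζ => ?_)
    · apply Measurable.aestronglyMeasurable
      fun_prop
    · rw [Real.norm_of_nonneg (by positivity)]
      exact hb ζ
  refine ⟨hint, ?_⟩
  calc _ ≤ ∫ ζ in closedBall (0:ℂ) R,
      2 * (‖ζ‖ ^ (-(a+b+c)) + ‖z - ζ‖ ^ (-(a+b+c)) + ‖z' - ζ‖ ^ (-(a+b+c))) :=
        integral_mono hint hi hb
    _ = 2 * ((∫ ζ in closedBall (0:ℂ) R, ‖ζ‖ ^ (-(a+b+c))) +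
          (∫ ζ in closedBall (0:ℂ) R, ‖z - ζ‖ ^ (-(a+b+c))) +
          ∫ ζ in closedBall (0:ℂ) R, ‖z' - ζ‖ ^ (-(a+b+c))) := by
        rw [integral_const_mul]
        congr 1
        refine (integral_add (h3.1.add h1.1) h2.1).trans ?_
        congr 1
        exact integral_add h3.1 h1.1
    _ ≤ _ := by linarith [h1.2, h2.2, h3.2]

lemma inv_diff_bound {X Y : ℂ} (hX : X ≠ 0) (hY : Y ≠ 0) {b : ℝ} (hb : 0 ≤ b) (hb1 : b ≤ 1) :
    ‖X⁻¹ - Y⁻¹‖ ≤ ‖X - Y‖ ^ b * (‖X‖ ^ (-b) * ‖Y‖ ^ (-(1:ℝ)) + ‖X‖ ^ (-(1:ℝ)) * ‖Y‖ ^ (-b)) := by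
  have hx : 0 < ‖X‖ := norm_pos_iff.mpr hX
  have hy : 0 < ‖Y‖ := norm_pos_iff.mpr hY
  have e : X⁻¹ - Y⁻¹ = (Y - X) * (X⁻¹ * Y⁻¹) := by field_simp
  have h1 : ‖X - Y‖ = ‖X - Y‖ ^ b * ‖X - Y‖ ^ (1 - b) := by
    rw [← Real.rpow_add_of_nonneg (norm_nonneg _) hb (by linarith)]; simp
  have h2 : ‖X - Y‖ ^ (1 - b) ≤ ‖X‖ ^ (1 - b) + ‖Y‖ ^ (1 - b) := by
    calc ‖X - Y‖ ^ (1 - b) ≤ (‖X‖ + ‖Y‖) ^ (1 - b) :=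
          Real.rpow_le_rpow (norm_nonneg _) (norm_sub_le _ _) (by linarith)
      _ ≤ _ := Real.rpow_add_le_add_rpow hx.le hy.le (by linarith) (by linarith)
  have h3 : ∀ t : ℝ, 0 < t → t ^ (1 - b) * t⁻¹ = t ^ (-b) := by
    intro t ht
    rw [← Real.rpow_neg_one, ← Real.rpow_add ht]; ring_nf
  rw [e, norm_mul, norm_mul, norm_inv, norm_inv, norm_sub_rev, Real.rpow_neg_one,
    Real.rpow_neg_one, ← h3 _ hx, ← h3 _ hy]
  calc ‖X - Y‖ * (‖X‖⁻¹ * ‖Y‖⁻¹) = ‖X - Y‖ ^ b * ‖X - Y‖ ^ (1 - b) * (‖X‖⁻¹ * ‖Y‖⁻¹) := by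
        rw [← h1]
    _ ≤ ‖X - Y‖ ^ b * (‖X‖ ^ (1 - b) + ‖Y‖ ^ (1 - b)) * (‖X‖⁻¹ * ‖Y‖⁻¹) := by gcongr
    _ = _ := by ring

/-- Cauchy transform (unnormalised) -/
def CT (G : ℂ → ℂ) (z : ℂ) : ℂ := ∫ ζ, G ζ * (z - ζ)⁻¹

lemma CT_integrable {G : ℂ → ℂ} {a R C : ℝ} (ha : 0 ≤ a) (ha1 : a < 1) (hR : 0 ≤ R)
    (hm : AEStronglyMeasurable G) (hs : ∀ ζ, ζ ∉ closedBall (0:ℂ) R → G ζ = 0)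
    (hb : ∀ ζ, ζ ≠ 0 → ‖G ζ‖ ≤ C * ‖ζ‖ ^ (-a)) {z : ℂ} (hz : z ∈ closedBall (0:ℂ) R) :
    Integrable (fun ζ => G ζ * (z - ζ)⁻¹) := by
  have hsupp : Function.support (fun ζ => G ζ * (z - ζ)⁻¹) ⊆ closedBall (0:ℂ) R := by
    intro ζ hζ
    by_contra h
    exact hζ (by simp [hs ζ h])
  rw [← integrableOn_iff_integrable_of_support_subset hsupp]
  obtain ⟨M, hM, h⟩ := three_sing (a := a) (b := 1) (c := 0) ha zero_le_one le_rfl (by linarith) R hR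
  refine Integrable.mono' ((h z hz z hz).1.const_mul C) ?_ ?_
  · apply AEStronglyMeasurable.restrict
    exact hm.mul (Measurable.aestronglyMeasurable (by fun_prop))
  · have : ∀ᵐ ζ : ℂ, ζ ≠ 0 := by simp [ae_iff]
    filter_upwards [ae_restrict_of_ae this] with ζ hζ
    rw [norm_mul, norm_inv, Real.rpow_neg_one]
    simp only [neg_zero, Real.rpow_zero, mul_one, ← mul_assoc]
    exact mul_le_mul_of_nonneg_right (hb ζ hζ) (by positivity)

lemma CT_holder {G : ℂ → ℂ} {a b R C : ℝ} (ha : 0 ≤ a) (hb0 : 0 < b) (hab : a + b < 1) (hR : 0 ≤ R)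
    (hm : AEStronglyMeasurable G) (hs : ∀ ζ, ζ ∉ closedBall (0:ℂ) R → G ζ = 0)
    (hb : ∀ ζ, ζ ≠ 0 → ‖G ζ‖ ≤ C * ‖ζ‖ ^ (-a)) :
    ∃ M, 0 ≤ M ∧ ∀ z ∈ closedBall (0:ℂ) R, ∀ z' ∈ closedBall (0:ℂ) R,
      ‖CT G z - CT G z'‖ ≤ M * ‖z - z'‖ ^ b := by
  obtain ⟨M1, hM1, h1⟩ := three_sing (a := a) (b := b) (c := 1) ha hb0.le zero_le_one
    (by linarith) R hR
  obtain ⟨M2, hM2, h2⟩ := three_sing (a := a) (b := 1) (c := b) ha zero_le_one hb0.le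
    (by linarith) R hR
  have hC : 0 ≤ C := by
    have := hb 1 one_ne_zero
    simp at this
    exact (norm_nonneg _).trans this
  refine ⟨C * (M1 + M2), by positivity, fun z hz z' hz' => ?_⟩
  unfold CT
  have i1 := CT_integrable ha (by linarith) hR hm hs hb hz
  have i2 := CT_integrable ha (by linarith) hR hm hs hb hz'
  rw [← integral_sub i1 i2]
  have hsupp : Function.support (fun ζ => G ζ * (z - ζ)⁻¹ - G ζ * (z' - ζ)⁻¹) ⊆
      closedBall (0:ℂ) R := by
    intro ζ hζ
    by_contra h
    exact hζ (by simp [hs ζ h])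
  rw [← setIntegral_eq_integral_of_forall_compl_eq_zero
    (fun ζ hζ => by simpa using fun h => hζ (hsupp h))]
  have hp := ((h1 z hz z' hz').1.add (h2 z hz z' hz').1).const_mul (C * ‖z - z'‖ ^ b)
  calc _ ≤ ∫ ζ in closedBall (0:ℂ) R, (C * ‖z - z'‖ ^ b) *
        (‖ζ‖ ^ (-a) * (‖z - ζ‖ ^ (-b) * ‖z' - ζ‖ ^ (-(1:ℝ))) +
          ‖ζ‖ ^ (-a) * (‖z - ζ‖ ^ (-(1:ℝ)) * ‖z' - ζ‖ ^ (-b))) := by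
        refine norm_integral_le_of_norm_le hp ?_
        have n0 : ∀ w : ℂ, ∀ᵐ ζ : ℂ, ζ ≠ w := by intro w; simp [ae_iff]
        filter_upwards [ae_restrict_of_ae (n0 0), ae_restrict_of_ae (n0 z),
          ae_restrict_of_ae (n0 z')] with ζ k0 k1 k2
        rw [← mul_sub, norm_mul]
        have k3 := inv_diff_bound (X := z - ζ) (Y := z' - ζ) (sub_ne_zero.mpr k1.symm)
          (sub_ne_zero.mpr k2.symm) hb0.le (by linarith)
        rw [sub_sub_sub_cancel_right] at k3
        calc _ ≤ (C * ‖ζ‖ ^ (-a)) * _ := mul_le_mul (hb ζ k0) k3 (norm_nonneg _) (by positivity)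
          _ = _ := by ring
    _ = (C * ‖z - z'‖ ^ b) *
        ((∫ ζ in closedBall (0:ℂ) R, ‖ζ‖ ^ (-a) * (‖z - ζ‖ ^ (-b) * ‖z' - ζ‖ ^ (-(1:ℝ)))) +
         ∫ ζ in closedBall (0:ℂ) R, ‖ζ‖ ^ (-a) * (‖z - ζ‖ ^ (-(1:ℝ)) * ‖z' - ζ‖ ^ (-b))) := by
        rw [integral_const_mul]
        congr 1
        exact integral_add (h1 z hz z' hz').1 (h2 z hz z' hz').1
    _ ≤ (C * ‖z - z'‖ ^ b) * (M1 + M2) := by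
        gcongr
        · exact (h1 z hz z' hz').2
        · exact (h2 z hz z' hz').2
    _ = _ := by ring

lemma integrable_c0 : Integrable (fun ξ : ℂ => ((1 + ‖ξ‖ ^ 2) ^ 2)⁻¹) := by
  have := integrable_rpow_neg_one_add_norm_sq (E := ℂ) (μ := volume) (r := 4) (by simp; norm_num)
  refine this.congr (Eventually.of_forall fun x => ?_)
  have h : 0 ≤ 1 + ‖x‖ ^ 2 := by positivity
  simp only
  rw [show (-4 / 2 : ℝ) = -(2:ℕ) by norm_num, Real.rpow_neg h, Real.rpow_natCast]

/-- normalising constant of the Cauchy kernel (it is `π`) -/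
def c0 : ℝ := ∫ ξ : ℂ, ((1 + ‖ξ‖ ^ 2) ^ 2)⁻¹

lemma c0_pos : 0 < c0 := by
  unfold c0
  rw [integral_pos_iff_support_of_nonneg (fun ξ => by positivity) integrable_c0]
  have : Function.support (fun ξ : ℂ => ((1 + ‖ξ‖ ^ 2) ^ 2)⁻¹) = Set.univ := by
    ext ξ
    simp only [Function.mem_support, Set.mem_univ, iff_true]
    positivity
  rw [this]
  simp

lemma c0_ne : (c0 : ℂ) ≠ 0 := by exact_mod_cast c0_pos.ne'

/-- regularised Cauchy kernel -/
def kReg (ε : ℝ) (ζ : ℂ) : ℂ := conj ζ * (ζ * conj ζ + (ε : ℂ) ^ 2)⁻¹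

lemma kReg_den {ε : ℝ} (ζ : ℂ) : ζ * conj ζ + (ε : ℂ) ^ 2 = ((‖ζ‖ ^ 2 + ε ^ 2 : ℝ) : ℂ) := by
  rw [Complex.mul_conj, Complex.normSq_eq_norm_sq]; push_cast; ring

lemma kReg_den_ne {ε : ℝ} (hε : 0 < ε) (ζ : ℂ) : ζ * conj ζ + (ε : ℂ) ^ 2 ≠ 0 := by
  rw [kReg_den]
  have : 0 < ‖ζ‖ ^ 2 + ε ^ 2 := by positivity
  exact_mod_cast this.ne'

lemma contDiff_conj' {n : WithTop ℕ∞} : ContDiff ℝ n (fun z : ℂ => conj z) :=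
  Complex.conjCLE.contDiff

lemma contDiff_kReg {ε : ℝ} (hε : 0 < ε) : ContDiff ℝ 1 (kReg ε) := by
  unfold kReg
  refine contDiff_conj'.mul (ContDiff.inv ?_ (kReg_den_ne hε))
  exact (contDiff_id.mul contDiff_conj').add contDiff_const

lemma dbar_kReg {ε : ℝ} (hε : 0 < ε) (ζ : ℂ) :
    dbar (kReg ε) ζ = (ε:ℂ) ^ 2 * ((ζ * conj ζ + (ε : ℂ) ^ 2) ^ 2)⁻¹ := by
  have hN := kReg_den_ne hε ζ
  have d1 : DifferentiableAt ℝ (kReg ε) ζ := (contDiff_kReg hε).differentiable one_ne_zero ζ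
  have dc : DifferentiableAt ℝ (fun z : ℂ => conj z) ζ :=
    (contDiff_conj' (n := 1)).differentiable one_ne_zero ζ
  have d2 : DifferentiableAt ℝ (fun ζ : ℂ => ζ * conj ζ) ζ := differentiableAt_id.mul dc
  have d3 : DifferentiableAt ℝ (fun ζ : ℂ => ζ * conj ζ + (ε : ℂ) ^ 2) ζ := d2.add_const _
  have e1 : dbar (fun x => kReg ε x * (x * conj x + (ε : ℂ) ^ 2)) ζ = 1 := by
    rw [← dbar_conj ζ]
    apply dbar_congr
    apply Eventually.of_forall
    intro x
    simp only [kReg]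
    rw [mul_assoc, inv_mul_cancel₀ (kReg_den_ne hε x), mul_one]
  have e2 : dbar (fun x : ℂ => x * conj x + (ε : ℂ) ^ 2) ζ = ζ := by
    rw [dbar_add d2 (differentiableAt_const _), dbar_const,
      dbar_mul (F := fun x => x) (G := fun x => conj x) differentiableAt_id dc, dbar_conj,
      dbar_holo (F := fun x => x) differentiableAt_id]
    ring
  rw [dbar_mul d1 d3, e2] at e1
  have : kReg ε ζ = conj ζ * (ζ * conj ζ + (ε : ℂ) ^ 2)⁻¹ := rfl
  rw [this] at e1
  field_simp at e1 ⊢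
  linear_combination e1

lemma rep_zero_eps {V : ℂ → ℂ} (hV : ContDiff ℝ 1 V) (hc : HasCompactSupport V) {ε : ℝ}
    (hε : 0 < ε) : ∫ ζ, dbar V ζ * kReg ε ζ =
      - ∫ ξ : ℂ, V (ε • ξ) * (((1 + ‖ξ‖ ^ 2) ^ 2)⁻¹ : ℝ) := by
  have h := integral_mul_dbar hV hc isOpen_univ (Set.subset_univ _) (contDiff_kReg hε).contDiffOn
  have e := Measure.integral_comp_smul (μ := (volume : Measure ℂ))
    (fun ζ => V ζ * dbar (kReg ε) ζ) ε
  rw [h] at e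
  have e2 : ∀ ξ : ℂ, V (ε • ξ) * dbar (kReg ε) (ε • ξ) =
      ((ε:ℂ) ^ 2)⁻¹ * (V (ε • ξ) * (((1 + ‖ξ‖ ^ 2) ^ 2)⁻¹ : ℝ)) := by
    intro ξ
    rw [dbar_kReg hε, kReg_den]
    have : (0:ℝ) < 1 + ‖ξ‖ ^ 2 := by positivity
    have h1 : ‖ε • ξ‖ ^ 2 + ε ^ 2 = ε ^ 2 * (1 + ‖ξ‖ ^ 2) := by
      rw [norm_smul, Real.norm_of_nonneg hε.le]; ring
    rw [h1]
    have h2 : ((1 + ‖ξ‖ ^ 2 : ℝ) : ℂ) ≠ 0 := by exact_mod_cast this.ne'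
    have h3 : (ε : ℂ) ≠ 0 := by exact_mod_cast hε.ne'
    push_cast at h2 ⊢
    field_simp
  simp_rw [e2] at e
  rw [integral_const_mul] at e
  have h3 : (ε : ℂ) ≠ 0 := by exact_mod_cast hε.ne'
  simp only [Complex.finrank_real_complex, abs_inv, abs_of_pos (pow_pos hε 2)] at e
  rw [Complex.real_smul] at e
  push_cast at e
  have h4 := mul_left_cancel₀ (inv_ne_zero (pow_ne_zero 2 h3)) e
  push_cast
  rw [h4, neg_neg]

lemma kReg_norm_le (ε : ℝ) (ζ : ℂ) : ‖kReg ε ζ‖ ≤ ‖ζ‖⁻¹ := by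
  rw [kReg, kReg_den, norm_mul, norm_inv, Complex.norm_conj, Complex.norm_real,
    Real.norm_of_nonneg (by positivity)]
  rcases eq_or_ne ζ 0 with rfl | h
  · simp
  have : 0 < ‖ζ‖ := norm_pos_iff.mpr h
  rw [← div_eq_mul_inv, div_le_iff₀ (by positivity), ← div_eq_inv_mul, le_div_iff₀ this]
  nlinarith [sq_nonneg ε]

lemma rep_zero {V : ℂ → ℂ} (hV : ContDiff ℝ 1 V) (hc : HasCompactSupport V) :
    ∫ ζ, dbar V ζ * ζ⁻¹ = - (c0 * V 0) := by
  have t1 : Tendsto (fun ε : ℝ => ∫ ζ, dbar V ζ * kReg ε ζ) (𝓝[>] 0) (𝓝 (∫ ζ, dbar V ζ * ζ⁻¹)) := by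
    have hn : LocallyIntegrable (fun ζ : ℂ => ‖ζ‖⁻¹) := by
      have := locInt_norm_rpow (σ := 1) (by norm_num)
      simpa only [Real.rpow_neg_one] using this
    have hbound : Integrable (fun ζ : ℂ => ‖ζ‖⁻¹ • ‖dbar V ζ‖) :=
      hn.integrable_smul_right_of_hasCompactSupport (continuous_dbar hV).norm hc.dbar'.norm
    refine tendsto_integral_filter_of_dominated_convergence _ ?_ ?_ hbound ?_
    · filter_upwards [self_mem_nhdsWithin] with ε hε
      exact ((continuous_dbar hV).mul (contDiff_kReg hε).continuous).aestronglyMeasurable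
    · refine Eventually.of_forall fun ε => Eventually.of_forall fun ζ => ?_
      rw [norm_mul, smul_eq_mul, mul_comm]
      exact mul_le_mul_of_nonneg_right (kReg_norm_le ε ζ) (norm_nonneg _)
    · have : ∀ᵐ ζ : ℂ, ζ ≠ 0 := by simp [ae_iff]
      filter_upwards [this] with ζ hζ
      apply Tendsto.const_mul
      have hz : conj ζ ≠ 0 := by simpa using hζ
      have e : ζ⁻¹ = conj ζ * (ζ * conj ζ + ((0:ℝ) : ℂ) ^ 2)⁻¹ := by
        simp; field_simp
      rw [e]
      unfold kReg
      apply Tendsto.const_mul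
      apply Tendsto.inv₀
      · apply Tendsto.mono_left _ nhdsWithin_le_nhds
        exact Continuous.tendsto (by fun_prop) 0
      · simp [hζ]
  have t2 : Tendsto (fun ε : ℝ => - ∫ ξ : ℂ, V (ε • ξ) * (((1 + ‖ξ‖ ^ 2) ^ 2)⁻¹ : ℝ)) (𝓝[>] 0)
      (𝓝 (- ∫ ξ : ℂ, V 0 * (((1 + ‖ξ‖ ^ 2) ^ 2)⁻¹ : ℝ))) := by
    apply Tendsto.neg
    obtain ⟨M, hM⟩ := hV.continuous.bounded_above_of_compact_support hc
    refine tendsto_integral_filter_of_dominated_convergence (fun ξ => M * ((1 + ‖ξ‖ ^ 2) ^ 2)⁻¹)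
      ?_ ?_ (integrable_c0.const_mul M) ?_
    · refine Eventually.of_forall fun ε => ?_
      have hc : Continuous (fun ξ : ℂ => (((1 + ‖ξ‖ ^ 2) ^ 2)⁻¹ : ℝ)) := by
        apply Continuous.inv₀ (by fun_prop)
        intro x; positivity
      exact ((hV.continuous.comp (continuous_const_smul ε)).mul
        (Complex.continuous_ofReal.comp hc)).aestronglyMeasurable
    · refine Eventually.of_forall fun ε => Eventually.of_forall fun ζ => ?_
      rw [norm_mul, Complex.norm_real, Real.norm_of_nonneg (by positivity)]
      exact mul_le_mul_of_nonneg_right (hM _) (by positivity)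
    · refine Eventually.of_forall fun ξ => ?_
      apply Tendsto.mul_const
      apply Tendsto.mono_left _ nhdsWithin_le_nhds
      have : Continuous (fun ε : ℝ => V (ε • ξ)) := hV.continuous.comp (by fun_prop)
      simpa using this.tendsto 0
  have t3 : Tendsto (fun ε : ℝ => ∫ ζ, dbar V ζ * kReg ε ζ) (𝓝[>] 0)
      (𝓝 (- ∫ ξ : ℂ, V 0 * (((1 + ‖ξ‖ ^ 2) ^ 2)⁻¹ : ℝ))) := by
    refine t2.congr' ?_
    filter_upwards [self_mem_nhdsWithin] with ε hε
    exact (rep_zero_eps hV hc hε).symm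
  rw [tendsto_nhds_unique t1 t3, integral_const_mul, integral_complex_ofReal, c0]
  ring

lemma rep_smooth {W : ℂ → ℂ} (hW : ContDiff ℝ 1 W) (hc : HasCompactSupport W) (z : ℂ) :
    CT (dbar W) z = c0 * W z := by
  have e0 : (fun x => W (z + ((-1:ℝ):ℂ) * x)) = fun x => W (z - x) := by
    funext x; push_cast; ring_nf
  have h1 : ContDiff ℝ 1 (fun x => W (z - x)) := hW.comp (contDiff_const.sub contDiff_id)
  have h2 : HasCompactSupport (fun x => W (z - x)) :=
    hc.comp_homeomorph (Homeomorph.subLeft z)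
  have h3 := rep_zero h1 h2
  have h4 : ∀ ζ, dbar (fun x => W (z - x)) ζ = - dbar W (z - ζ) := by
    intro ζ
    have := dbar_affine (F := W) (z := z) (ξ := ζ) (-1) (hW.differentiable one_ne_zero _)
    rw [e0] at this
    rw [this]
    push_cast; ring_nf
  simp_rw [h4] at h3
  have h5 := integral_sub_left_eq_self (fun ζ => dbar W ζ * (z - ζ)⁻¹) volume z
  unfold CT
  rw [← h5]
  simp only [sub_sub_cancel]
  simp only [neg_mul, integral_neg, sub_zero] at h3
  linear_combination -h3

/-- standard real bump -/
def bmpR : ContDiffBump (0:ℂ) := ⟨1, 3/2, by norm_num, by norm_num⟩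

/-- scaled complex valued bump: 1 on `‖s ζ‖ ≤ 1`, 0 for `‖s ζ‖ ≥ 3/2` -/
def cut (s : ℝ) (ζ : ℂ) : ℂ := (bmpR (s * ζ) : ℝ)

lemma contDiff_cut (s : ℝ) {n : ℕ∞} : ContDiff ℝ n (cut s) := by
  unfold cut
  exact Complex.ofRealCLM.contDiff.comp (bmpR.contDiff.comp (contDiff_const.mul contDiff_id))

lemma contDiff_cut1 (s : ℝ) : ContDiff ℝ 1 (cut s) := contDiff_cut s (n := 1)

lemma cut_eq_one {s : ℝ} {ζ : ℂ} (hs : 0 ≤ s) (h : s * ‖ζ‖ ≤ 1) : cut s ζ = 1 := by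
  unfold cut
  rw [bmpR.one_of_mem_closedBall]
  · simp
  · simp [bmpR, abs_of_nonneg hs, h]

lemma cut_eq_zero {s : ℝ} {ζ : ℂ} (hs : 0 ≤ s) (h : 3/2 ≤ s * ‖ζ‖) : cut s ζ = 0 := by
  unfold cut
  rw [bmpR.zero_of_le_dist]
  · simp
  · simp [bmpR, abs_of_nonneg hs, h]

lemma cut_norm_le (s : ℝ) (ζ : ℂ) : ‖cut s ζ‖ ≤ 1 := by
  unfold cut
  rw [Complex.norm_real, Real.norm_of_nonneg bmpR.nonneg]
  exact bmpR.le_one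

lemma cut_scale (s : ℝ) (ζ : ℂ) : cut s ζ = cut 1 (s * ζ) := by simp [cut]

lemma cut_hcs : HasCompactSupport (cut 1) := by
  apply HasCompactSupport.of_support_subset_isCompact (isCompact_closedBall (0:ℂ) (3/2))
  intro ζ hζ
  by_contra h
  apply hζ
  apply cut_eq_zero zero_le_one
  simp at h; linarith

lemma dbar_cut (s : ℝ) (ζ : ℂ) : dbar (cut s) ζ = s * dbar (cut 1) (s * ζ) := by
  have := dbar_affine (F := cut 1) (z := 0) (ξ := ζ) s ((contDiff_cut1 1).differentiable one_ne_zero _)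
  simp only [zero_add, ← cut_scale] at this
  exact this

lemma dbar_cut_bound : ∃ M, 0 ≤ M ∧ ∀ ζ, ‖dbar (cut 1) ζ‖ ≤ M := by
  obtain ⟨M, hM⟩ := (continuous_dbar (contDiff_cut1 1)).bounded_above_of_compact_support cut_hcs.dbar'
  exact ⟨M, (norm_nonneg _).trans (hM 0), hM⟩

lemma cut_eventually_one {s : ℝ} {ζ : ℂ} (hs : 0 ≤ s) (h : s * ‖ζ‖ < 1) : cut s =ᶠ[𝓝 ζ] fun _ => 1 := by
  have : ∀ᶠ x in 𝓝 ζ, s * ‖x‖ < 1 :=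
    ContinuousAt.eventually_lt (f := fun x : ℂ => s * ‖x‖) (by fun_prop) (by fun_prop) h
  filter_upwards [this] with x hx using cut_eq_one hs hx.le

lemma cut_eventually_zero {s : ℝ} {ζ : ℂ} (hs : 0 ≤ s) (h : 3/2 < s * ‖ζ‖) :
    cut s =ᶠ[𝓝 ζ] fun _ => 0 := by
  have : ∀ᶠ x in 𝓝 ζ, 3/2 < s * ‖x‖ :=
    ContinuousAt.eventually_lt (g := fun x : ℂ => s * ‖x‖) (by fun_prop) (by fun_prop) h
  filter_upwards [this] with x hx using cut_eq_zero hs hx.le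

lemma dbar_cut_zero {s : ℝ} {ζ : ℂ} (hs : 0 ≤ s) (h : 3/2 < s * ‖ζ‖) : dbar (cut s) ζ = 0 := by
  rw [dbar_congr (cut_eventually_zero hs h), dbar_const]

lemma dbar_cut_zero' {s : ℝ} {ζ : ℂ} (hs : 0 ≤ s) (h : s * ‖ζ‖ < 1) : dbar (cut s) ζ = 0 := by
  rw [dbar_congr (cut_eventually_one hs h), dbar_const]

lemma measurable_dbar (F : ℂ → ℂ) : Measurable (dbar F) := by
  unfold dbar
  exact ((measurable_fderiv_apply_const ℝ F 1).add
    ((measurable_fderiv_apply_const ℝ F Complex.I).const_mul _)).div_const 2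

lemma ae_ne (w : ℂ) : ∀ᵐ ζ : ℂ, ζ ≠ w := by simp [ae_iff]

lemma rep_sing {W : ℂ → ℂ} {a R C : ℝ} (ha : 0 ≤ a) (ha1 : a < 1) (hR : 0 < R)
    (hW : ContDiffOn ℝ 1 W {0}ᶜ) (hs : ∀ ζ, ζ ∉ closedBall (0:ℂ) R → W ζ = 0)
    (hb : ∀ ζ, ζ ≠ 0 → ‖W ζ‖ ≤ C * ‖ζ‖ ^ (-a))
    (hb' : ∀ ζ, ζ ≠ 0 → ‖dbar W ζ‖ ≤ C * ‖ζ‖ ^ (-a)) {z : ℂ} (hz : z ≠ 0) (hzR : z ∈ closedBall (0:ℂ) R) :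
    CT (dbar W) z = c0 * W z := by
  have hC : 0 ≤ C := by
    have := hb 1 one_ne_zero
    simp at this
    exact (norm_nonneg _).trans this
  obtain ⟨M, hM, hMb⟩ := dbar_cut_bound
  have hz0 : 0 < ‖z‖ := norm_pos_iff.mpr hz
  have hop : IsOpen ({0}ᶜ : Set ℂ) := isOpen_compl_singleton
  have hds : ∀ ζ, ζ ∉ closedBall (0:ℂ) R → dbar W ζ = 0 := by
    intro ζ hζ
    have : W =ᶠ[𝓝 ζ] fun _ => 0 := by
      filter_upwards [isClosed_closedBall.isOpen_compl.mem_nhds hζ] with x hx using hs x hx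
    rw [dbar_congr this, dbar_const]
  set We : ℝ → ℂ → ℂ := fun s ζ => (1 - cut s ζ) * W ζ with hWe
  have hcd : ∀ s, 0 < s → ContDiff ℝ 1 (We s) := by
    intro s hs
    rw [contDiff_iff_contDiffAt]
    intro ζ
    rcases eq_or_ne ζ 0 with rfl | hζ
    · have : We s =ᶠ[𝓝 0] fun _ => 0 := by
        filter_upwards [cut_eventually_one hs.le (ζ := 0) (by simp)] with x hx
        simp [hWe, hx]
      exact contDiffAt_const.congr_of_eventuallyEq this
    · exact (contDiffAt_const.sub (contDiff_cut1 s).contDiffAt).mul (hW.contDiffAt (hop.mem_nhds hζ))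
  have hcs : ∀ s, HasCompactSupport (We s) := by
    intro s
    apply HasCompactSupport.of_support_subset_isCompact (isCompact_closedBall (0:ℂ) R)
    intro ζ hζ
    by_contra h
    exact hζ (by simp [hWe, hs ζ h])
  have hdb : ∀ s ζ, 0 < s → ζ ≠ 0 → dbar (We s) ζ =
      - (s * dbar (cut 1) (s * ζ)) * W ζ + (1 - cut s ζ) * dbar W ζ := by
    intro s ζ hs hζ
    have dc := (contDiff_cut1 s).differentiable one_ne_zero ζ
    have dW := (hW.contDiffAt (hop.mem_nhds hζ)).differentiableAt one_ne_zero
    rw [hWe]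
    simp only
    rw [dbar_mul (F := fun x => 1 - cut s x) ((differentiableAt_const _).sub dc) dW, dbar_sub (differentiableAt_const _) dc,
      dbar_const, dbar_cut]
    ring
  have hrep : ∀ s, 0 < s → CT (dbar (We s)) z = c0 * We s z := fun s hs =>
    rep_smooth (hcd s hs) (hcs s) z
  have t1 : Tendsto (fun s => c0 * We s z) atTop (𝓝 (c0 * W z)) := by
    apply tendsto_const_nhds.congr'
    filter_upwards [eventually_ge_atTop (3 / 2 / ‖z‖), eventually_ge_atTop 0] with s hs h0
    rw [hWe]
    simp only
    rw [cut_eq_zero h0 (by rwa [div_le_iff₀ hz0] at hs)]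
    simp
  have iW := CT_integrable ha ha1 hR.le (measurable_dbar W).aestronglyMeasurable hds hb' hzR
  have i2 : Integrable ((closedBall (0:ℂ) R).indicator fun ζ =>
      (3 / 2 * M * C * (2 / ‖z‖)) * ‖ζ‖ ^ (-(a+1))) := by
    rw [integrable_indicator_iff measurableSet_closedBall]
    exact ((locInt_norm_rpow (by linarith)).integrableOn_isCompact (isCompact_closedBall _ _)).const_mul _
  have t2 : Tendsto (fun s => CT (dbar (We s)) z) atTop (𝓝 (CT (dbar W) z)) := by
    unfold CT
    refine tendsto_integral_filter_of_dominated_convergence _ ?_ ?_ (i2.add iW.norm) ?_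
    · refine Eventually.of_forall fun s => ?_
      exact ((measurable_dbar _).mul (by fun_prop)).aestronglyMeasurable
    · filter_upwards [eventually_ge_atTop (3 / ‖z‖), eventually_gt_atTop 0] with s hs3 h0
      filter_upwards [ae_ne 0] with ζ hζ
      have hζ0 : 0 < ‖ζ‖ := norm_pos_iff.mpr hζ
      rw [hdb s ζ h0 hζ, add_mul, Pi.add_apply]
      refine (norm_add_le _ _).trans (add_le_add ?_ ?_)
      · by_cases h1 : ζ ∈ closedBall (0:ℂ) R
        swap
        · rw [hs ζ h1]
          simp
          exact Set.indicator_nonneg (fun _ _ => by positivity) _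
        rw [Set.indicator_of_mem h1]
        by_cases h2 : s * ‖ζ‖ ≤ 3 / 2
        swap
        · have : dbar (cut 1) (s * ζ) = 0 := by
            apply dbar_cut_zero zero_le_one
            rw [norm_mul, Complex.norm_real, Real.norm_of_nonneg h0.le]; linarith
          rw [this]; simp; positivity
        have h3 : s ≤ 3 / 2 * ‖ζ‖⁻¹ := by rw [← div_eq_mul_inv, le_div_iff₀ hζ0]; exact h2
        have h4 : ‖z‖ / 2 ≤ ‖z - ζ‖ := by
          have : ‖z‖ - ‖ζ‖ ≤ ‖z - ζ‖ := norm_sub_norm_le _ _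
          have : ‖ζ‖ ≤ ‖z‖ / 2 := by
            rw [div_le_iff₀ hz0] at hs3
            have h5 : s * ‖ζ‖ ≤ s * (‖z‖ / 2) := by linarith
            exact le_of_mul_le_mul_left h5 h0
          linarith
        have h5 : ‖z - ζ‖⁻¹ ≤ 2 / ‖z‖ := by
          rw [show 2 / ‖z‖ = (‖z‖ / 2)⁻¹ by simp]
          exact inv_anti₀ (by positivity) h4
        rw [norm_mul, norm_mul, norm_neg, norm_mul, norm_inv, Complex.norm_real, Real.norm_of_nonneg h0.le]
        calc s * ‖dbar (cut 1) (s * ζ)‖ * ‖W ζ‖ * ‖z - ζ‖⁻¹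
            ≤ (3 / 2 * ‖ζ‖⁻¹) * M * (C * ‖ζ‖ ^ (-a)) * (2 / ‖z‖) := by
              gcongr
              · exact hMb _
              · exact hb ζ hζ
          _ = _ := by
              rw [show -(a + 1) = -a + -1 by ring, Real.rpow_add hζ0, Real.rpow_neg_one]; ring
      · rw [mul_assoc, norm_mul]
        apply mul_le_of_le_one_left (norm_nonneg _)
        unfold cut
        rw [← Complex.ofReal_one, ← Complex.ofReal_sub, Complex.norm_real, Real.norm_of_nonneg]
        · linarith [bmpR.nonneg (x := s * ζ)]
        · linarith [bmpR.le_one (x := s * ζ)]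
    · filter_upwards [ae_ne 0] with ζ hζ
      apply Tendsto.mul_const
      apply tendsto_const_nhds.congr'
      have hζ0 : 0 < ‖ζ‖ := norm_pos_iff.mpr hζ
      filter_upwards [eventually_gt_atTop (3 / 2 / ‖ζ‖), eventually_gt_atTop 0] with s hs h0
      rw [div_lt_iff₀ hζ0] at hs
      have := dbar_cut_zero h0.le hs
      rw [dbar_cut] at this
      rw [hdb s ζ h0 hζ, this, cut_eq_zero h0.le hs.le]
      ring
  refine tendsto_nhds_unique t2 (t1.congr' ?_)
  filter_upwards [eventually_gt_atTop 0] with s hs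
  exact (hrep s hs).symm

/-- punctured ball -/
def pB (R : ℝ) : Set ℂ := ball 0 R \ {0}

lemma mem_pB {R : ℝ} {z : ℂ} : z ∈ pB R ↔ ‖z‖ < R ∧ z ≠ 0 := by simp [pB]

lemma isOpen_pB (R : ℝ) : IsOpen (pB R) := isOpen_ball.sdiff isClosed_singleton

lemma pB_mono {R R' : ℝ} (h : R ≤ R') : pB R ⊆ pB R' := fun z hz => by
  rw [mem_pB] at *; exact ⟨hz.1.trans_le h, hz.2⟩

/-- the `dbar` of a cut off function -/
def cutG (R : ℝ) (W G : ℂ → ℂ) (ζ : ℂ) : ℂ := cut (2/R) ζ * G ζ + dbar (cut (2/R)) ζ * W ζ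

lemma cutG_zero {R : ℝ} (hR : 0 < R) (W G : ℂ → ℂ) {ζ : ℂ} (h : 3 / 4 * R < ‖ζ‖) : cutG R W G ζ = 0 := by
  have : 3 / 2 < 2 / R * ‖ζ‖ := by
    rw [div_mul_eq_mul_div, lt_div_iff₀ hR]; linarith
  rw [cutG, cut_eq_zero (by positivity) this.le, dbar_cut_zero (by positivity) this]; simp

lemma cut_W_contDiff {W : ℂ → ℂ} {R : ℝ} (hR : 0 < R) (hW : ContDiffOn ℝ 1 W (pB R)) :
    ContDiffOn ℝ 1 (fun ζ => cut (2/R) ζ * W ζ) {0}ᶜ := by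
  intro ζ hζ
  apply ContDiffAt.contDiffWithinAt
  by_cases h : ‖ζ‖ < R
  · exact (contDiff_cut1 _).contDiffAt.mul (hW.contDiffAt ((isOpen_pB R).mem_nhds (mem_pB.2 ⟨h, hζ⟩)))
  · have : (fun ζ => cut (2/R) ζ * W ζ) =ᶠ[𝓝 ζ] fun _ => 0 := by
      filter_upwards [cut_eventually_zero (s := 2/R) (ζ := ζ) (by positivity) (by
        rw [div_mul_eq_mul_div, lt_div_iff₀ hR]; linarith)] with x hx
      simp [hx]
    exact contDiffAt_const.congr_of_eventuallyEq this

lemma dbar_cut_W {W : ℂ → ℂ} {R : ℝ} (hR : 0 < R) (hW : ContDiffOn ℝ 1 W (pB R)) {ζ : ℂ} (hζ : ζ ≠ 0) :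
    dbar (fun ζ => cut (2/R) ζ * W ζ) ζ = cutG R W (dbar W) ζ := by
  by_cases h : ‖ζ‖ < R
  · rw [dbar_mul ((contDiff_cut1 _).differentiable one_ne_zero ζ)
      ((hW.contDiffAt ((isOpen_pB R).mem_nhds (mem_pB.2 ⟨h, hζ⟩))).differentiableAt one_ne_zero), cutG]
    ring
  · rw [cutG_zero hR _ _ (by linarith)]
    have : (fun ζ => cut (2/R) ζ * W ζ) =ᶠ[𝓝 ζ] fun _ => 0 := by
      filter_upwards [cut_eventually_zero (s := 2/R) (ζ := ζ) (by positivity) (by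
        rw [div_mul_eq_mul_div, lt_div_iff₀ hR]; linarith)] with x hx
      simp [hx]
    rw [dbar_congr this, dbar_const]

lemma CT_congr {G G' : ℂ → ℂ} (h : ∀ ζ, ζ ≠ 0 → G ζ = G' ζ) (z : ℂ) : CT G z = CT G' z := by
  apply integral_congr_ae
  filter_upwards [ae_ne 0] with ζ hζ
  rw [h ζ hζ]

lemma cutG_meas {W : ℂ → ℂ} {R : ℝ} (hR : 0 < R) (hW : ContDiffOn ℝ 1 W (pB R)) :
    AEStronglyMeasurable (cutG R W (dbar W)) := by
  refine (measurable_dbar (fun ζ => cut (2/R) ζ * W ζ)).aestronglyMeasurable.congr ?_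
  filter_upwards [ae_ne 0] with ζ hζ using dbar_cut_W hR hW hζ

lemma cutG_bound {R : ℝ} (hR : 0 < R) : ∃ M, 0 ≤ M ∧ ∀ (W G : ℂ → ℂ) (C a : ℝ),
    (∀ ζ ∈ pB R, ‖W ζ‖ ≤ C * ‖ζ‖ ^ (-a)) → (∀ ζ ∈ pB R, ‖G ζ‖ ≤ C * ‖ζ‖ ^ (-a)) →
    ∀ ζ, ζ ≠ 0 → ‖cutG R W G ζ‖ ≤ (C * M) * ‖ζ‖ ^ (-a) := by
  obtain ⟨M, hM, hMb⟩ := dbar_cut_bound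
  refine ⟨1 + 2 / R * M, by positivity, fun W G C a hb hb' ζ hζ => ?_⟩
  have hC : 0 ≤ C := by
    have hmem : ((R/2 : ℝ) : ℂ) ∈ pB R := by
      rw [mem_pB]
      refine ⟨?_, by exact_mod_cast (by positivity : R/2 ≠ 0)⟩
      rw [Complex.norm_real, Real.norm_of_nonneg (by positivity)]; linarith
    have h1 := (norm_nonneg _).trans (hb _ hmem)
    rw [Complex.norm_real, Real.norm_of_nonneg (by positivity)] at h1
    have : 0 < (R/2) ^ (-a) := by positivity
    exact nonneg_of_mul_nonneg_left h1 this
  by_cases h : ‖ζ‖ < R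
  · have m := mem_pB.2 ⟨h, hζ⟩
    rw [cutG, dbar_cut]
    calc _ ≤ ‖cut (2/R) ζ * G ζ‖ + ‖_‖ := norm_add_le _ _
      _ ≤ 1 * (C * ‖ζ‖ ^ (-a)) + (2/R) * M * (C * ‖ζ‖ ^ (-a)) := by
        rw [norm_mul, norm_mul, norm_mul, Complex.norm_real, Real.norm_of_nonneg (by positivity)]
        gcongr
        · exact cut_norm_le _ _
        · exact hb' ζ m
        · exact hMb _
        · exact hb ζ m
      _ = _ := by ring
  · rw [cutG_zero hR _ _ (by linarith)]
    simp; positivity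

lemma rep_cut {W : ℂ → ℂ} {a R C : ℝ} (ha : 0 ≤ a) (ha1 : a < 1) (hR : 0 < R)
    (hW : ContDiffOn ℝ 1 W (pB R)) (hb : ∀ ζ ∈ pB R, ‖W ζ‖ ≤ C * ‖ζ‖ ^ (-a))
    (hb' : ∀ ζ ∈ pB R, ‖dbar W ζ‖ ≤ C * ‖ζ‖ ^ (-a)) {z : ℂ} (hz : z ≠ 0) :
    CT (cutG R W (dbar W)) z = c0 * (cut (2/R) z * W z) := by
  obtain ⟨M, hM, hMb⟩ := cutG_bound hR
  rw [← CT_congr (fun ζ hζ => dbar_cut_W hR hW hζ)]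
  obtain ⟨M', hM', hMb'⟩ := cutG_bound hR
  have hC : 0 ≤ C := by
    have hmem : ((R/2 : ℝ) : ℂ) ∈ pB R := by
      rw [mem_pB]
      refine ⟨?_, by exact_mod_cast (by positivity : R/2 ≠ 0)⟩
      rw [Complex.norm_real, Real.norm_of_nonneg (by positivity)]; linarith
    have h1 := (norm_nonneg _).trans (hb _ hmem)
    rw [Complex.norm_real, Real.norm_of_nonneg (by positivity)] at h1
    have : 0 < (R/2) ^ (-a) := by positivity
    exact nonneg_of_mul_nonneg_left h1 this
  have hcz : ∀ ζ : ℂ, R ≤ ‖ζ‖ → cut (2/R) ζ = 0 := by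
    intro ζ hζ
    apply cut_eq_zero (by positivity)
    rw [div_mul_eq_mul_div, le_div_iff₀ hR]; linarith
  refine rep_sing (a := a) (R := max R ‖z‖) (C := max C (C * M)) ha ha1 (lt_max_of_lt_left hR)
    (cut_W_contDiff hR hW) ?_ ?_ ?_ hz (by simp)
  · intro ζ hζ
    simp only [mem_closedBall_zero_iff, not_le, max_lt_iff] at hζ
    rw [hcz ζ hζ.1.le]; simp
  · intro ζ hζ
    by_cases h : ‖ζ‖ < R
    · rw [norm_mul]
      calc _ ≤ 1 * (C * ‖ζ‖ ^ (-a)) := by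
            gcongr
            · exact cut_norm_le _ _
            · exact hb ζ (mem_pB.2 ⟨h, hζ⟩)
        _ ≤ _ := by
            rw [one_mul]; gcongr; exact le_max_left _ _
    · rw [hcz ζ (by linarith)]; simp
      exact mul_nonneg (hC.trans (le_max_left _ _)) (by positivity)
  · intro ζ hζ
    rw [dbar_cut_W hR hW hζ]
    refine (hMb W _ C a hb hb' ζ hζ).trans ?_
    gcongr; exact le_max_right _ _

/-- a function with mild singularity and mild `dbar` has a limit with a rate -/
lemma lemmaA {W : ℂ → ℂ} {a R C : ℝ} (ha : 0 ≤ a) (ha1 : a < 1) (hR : 0 < R)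
    (hW : ContDiffOn ℝ 1 W (pB R)) (hb : ∀ ζ ∈ pB R, ‖W ζ‖ ≤ C * ‖ζ‖ ^ (-a))
    (hb' : ∀ ζ ∈ pB R, ‖dbar W ζ‖ ≤ C * ‖ζ‖ ^ (-a)) :
    ∃ c : ℂ, ∃ C' : ℝ, 0 ≤ C' ∧ ∀ z ∈ pB (R/2), ‖W z - c‖ ≤ C' * ‖z‖ ^ ((1-a)/2) := by
  obtain ⟨M, hM, hMb⟩ := cutG_bound hR
  obtain ⟨M', hM', hh⟩ := CT_holder (a := a) (b := (1-a)/2) (R := R) ha (by linarith) (by linarith)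
    hR.le (cutG_meas hR hW) (fun ζ hζ => cutG_zero hR _ _ (by simp at hζ; linarith))
    (hMb W _ C a hb hb')
  refine ⟨c0⁻¹ * CT (cutG R W (dbar W)) 0, c0⁻¹ * M', by have := c0_pos; positivity, fun z hz => ?_⟩
  rw [mem_pB] at hz
  have h1 := rep_cut ha ha1 hR hW hb hb' hz.2
  rw [cut_eq_one (by positivity) (by rw [div_mul_eq_mul_div, div_le_iff₀ hR]; linarith), one_mul] at h1
  have h2 : W z = c0⁻¹ * CT (cutG R W (dbar W)) z := by
    rw [h1]; have := c0_ne; push_cast; field_simp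
  rw [h2, ← mul_sub, norm_mul, Complex.norm_real, Real.norm_of_nonneg (inv_nonneg.2 c0_pos.le), mul_assoc]
  have h3 := hh z (by simp; linarith) 0 (by simp [hR.le])
  rw [sub_zero] at h3
  have := c0_pos
  gcongr

open scoped ContDiff in
/-- admissible averaging kernels -/
def TestK (k : ℂ → ℂ) : Prop := ContDiff ℝ ∞ k ∧ ∀ ξ, 3/4 < ‖ξ‖ → k ξ = 0

/-- local average at scale `ρ` -/
def Av (k F : ℂ → ℂ) (z : ℂ) (ρ : ℝ) : ℂ := ∫ ξ, k ξ * F (z + ρ * ξ)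

lemma TestK.tsupport {k : ℂ → ℂ} (h : TestK k) : tsupport k ⊆ closedBall 0 (3/4) := by
  apply closure_minimal _ isClosed_closedBall
  intro ξ hξ
  by_contra h1
  simp at h1
  exact hξ (h.2 ξ h1)

lemma TestK.hcs {k : ℂ → ℂ} (h : TestK k) : HasCompactSupport k :=
  (isCompact_closedBall (0:ℂ) (3/4)).of_isClosed_subset (isClosed_tsupport _) h.tsupport

lemma TestK.dbar {k : ℂ → ℂ} (h : TestK k) : TestK (dbar k) := by
  refine ⟨ContDiff.dbar' h.1 (by exact le_rfl), fun ξ hξ => ?_⟩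
  apply dbar_eq_zero_of_notMem
  intro h1
  have := h.tsupport h1
  simp at this
  linarith

lemma TestK.conj {k : ℂ → ℂ} (h : TestK k) : TestK (fun ξ => conj (k ξ)) :=
  ⟨contDiff_conj'.comp h.1, fun ξ hξ => by simp [h.2 ξ hξ]⟩

lemma TestK.const_mul {k : ℂ → ℂ} (h : TestK k) (c : ℂ) : TestK (fun ξ => c * k ξ) :=
  ⟨contDiff_const.mul h.1, fun ξ hξ => by simp [h.2 ξ hξ]⟩

lemma TestK.C1 {k : ℂ → ℂ} (h : TestK k) : ContDiff ℝ 1 k := h.1.of_le (by exact_mod_cast le_top)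

lemma affine_mem {z ξ : ℂ} {ρ : ℝ} (hρ : 0 < ρ) (h : ‖ξ‖ < 1) : z + ρ * ξ ∈ ball z ρ := by
  simp [abs_of_pos hρ]; nlinarith

lemma Av_integrable {k F : ℂ → ℂ} {z : ℂ} {ρ : ℝ} (hk : TestK k) (hρ : 0 < ρ)
    (hF : ContinuousOn F (ball z ρ)) : Integrable (fun ξ => k ξ * F (z + ρ * ξ)) := by
  apply Continuous.integrable_of_hasCompactSupport _ hk.hcs.mul_right
  rw [continuous_iff_continuousAt]
  intro ξ
  by_cases h : ‖ξ‖ < 1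
  · refine hk.1.continuous.continuousAt.mul ?_
    have h2 : ContinuousAt F (z + ρ * ξ) := hF.continuousAt (isOpen_ball.mem_nhds (affine_mem hρ h))
    exact ContinuousAt.comp (f := fun ξ : ℂ => z + ρ * ξ) h2 (by fun_prop)
  · have : (fun ξ => k ξ * F (z + ρ * ξ)) =ᶠ[𝓝 ξ] fun _ => 0 := by
      have hn : ξ ∉ tsupport k := fun h1 => by
        have := hk.tsupport h1; simp at this; linarith
      filter_upwards [notMem_tsupport_iff_eventuallyEq.mp hn] with y hy
      simp [hy]
    exact continuousAt_const.congr this.symm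

lemma Av_bound {k : ℂ → ℂ} (hk : TestK k) : ∃ N, 0 ≤ N ∧ ∀ (F : ℂ → ℂ) (z : ℂ) (ρ B : ℝ), 0 < ρ →
    (∀ ζ ∈ ball z ρ, ‖F ζ‖ ≤ B) → ‖Av k F z ρ‖ ≤ N * B := by
  refine ⟨∫ ξ, ‖k ξ‖, integral_nonneg fun _ => norm_nonneg _, fun F z ρ B hρ hB => ?_⟩
  have hi : Integrable (fun ξ => ‖k ξ‖ * B) :=
    ((hk.1.continuous.integrable_of_hasCompactSupport hk.hcs).norm).mul_const B
  rw [← integral_mul_const]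
  refine norm_integral_le_of_norm_le hi (Eventually.of_forall fun ξ => ?_)
  rw [norm_mul]
  by_cases h : ‖ξ‖ < 1
  · gcongr; exact hB _ (affine_mem hρ h)
  · rw [hk.2 ξ (by linarith)]; simp

lemma Av_dbar {k F : ℂ → ℂ} {z : ℂ} {ρ : ℝ} (hk : TestK k) (hρ : 0 < ρ)
    (hF : ContDiffOn ℝ 1 F (ball z ρ)) : Av k (dbar F) z ρ = - (ρ⁻¹ : ℝ) * Av (dbar k) F z ρ := by
  have hmaps : Set.MapsTo (fun ξ : ℂ => z + ρ * ξ) (ball 0 1) (ball z ρ) :=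
    fun ξ hξ => affine_mem hρ (by simpa using hξ)
  have h1 : ContDiffOn ℝ 1 (fun ξ => F (z + ρ * ξ)) (ball 0 1) :=
    hF.comp (by fun_prop) hmaps
  have h2 := integral_mul_dbar hk.C1 hk.hcs isOpen_ball
    (hk.tsupport.trans (closedBall_subset_ball (by norm_num))) h1
  have h3 : ∀ ξ, k ξ * dbar (fun ξ => F (z + ρ * ξ)) ξ = ρ * (k ξ * dbar F (z + ρ * ξ)) := by
    intro ξ
    by_cases h : ‖ξ‖ < 1
    · rw [dbar_affine ρ ((hF.contDiffAt (isOpen_ball.mem_nhds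
        (affine_mem hρ h))).differentiableAt one_ne_zero)]
      ring
    · rw [hk.2 ξ (by linarith)]; simp
  simp_rw [h3] at h2
  rw [integral_const_mul] at h2
  have : (ρ : ℂ) ≠ 0 := by exact_mod_cast hρ.ne'
  unfold Av
  push_cast
  field_simp
  linear_combination h2

lemma Av_conj (k F : ℂ → ℂ) (z : ℂ) (ρ : ℝ) :
    Av k (fun ζ => conj (F ζ)) z ρ = conj (Av (fun ξ => conj (k ξ)) F z ρ) := by
  unfold Av
  rw [← integral_conj]
  simp

lemma Av_add {k F G : ℂ → ℂ} {z : ℂ} {ρ : ℝ} (hk : TestK k) (hρ : 0 < ρ)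
    (hF : ContinuousOn F (ball z ρ)) (hG : ContinuousOn G (ball z ρ)) :
    Av k (fun ζ => F ζ + G ζ) z ρ = Av k F z ρ + Av k G z ρ := by
  unfold Av
  rw [← integral_add (Av_integrable hk hρ hF) (Av_integrable hk hρ hG)]
  congr 1; ext ξ; ring

lemma Av_const_mul (k F : ℂ → ℂ) (z c : ℂ) (ρ : ℝ) :
    Av k (fun ζ => c * F ζ) z ρ = c * Av k F z ρ := by
  unfold Av
  rw [← integral_const_mul]
  congr 1; ext ξ; ring

lemma Av_congr {k F G : ℂ → ℂ} {z : ℂ} {ρ : ℝ} (hk : TestK k) (hρ : 0 < ρ)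
    (h : ∀ ζ ∈ ball z ρ, F ζ = G ζ) : Av k F z ρ = Av k G z ρ := by
  unfold Av
  congr 1; ext ξ
  by_cases h1 : ‖ξ‖ < 1
  · rw [h _ (affine_mem hρ h1)]
  · rw [hk.2 ξ (by linarith)]; simp

/-- the fixed averaging kernel -/
def Kk (ξ : ℂ) : ℂ := dbar (cut 2) ξ * ξ⁻¹

open scoped ContDiff in
lemma TestK_cut : TestK (cut 2) := by
  refine ⟨contDiff_cut 2 (n := ⊤), fun ξ hξ => ?_⟩
  exact cut_eq_zero (by norm_num) (by linarith)

lemma TestK_Kk : TestK Kk := by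
  refine ⟨?_, fun ξ hξ => by simp [Kk, TestK_cut.dbar.2 ξ hξ]⟩
  rw [contDiff_iff_contDiffAt]
  intro ξ
  rcases eq_or_ne ξ 0 with rfl | h
  · have : Kk =ᶠ[𝓝 0] fun _ => 0 := by
      have : ∀ᶠ ξ : ℂ in 𝓝 0, 2 * ‖ξ‖ < 1 :=
        ContinuousAt.eventually_lt (f := fun x : ℂ => 2 * ‖x‖) (by fun_prop) (by fun_prop) (by simp)
      filter_upwards [this] with x hx
      rw [Kk, dbar_cut_zero' (by norm_num) hx, zero_mul]
    exact contDiffAt_const.congr_of_eventuallyEq this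
  · exact TestK_cut.dbar.1.contDiffAt.mul (contDiffAt_id.inv h)

lemma interior_rep {F : ℂ → ℂ} {z : ℂ} {ρ : ℝ} (hρ : 0 < ρ) (hF : ContDiffOn ℝ 1 F (ball z ρ)) :
    c0 * F z = - (Av Kk F z ρ + ρ * ∫ ξ, cut 2 ξ * ξ⁻¹ * dbar F (z + ρ * ξ)) := by
  have hmaps : Set.MapsTo (fun ξ : ℂ => z + ρ * ξ) (ball 0 1) (ball z ρ) :=
    fun ξ hξ => affine_mem hρ (by simpa using hξ)
  have h1 : ContDiffOn ℝ 1 (fun ξ => F (z + ρ * ξ)) (ball 0 1) :=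
    hF.comp (by fun_prop) hmaps
  have hz : ∀ ξ, ¬ ‖ξ‖ < 1 → cut 2 =ᶠ[𝓝 ξ] fun _ => 0 := fun ξ hξ =>
    cut_eventually_zero (by norm_num) (by linarith)
  have hV : ContDiff ℝ 1 (fun ξ => cut 2 ξ * F (z + ρ * ξ)) := by
    rw [contDiff_iff_contDiffAt]
    intro ξ
    by_cases h : ‖ξ‖ < 1
    · exact (contDiff_cut1 2).contDiffAt.mul (h1.contDiffAt (isOpen_ball.mem_nhds (by simpa using h)))
    · have : (fun ξ => cut 2 ξ * F (z + ρ * ξ)) =ᶠ[𝓝 ξ] fun _ => 0 := by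
        filter_upwards [hz ξ h] with x hx
        simp [hx]
      exact contDiffAt_const.congr_of_eventuallyEq this
  have h2 := rep_zero hV TestK_cut.hcs.mul_right
  have h3 : ∀ ξ, dbar (fun ξ => cut 2 ξ * F (z + ρ * ξ)) ξ * ξ⁻¹ =
      Kk ξ * F (z + ρ * ξ) + ρ * (cut 2 ξ * ξ⁻¹ * dbar F (z + ρ * ξ)) := by
    intro ξ
    by_cases h : ‖ξ‖ < 1
    · have dF := (hF.contDiffAt (isOpen_ball.mem_nhds (affine_mem hρ h))).differentiableAt one_ne_zero
      rw [dbar_mul ((contDiff_cut1 2).differentiable one_ne_zero ξ)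
        ((h1.contDiffAt (isOpen_ball.mem_nhds (by simpa using h))).differentiableAt one_ne_zero),
        dbar_affine ρ dF, Kk]
      ring
    · have : (fun ξ => cut 2 ξ * F (z + ρ * ξ)) =ᶠ[𝓝 ξ] fun _ => 0 := by
        filter_upwards [hz ξ h] with x hx
        simp [hx]
      rw [dbar_congr this, dbar_const, Kk, dbar_congr (hz ξ h), dbar_const, (hz ξ h).eq_of_nhds]
      simp
  have i1 := Av_integrable TestK_Kk hρ hF.continuousOn
  have i0 : Integrable (fun ξ => dbar (fun ξ => cut 2 ξ * F (z + ρ * ξ)) ξ * ξ⁻¹) := by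
    have hn : LocallyIntegrable (fun ζ : ℂ => ζ⁻¹) := by
      refine (locInt_norm_rpow (σ := 1) (by norm_num)).mono
        (Measurable.aestronglyMeasurable (by fun_prop)) (Eventually.of_forall fun x => ?_)
      rw [Real.rpow_neg_one, norm_inv, norm_inv, norm_norm]
    have := hn.integrable_smul_left_of_hasCompactSupport (continuous_dbar hV)
      (TestK_cut.hcs.mul_right (f' := fun ξ => F (z + ρ * ξ))).dbar'
    simpa using this
  have i2 : Integrable (fun ξ => ρ * (cut 2 ξ * ξ⁻¹ * dbar F (z + ρ * ξ))) := by
    refine (i0.sub i1).congr (Eventually.of_forall fun ξ => ?_)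
    simp only [Pi.sub_apply]
    rw [h3 ξ]; ring
  simp_rw [h3] at h2
  rw [integral_add i1 i2, integral_const_mul] at h2
  simp only [mul_zero, add_zero] at h2
  rw [cut_eq_one (by norm_num) (by simp), one_mul] at h2
  unfold Av
  linear_combination h2

lemma lemmaB {Y : ℂ → ℂ} {A R s : ℝ} (hA : 0 ≤ A) (hR : 0 < R) (hR1 : R ≤ 1) (hs : 0 < s)
    (hY : ContDiffOn ℝ 1 Y (pB R))
    (hb : ∀ ζ ∈ pB R, ‖dbar Y ζ‖ ≤ A * ‖ζ‖ ^ (-(1/2:ℝ)) * (‖Y ζ‖ + 1))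
    (hw : ∀ z ∈ pB R, ∀ ρ : ℝ, 0 < ρ → ρ ≤ ‖z‖ / 2 → ball z ρ ⊆ pB R → ‖Av Kk Y z ρ‖ ≤ A * ρ ^ (-s)) :
    ∃ R' C, 0 < R' ∧ R' ≤ R ∧ 0 ≤ C ∧ ∀ z ∈ pB R', ‖Y z‖ ≤ C * ‖z‖ ^ (-s) := by
  set C1 : ℝ := ∫ ξ : ℂ, ‖cut 2 ξ * ξ⁻¹‖ with hC1
  have hC1i : Integrable (fun ξ : ℂ => ‖cut 2 ξ * ξ⁻¹‖) := by
    have hn : LocallyIntegrable (fun ζ : ℂ => ζ⁻¹) := by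
      refine (locInt_norm_rpow (σ := 1) (by norm_num)).mono
        (Measurable.aestronglyMeasurable (by fun_prop)) (Eventually.of_forall fun x => ?_)
      rw [Real.rpow_neg_one, norm_inv, norm_inv, norm_norm]
    have := hn.integrable_smul_left_of_hasCompactSupport TestK_cut.1.continuous TestK_cut.hcs
    simpa using this.norm
  have hC10 : 0 ≤ C1 := integral_nonneg fun _ => norm_nonneg _
  have c0p := c0_pos
  -- choose the radius
  obtain ⟨R0, hR0, hR0R, hR0s⟩ : ∃ R0 : ℝ, 0 < R0 ∧ R0 ≤ R / 2 ∧
      C1 * A * 2 ^ s * R0 ^ (1/2:ℝ) ≤ c0 / 2 := by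
    have ht : Tendsto (fun r : ℝ => C1 * A * 2 ^ s * r ^ (1/2:ℝ)) (𝓝[>] 0) (𝓝 0) := by
      have : Tendsto (fun r : ℝ => C1 * A * 2 ^ s * r ^ (1/2:ℝ)) (𝓝 0) (𝓝 (C1 * A * 2 ^ s * 0 ^ (1/2:ℝ))) := by
        apply Tendsto.const_mul
        exact (Real.continuousAt_rpow_const 0 (1/2) (Or.inr (by norm_num))).tendsto
      rw [Real.zero_rpow (by norm_num), mul_zero] at this
      exact this.mono_left nhdsWithin_le_nhds
    have h1 := ht.eventually (gt_mem_nhds (show (0:ℝ) < c0 / 2 by positivity))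
    have h2 : ∀ᶠ r : ℝ in 𝓝[>] 0, r < R / 2 :=
      Filter.Eventually.filter_mono nhdsWithin_le_nhds (gt_mem_nhds (show (0:ℝ) < R / 2 by positivity))
    obtain ⟨r, hr1, hr2, hr3⟩ := (h1.and (h2.and self_mem_nhdsWithin)).exists
    exact ⟨r, hr3, hr2.le, hr1.le⟩
  -- bound on outer annulus
  obtain ⟨M0, hM0⟩ : ∃ M0, ∀ ζ : ℂ, R0 ≤ ‖ζ‖ → ‖ζ‖ ≤ 3/2 * R0 → ‖Y ζ‖ ≤ M0 := by
    have hk : IsCompact (closedBall (0:ℂ) (3/2*R0) \ ball 0 R0) :=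
      (isCompact_closedBall _ _).diff isOpen_ball
    obtain ⟨M0, h⟩ := hk.exists_bound_of_continuousOn (f := Y) (hY.continuousOn.mono (by
      intro ζ hζ
      simp at hζ
      rw [mem_pB]
      refine ⟨by linarith, ?_⟩
      rw [← norm_pos_iff]; linarith))
    exact ⟨M0, fun ζ h1 h2 => h ζ (by simp [h1, h2])⟩
  have hM00 : 0 ≤ M0 := by
    refine (norm_nonneg _).trans (hM0 (R0 : ℂ) ?_ ?_) <;>
    · rw [Complex.norm_real, Real.norm_of_nonneg hR0.le]; try linarith
  set B : ℝ := 2 / c0 * (2 ^ s * A + C1 * A * 2 ^ s * (M0 + 1)) with hB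
  have hB0 : 0 ≤ B := by positivity
  have key : ∀ δ0 : ℝ, 0 < δ0 → δ0 < R0 → ∀ z : ℂ, δ0 ≤ ‖z‖ → ‖z‖ ≤ R0 →
      (‖z‖ - δ0) ^ s * ‖Y z‖ ≤ B := by
    intro δ0 hδ hδR
    have hk : IsCompact (closedBall (0:ℂ) R0 \ ball 0 δ0) := (isCompact_closedBall _ _).diff isOpen_ball
    have hmem : ∀ z : ℂ, z ∈ (closedBall (0:ℂ) R0 \ ball 0 δ0) ↔ δ0 ≤ ‖z‖ ∧ ‖z‖ ≤ R0 := by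
      intro z; simp [and_comm]
    have hsub : (closedBall (0:ℂ) R0 \ ball 0 δ0) ⊆ pB R := by
      intro ζ hζ
      rw [hmem] at hζ
      rw [mem_pB, ← norm_pos_iff]
      constructor <;> linarith
    have hcont : ContinuousOn (fun z : ℂ => (‖z‖ - δ0) ^ s * ‖Y z‖) (closedBall (0:ℂ) R0 \ ball 0 δ0) := by
      refine ContinuousOn.mul ?_ (hY.continuousOn.mono hsub).norm
      refine ContinuousOn.rpow_const (by fun_prop) fun x _ => Or.inr hs.le
    obtain ⟨zs, hzs, hmax⟩ := hk.exists_isMaxOn ⟨(R0:ℂ), by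
      rw [hmem, Complex.norm_real, Real.norm_of_nonneg hR0.le]; exact ⟨hδR.le, le_rfl⟩⟩ hcont
    intro z hz1 hz2
    refine (hmax ((hmem z).2 ⟨hz1, hz2⟩)).trans ?_
    simp only
    have hzp := hsub hzs
    rw [hmem] at hzs
    rcases hzs.1.eq_or_lt with h0 | h0
    · rw [← h0, sub_self, Real.zero_rpow hs.ne', zero_mul]; exact hB0
    set M := (‖zs‖ - δ0) ^ s * ‖Y zs‖ with hM
    have hMn : 0 ≤ M := mul_nonneg (Real.rpow_nonneg (by linarith) _) (norm_nonneg _)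
    set D := (‖zs‖ - δ0) / 2 with hD
    have hDp : 0 < D := by rw [hD]; linarith
    have hD2 : ‖zs‖ - δ0 = 2 * D := by rw [hD]; ring
    have hDR : D ≤ R0 := by linarith
    -- geometry on the ball
    have hgeo : ∀ ζ ∈ ball zs D, ‖zs‖ - D < ‖ζ‖ ∧ ‖ζ‖ < ‖zs‖ + D := by
      intro ζ hζ
      rw [mem_ball, dist_eq_norm] at hζ
      have h1 := norm_sub_norm_le ζ zs
      have h2 := norm_sub_norm_le zs ζ
      rw [norm_sub_rev] at h2
      constructor <;> linarith
    have hsubB : ball zs D ⊆ pB R := by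
      intro ζ hζ
      have := hgeo ζ hζ
      rw [mem_pB, ← norm_pos_iff]
      constructor <;> linarith
    have hYb : ∀ ζ ∈ ball zs D, ‖Y ζ‖ ≤ M * D ^ (-s) + M0 := by
      intro ζ hζ
      have hg := hgeo ζ hζ
      have hp : 0 ≤ M * D ^ (-s) := by positivity
      by_cases hc : ‖ζ‖ ≤ R0
      · have h1 : (‖ζ‖ - δ0) ^ s * ‖Y ζ‖ ≤ M := hmax ((hmem ζ).2 ⟨by linarith, hc⟩)
        have h2 : D ^ s * ‖Y ζ‖ ≤ M := by
          refine le_trans ?_ h1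
          gcongr
          linarith
        have h3 : ‖Y ζ‖ ≤ M * D ^ (-s) := by
          rw [Real.rpow_neg hDp.le, ← div_eq_mul_inv, le_div_iff₀ (by positivity)]; linarith
        linarith
      · have := hM0 ζ (by linarith) (by linarith)
        linarith
    have hdb : ∀ ζ ∈ ball zs D, ‖dbar Y ζ‖ ≤ A * D ^ (-(1/2:ℝ)) * (M * D ^ (-s) + M0 + 1) := by
      intro ζ hζ
      have hg := hgeo ζ hζ
      refine (hb ζ (hsubB hζ)).trans ?_
      have : ‖ζ‖ ^ (-(1/2:ℝ)) ≤ D ^ (-(1/2:ℝ)) :=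
        Real.rpow_le_rpow_of_nonpos hDp (by linarith) (by norm_num)
      have := hYb ζ hζ
      gcongr
    have hrep := interior_rep hDp (hY.mono hsubB)
    have hI : ‖∫ ξ, cut 2 ξ * ξ⁻¹ * dbar Y (zs + D * ξ)‖ ≤
        C1 * (A * D ^ (-(1/2:ℝ)) * (M * D ^ (-s) + M0 + 1)) := by
      rw [hC1, ← integral_mul_const]
      refine norm_integral_le_of_norm_le (hC1i.mul_const _) (Eventually.of_forall fun ξ => ?_)
      rw [norm_mul]
      by_cases h : ‖ξ‖ < 1
      · gcongr; exact hdb _ (affine_mem hDp h)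
      · rw [TestK_cut.2 ξ (by linarith)]; simp
    have hAv := hw zs hzp D hDp (by linarith) hsubB
    have hfin : c0 * ‖Y zs‖ ≤ A * D ^ (-s) +
        D * (C1 * (A * D ^ (-(1/2:ℝ)) * (M * D ^ (-s) + M0 + 1))) := by
      have := congrArg norm hrep
      rw [norm_mul, Complex.norm_real, Real.norm_of_nonneg c0p.le, norm_neg] at this
      rw [this]
      refine (norm_add_le _ _).trans (add_le_add hAv ?_)
      rw [norm_mul, Complex.norm_real, Real.norm_of_nonneg hDp.le]
      gcongr
    have hDh : D * D ^ (-(1/2:ℝ)) = D ^ (1/2:ℝ) := by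
      nth_rewrite 1 [← Real.rpow_one D]
      rw [← Real.rpow_add hDp]; norm_num
    have hDs : D ^ s * D ^ (-s) = 1 := by rw [← Real.rpow_add hDp]; simp
    have hMe : M = 2 ^ s * D ^ s * ‖Y zs‖ := by
      rw [hM, hD2, Real.mul_rpow (by norm_num) hDp.le]
    have hpos : 0 ≤ 2 ^ s * D ^ s := by positivity
    have h5 := mul_le_mul_of_nonneg_left hfin hpos
    have e5 : 2 ^ s * D ^ s * (A * D ^ (-s) +
        D * (C1 * (A * D ^ (-(1/2:ℝ)) * (M * D ^ (-s) + M0 + 1)))) =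
        2 ^ s * A * (D ^ s * D ^ (-s)) + C1 * A * 2 ^ s * (D * D ^ (-(1/2:ℝ))) * (M * (D ^ s * D ^ (-s)))
         + C1 * A * 2 ^ s * (M0 + 1) * ((D * D ^ (-(1/2:ℝ))) * D ^ s) := by ring
    rw [e5, hDs, hDh] at h5
    have hDle : D ^ (1/2:ℝ) ≤ R0 ^ (1/2:ℝ) := Real.rpow_le_rpow hDp.le hDR (by norm_num)
    have hD1 : D ^ (1/2:ℝ) ≤ 1 := Real.rpow_le_one hDp.le (by linarith) (by norm_num)
    have hD1s : D ^ s ≤ 1 := Real.rpow_le_one hDp.le (by linarith) hs.le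
    have h6 : C1 * A * 2 ^ s * D ^ (1/2:ℝ) * (M * 1) ≤ c0 / 2 * M := by
      rw [mul_one]
      gcongr
      refine le_trans ?_ hR0s
      gcongr
    have h7 : C1 * A * 2 ^ s * (M0 + 1) * (D ^ (1/2:ℝ) * D ^ s) ≤ C1 * A * 2 ^ s * (M0 + 1) := by
      apply mul_le_of_le_one_right (by positivity)
      exact mul_le_one₀ hD1 (by positivity) hD1s
    have h8 : c0 * M ≤ 2 ^ s * A + c0 / 2 * M + C1 * A * 2 ^ s * (M0 + 1) := by
      have : c0 * M = 2 ^ s * D ^ s * (c0 * ‖Y zs‖) := by rw [hMe]; ring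
      rw [this]
      linarith
    rw [hB, div_mul_eq_mul_div, le_div_iff₀ c0p]
    linarith
  refine ⟨R0, 2 ^ s * B, hR0, by linarith, by positivity, fun z hz => ?_⟩
  rw [mem_pB, ← norm_pos_iff] at hz
  have h := key (‖z‖ / 2) (by linarith) (by linarith) z (by linarith) hz.1.le
  rw [show ‖z‖ - ‖z‖ / 2 = ‖z‖ / 2 by ring, Real.div_rpow hz.2.le (by norm_num)] at h
  have hzs : 0 < ‖z‖ ^ s := Real.rpow_pos_of_pos hz.2 s
  rw [Real.rpow_neg hz.2.le, ← div_eq_mul_inv, le_div_iff₀ hzs]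
  rw [div_mul_eq_mul_div, div_le_iff₀ (by positivity)] at h
  linarith

/-- weak (averaged) bounds -/
def WB (R : ℝ) (F : ℂ → ℂ) (s : ℝ) : Prop := ∀ k, TestK k → ∃ N, 0 ≤ N ∧ ∀ z ∈ pB R, ∀ ρ : ℝ, 0 < ρ →
  ρ ≤ ‖z‖ / 2 → ball z ρ ⊆ pB R → ‖Av k F z ρ‖ ≤ N * ρ ^ (-s)

lemma WB.restrict {R R' s : ℝ} {F : ℂ → ℂ} (h : WB R F s) (hR : R' ≤ R) : WB R' F s := by
  intro k hk
  obtain ⟨N, hN, hb⟩ := h k hk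
  exact ⟨N, hN, fun z hz ρ h1 h2 h3 => hb z (pB_mono hR hz) ρ h1 h2 (h3.trans (pB_mono hR))⟩

lemma WB.mono {R s s' : ℝ} {F : ℂ → ℂ} (h : WB R F s) (hR : R ≤ 1) (hs : s ≤ s') : WB R F s' := by
  intro k hk
  obtain ⟨N, hN, hb⟩ := h k hk
  refine ⟨N, hN, fun z hz ρ h1 h2 h3 => (hb z hz ρ h1 h2 h3).trans ?_⟩
  rw [mem_pB] at hz
  gcongr N * ?_
  exact Real.rpow_le_rpow_of_exponent_ge h1 (by linarith [norm_nonneg z]) (by linarith)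

lemma WB_of_bound {R s C : ℝ} {F : ℂ → ℂ} (hC : 0 ≤ C) (hs : 0 ≤ s)
    (h : ∀ z ∈ pB R, ‖F z‖ ≤ C * ‖z‖ ^ (-s)) : WB R F s := by
  intro k hk
  obtain ⟨N, hN, hb⟩ := Av_bound hk
  refine ⟨N * C, by positivity, fun z hz ρ h1 h2 h3 => ?_⟩
  rw [mul_assoc]
  refine hb F z ρ _ h1 fun ζ hζ => (h ζ (h3 hζ)).trans ?_
  gcongr C * ?_
  apply Real.rpow_le_rpow_of_nonpos h1 _ (by linarith)
  rw [mem_ball, dist_eq_norm] at hζ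
  have := norm_sub_norm_le z ζ
  rw [norm_sub_rev] at this
  linarith

lemma WB.dbar {R s : ℝ} {F : ℂ → ℂ} (h : WB R F s) (hF : ContDiffOn ℝ 1 F (pB R)) :
    WB R (dbar F) (s + 1) := by
  intro k hk
  obtain ⟨N, hN, hb⟩ := h _ hk.dbar
  refine ⟨N, hN, fun z hz ρ h1 h2 h3 => ?_⟩
  rw [Av_dbar hk h1 (hF.mono h3), norm_mul, norm_neg, Complex.norm_real,
    Real.norm_of_nonneg (by positivity), show -(s + 1) = -1 + -s by ring, Real.rpow_add h1,
    Real.rpow_neg_one]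
  have := hb z hz ρ h1 h2 h3
  have : 0 < ρ⁻¹ := by positivity
  calc _ ≤ ρ⁻¹ * (N * ρ ^ (-s)) := by gcongr
    _ = _ := by ring

lemma WB.conj {R s : ℝ} {F : ℂ → ℂ} (h : WB R F s) : WB R (fun z => conj (F z)) s := by
  intro k hk
  obtain ⟨N, hN, hb⟩ := h _ hk.conj
  refine ⟨N, hN, fun z hz ρ h1 h2 h3 => ?_⟩
  rw [Av_conj, Complex.norm_conj]
  exact hb z hz ρ h1 h2 h3

lemma WB.add {R s : ℝ} {F G : ℂ → ℂ} (hF : WB R F s) (hG : WB R G s) (cF : ContinuousOn F (pB R))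
    (cG : ContinuousOn G (pB R)) : WB R (fun z => F z + G z) s := by
  intro k hk
  obtain ⟨N, hN, hb⟩ := hF k hk
  obtain ⟨N', hN', hb'⟩ := hG k hk
  refine ⟨N + N', by positivity, fun z hz ρ h1 h2 h3 => ?_⟩
  rw [Av_add hk h1 (cF.mono h3) (cG.mono h3), add_mul]
  exact (norm_add_le _ _).trans (add_le_add (hb z hz ρ h1 h2 h3) (hb' z hz ρ h1 h2 h3))

lemma WB.const_mul {R s : ℝ} {F : ℂ → ℂ} (hF : WB R F s) (c : ℂ) : WB R (fun z => c * F z) s := by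
  intro k hk
  obtain ⟨N, hN, hb⟩ := hF k hk
  refine ⟨‖c‖ * N, by positivity, fun z hz ρ h1 h2 h3 => ?_⟩
  rw [Av_const_mul, norm_mul, mul_assoc]
  gcongr
  exact hb z hz ρ h1 h2 h3

lemma WB.congr {R s : ℝ} {F G : ℂ → ℂ} (hF : WB R F s) (h : ∀ z ∈ pB R, G z = F z) : WB R G s := by
  intro k hk
  obtain ⟨N, hN, hb⟩ := hF k hk
  refine ⟨N, hN, fun z hz ρ h1 h2 h3 => ?_⟩
  rw [Av_congr hk h1 (fun ζ hζ => h ζ (h3 hζ))]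
  exact hb z hz ρ h1 h2 h3

lemma lemmaB' {Y : ℂ → ℂ} {A R s : ℝ} (hA : 0 ≤ A) (hR : 0 < R) (hR1 : R ≤ 1) (hs : 0 < s)
    (hY : ContDiffOn ℝ 1 Y (pB R))
    (hb : ∀ ζ ∈ pB R, ‖dbar Y ζ‖ ≤ A * ‖ζ‖ ^ (-(1/2:ℝ)) * (‖Y ζ‖ + 1)) (hw : WB R Y s) :
    ∃ R' C, 0 < R' ∧ R' ≤ R ∧ 0 ≤ C ∧ ∀ z ∈ pB R', ‖Y z‖ ≤ C * ‖z‖ ^ (-s) := by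
  obtain ⟨N, hN, hw⟩ := hw Kk TestK_Kk
  refine lemmaB (A := A + N) (by positivity) hR hR1 hs hY (fun ζ hζ => (hb ζ hζ).trans ?_)
    (fun z hz ρ h1 h2 h3 => (hw z hz ρ h1 h2 h3).trans ?_)
  · gcongr; linarith
  · gcongr; linarith

/-- conformal factor -/
def Ez (z : ℂ) : ℂ := ((4 / (1 + ‖z‖ ^ 2) ^ 2 : ℝ) : ℂ)
/-- `dbar log E` -/
def kz (z : ℂ) : ℂ := ((-2 / (1 + ‖z‖ ^ 2) : ℝ) : ℂ) * z

/-- the first order system -/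
structure Sys (R : ℝ) (w f h Φ : ℂ → ℂ) : Prop where
  cw : ContDiffOn ℝ 1 w (pB R)
  cf : ContDiffOn ℝ 1 f (pB R)
  ch : ContDiffOn ℝ 1 h (pB R)
  cΦ : ContDiffOn ℝ 1 Φ (pB R)
  fr : ∀ z ∈ pB R, (f z).im = 0
  ew : ∀ z ∈ pB R, dbar w z = -(1/2) * (Ez z * f z - Complex.I * (h z).im)
  ef : ∀ z ∈ pB R, dbar f z = (1/2) * conj (w z * (f z + 2) - Φ z)
  eh : ∀ z ∈ pB R, dbar h z = Complex.I / 2 * (h z).im * conj (w z) + kz z * h z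
  eΦ : ∀ z ∈ pB R, dbar Φ z = (h z).re - Complex.I / 2 * (-(f z + 2) * (h z).im + (w z * conj (Φ z)).im)

lemma Sys.restrict {R R' : ℝ} {w f h Φ : ℂ → ℂ} (S : Sys R w f h Φ) (hR : R' ≤ R) : Sys R' w f h Φ where
  cw := S.cw.mono (pB_mono hR)
  cf := S.cf.mono (pB_mono hR)
  ch := S.ch.mono (pB_mono hR)
  cΦ := S.cΦ.mono (pB_mono hR)
  fr := fun z hz => S.fr z (pB_mono hR hz)
  ew := fun z hz => S.ew z (pB_mono hR hz)
  ef := fun z hz => S.ef z (pB_mono hR hz)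
  eh := fun z hz => S.eh z (pB_mono hR hz)
  eΦ := fun z hz => S.eΦ z (pB_mono hR hz)

lemma Ez_norm (z : ℂ) : ‖Ez z‖ ≤ 4 := by
  rw [Ez, Complex.norm_real, Real.norm_of_nonneg (by positivity), div_le_iff₀ (by positivity)]
  nlinarith [sq_nonneg ‖z‖, sq_nonneg (‖z‖^2)]

lemma kz_norm (z : ℂ) : ‖kz z‖ ≤ 2 * ‖z‖ := by
  rw [kz, norm_mul, Complex.norm_real, Real.norm_eq_abs, abs_div, abs_of_pos (by positivity : 0 < 1 + ‖z‖^2)]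
  gcongr
  rw [div_le_iff₀ (by positivity), abs_of_neg (by norm_num)]
  nlinarith [sq_nonneg ‖z‖]

lemma weak_Φ {R ε : ℝ} {w f h Φ : ℂ → ℂ} (S : Sys R w f h Φ) (hR1 : R ≤ 1) (hε : 0 ≤ ε) (hε1 : ε ≤ 1)
    (hw : ∀ z ∈ pB R, ‖w z‖ ≤ ‖z‖ ^ (-ε)) (hf : ∀ z ∈ pB R, ‖f z‖ ≤ ‖z‖ ^ (-ε)) : WB R Φ (1 + 2 * ε) := by
  have h1 : WB R f ε := WB_of_bound zero_le_one hε (by simpa using hf)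
  have h2 : WB R (fun z => conj (dbar f z)) (1 + 2 * ε) :=
    ((h1.dbar S.cf).conj).mono hR1 (by linarith)
  have h3 : WB R (fun z => w z * (f z + 2)) (1 + 2 * ε) := by
    refine WB.mono (s := 2 * ε) (WB_of_bound (C := 3) (by norm_num) (by linarith) fun z hz => ?_) hR1 (by linarith)
    have hz' := mem_pB.1 hz
    have hz0 : 0 < ‖z‖ := norm_pos_iff.2 hz'.2
    have h4 : 1 ≤ ‖z‖ ^ (-ε) := Real.one_le_rpow_of_pos_of_le_one_of_nonpos hz0 (by linarith) (by linarith)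
    have h5 : ‖f z + 2‖ ≤ 3 * ‖z‖ ^ (-ε) := by
      refine (norm_add_le _ _).trans ?_
      have := hf z hz
      rw [Complex.norm_ofNat]; linarith
    rw [norm_mul]
    calc _ ≤ ‖z‖ ^ (-ε) * (3 * ‖z‖ ^ (-ε)) := by gcongr; exact hw z hz
      _ = 3 * (‖z‖ ^ (-ε) * ‖z‖ ^ (-ε)) := by ring
      _ = _ := by rw [← Real.rpow_add hz0]; ring_nf
  have cdf := continuousOn_dbar (isOpen_pB R) S.cf
  refine (h3.add (h2.const_mul (-2)) ?_ ?_).congr ?_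
  · exact S.cw.continuousOn.mul (S.cf.continuousOn.add continuousOn_const)
  · exact continuousOn_const.mul (Complex.continuous_conj.comp_continuousOn cdf)
  · intro z hz
    rw [S.ef z hz]
    have c2 : conj (2:ℂ) = 2 := by rw [map_ofNat]
    simp [c2]

lemma h_eq {R : ℝ} {w f h Φ : ℂ → ℂ} (S : Sys R w f h Φ) {z : ℂ} (hz : z ∈ pB R) :
    h z = ((1/2) * dbar Φ z + (1/2) * conj (dbar Φ z)) + (dbar w z + (-1) * conj (dbar w z)) := by
  have fr := S.fr z hz
  have hE : (Ez z).im = 0 := by simp only [Ez, Complex.ofReal_im]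
  have a1 : (dbar Φ z).re = (h z).re := by rw [S.eΦ z hz]; simp [fr]
  have a2 : (dbar w z).im = (h z).im / 2 := by rw [S.ew z hz]; simp [fr, hE]; try ring
  apply Complex.ext
  · simp [a1]; try ring
  · simp [a2]; try ring

lemma weak_h {R ε : ℝ} {w f h Φ : ℂ → ℂ} (S : Sys R w f h Φ) (hR1 : R ≤ 1) (hε : 0 ≤ ε) (hε1 : ε ≤ 1)
    (hw : ∀ z ∈ pB R, ‖w z‖ ≤ ‖z‖ ^ (-ε)) (hf : ∀ z ∈ pB R, ‖f z‖ ≤ ‖z‖ ^ (-ε)) : WB R h (2 + 2 * ε) := by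
  have h1 : WB R w ε := WB_of_bound zero_le_one hε (by simpa using hw)
  have cdw := continuousOn_dbar (isOpen_pB R) S.cw
  have cdΦ := continuousOn_dbar (isOpen_pB R) S.cΦ
  have h2 := (h1.dbar S.cw).mono (s' := 2 + 2 * ε) hR1 (by linarith)
  have h3 := ((weak_Φ S hR1 hε hε1 hw hf).dbar S.cΦ).mono (s' := 2 + 2 * ε) hR1 (by linarith)
  refine WB.congr (WB.add (WB.add (h3.const_mul (1/2)) (h3.conj.const_mul (1/2)) ?_ ?_)
    (WB.add h2 (h2.conj.const_mul (-1)) ?_ ?_) ?_ ?_) (fun z hz => h_eq S hz)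
  all_goals
    first
    | exact cdw
    | exact continuousOn_const.mul cdΦ
    | exact continuousOn_const.mul (Complex.continuous_conj.comp_continuousOn cdΦ)
    | exact continuousOn_const.mul (Complex.continuous_conj.comp_continuousOn cdw)
    | exact (continuousOn_const.mul cdΦ).add (continuousOn_const.mul (Complex.continuous_conj.comp_continuousOn cdΦ))
    | exact cdw.add (continuousOn_const.mul (Complex.continuous_conj.comp_continuousOn cdw))

/-- punctured neighbourhoods of `0` -/
abbrev nz : Filter ℂ := 𝓝[≠] 0
/-- powers of the modulus -/
def pw (s : ℝ) (z : ℂ) : ℝ := ‖z‖ ^ s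

lemma pB_mem {R : ℝ} (hR : 0 < R) : pB R ∈ nz := by
  have : ball (0:ℂ) R ∈ 𝓝 (0:ℂ) := ball_mem_nhds _ hR
  exact diff_mem_nhdsWithin_compl this _

lemma exists_pB {P : ℂ → Prop} (h : ∀ᶠ z in nz, P z) : ∃ R, 0 < R ∧ ∀ z ∈ pB R, P z := by
  rw [eventually_nhdsWithin_iff, Metric.eventually_nhds_iff_ball] at h
  obtain ⟨R, hR, h⟩ := h
  exact ⟨R, hR, fun z hz => h z hz.1 hz.2⟩

lemma bigO_pB {F : ℂ → ℂ} {s : ℝ} (h : F =O[nz] pw s) :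
    ∃ R C, 0 < R ∧ 0 ≤ C ∧ ∀ z ∈ pB R, ‖F z‖ ≤ C * ‖z‖ ^ s := by
  obtain ⟨C, hC, h⟩ := h.exists_pos
  obtain ⟨R, hR, h⟩ := exists_pB h.bound
  refine ⟨R, C, hR, hC.le, fun z hz => ?_⟩
  have := h z hz
  rwa [pw, Real.norm_of_nonneg (by positivity)] at this

lemma bigO_of_pB {F : ℂ → ℂ} {s R C : ℝ} (hR : 0 < R) (h : ∀ z ∈ pB R, ‖F z‖ ≤ C * ‖z‖ ^ s) :
    F =O[nz] pw s := by
  refine Asymptotics.IsBigO.of_bound C ?_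
  filter_upwards [pB_mem hR] with z hz
  rw [pw, Real.norm_of_nonneg (by positivity)]
  exact h z hz

lemma pw_mono {s t : ℝ} (h : s ≤ t) : pw t =O[nz] pw s := by
  refine Asymptotics.IsBigO.of_bound 1 ?_
  filter_upwards [pB_mem one_pos] with z hz
  rw [mem_pB] at hz
  rw [pw, pw, Real.norm_of_nonneg (by positivity), Real.norm_of_nonneg (by positivity), one_mul]
  exact Real.rpow_le_rpow_of_exponent_ge (norm_pos_iff.2 hz.2) hz.1.le h

lemma pw_mul {F G : ℂ → ℂ} {s t r : ℝ} (hF : F =O[nz] pw s) (hG : G =O[nz] pw t) (h : r ≤ s + t) :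
    (fun z => F z * G z) =O[nz] pw r := by
  refine ((hF.mul hG).congr' EventuallyEq.rfl ?_).trans (pw_mono h)
  filter_upwards [self_mem_nhdsWithin] with z hz
  exact (Real.rpow_add (norm_pos_iff.2 hz) _ _).symm

lemma pw_id : (fun z : ℂ => z) =O[nz] pw 1 :=
  Asymptotics.IsBigO.of_bound 1 (Eventually.of_forall fun z => by simp [pw])
lemma pw_inv : (fun z : ℂ => z⁻¹) =O[nz] pw (-1) :=
  Asymptotics.IsBigO.of_bound 1 (Eventually.of_forall fun z => by simp [pw, Real.rpow_neg_one])
lemma pw_const (c : ℂ) {s : ℝ} (hs : s ≤ 0) : (fun _ : ℂ => c) =O[nz] pw s := by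
  refine Asymptotics.IsBigO.trans (Asymptotics.IsBigO.of_bound ‖c‖ (Eventually.of_forall fun z => by simp [pw])) (pw_mono hs)
lemma pw_le {F : ℂ → ℂ} {s t : ℝ} (hF : F =O[nz] pw s) (h : t ≤ s) : F =O[nz] pw t := hF.trans (pw_mono h)
lemma pw_conj {F : ℂ → ℂ} {s : ℝ} (hF : F =O[nz] pw s) : (fun z => conj (F z)) =O[nz] pw s :=
  Asymptotics.IsBigO.trans (Asymptotics.IsBigO.of_bound 1 (Eventually.of_forall fun z => by simp)) hF
lemma pw_im {F : ℂ → ℂ} {s : ℝ} (hF : F =O[nz] pw s) : (fun z => ((F z).im : ℂ)) =O[nz] pw s :=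
  Asymptotics.IsBigO.trans (Asymptotics.IsBigO.of_bound 1 (Eventually.of_forall fun z => by
    simpa using Complex.abs_im_le_norm _)) hF
lemma pw_re {F : ℂ → ℂ} {s : ℝ} (hF : F =O[nz] pw s) : (fun z => ((F z).re : ℂ)) =O[nz] pw s :=
  Asymptotics.IsBigO.trans (Asymptotics.IsBigO.of_bound 1 (Eventually.of_forall fun z => by
    simpa using Complex.abs_re_le_norm _)) hF
lemma pw_tendsto {F : ℂ → ℂ} {s : ℝ} (hs : 0 < s) (hF : F =O[nz] pw s) : Tendsto F nz (𝓝 0) := by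
  refine hF.trans_tendsto ?_
  have : Tendsto (fun z : ℂ => ‖z‖ ^ s) (𝓝 0) (𝓝 (‖(0:ℂ)‖ ^ s)) :=
    (continuous_norm.rpow_const (fun _ => Or.inr hs.le)).tendsto 0
  rw [norm_zero, Real.zero_rpow hs.ne'] at this
  exact this.mono_left nhdsWithin_le_nhds

lemma lemmaA' {W : ℂ → ℂ} {a R : ℝ} (ha : 0 ≤ a) (ha1 : a < 1) (hR : 0 < R)
    (hW : ContDiffOn ℝ 1 W (pB R)) (hb : W =O[nz] pw (-a)) (hb' : dbar W =O[nz] pw (-a)) :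
    ∃ c : ℂ, (fun z => W z - c) =O[nz] pw ((1-a)/2) := by
  obtain ⟨R1, C1, h1, hC1, hb⟩ := bigO_pB hb
  obtain ⟨R2, C2, h2, hC2, hb'⟩ := bigO_pB hb'
  have hR' : 0 < min R (min R1 R2) := by positivity
  obtain ⟨c, C', hC', h⟩ := lemmaA (C := C1 + C2) ha ha1 hR' (hW.mono (pB_mono (min_le_left _ _)))
    (fun z hz => (hb z (pB_mono ((min_le_right _ _).trans (min_le_left _ _)) hz)).trans
      (by gcongr; linarith))
    (fun z hz => (hb' z (pB_mono ((min_le_right _ _).trans (min_le_right _ _)) hz)).trans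
      (by gcongr; linarith))
  exact ⟨c, bigO_of_pB (half_pos hR') h⟩

lemma lemmaA_bdd {W : ℂ → ℂ} {a R : ℝ} (ha : 0 ≤ a) (ha1 : a < 1) (hR : 0 < R)
    (hW : ContDiffOn ℝ 1 W (pB R)) (hb : W =O[nz] pw (-a)) (hb' : dbar W =O[nz] pw (-a)) :
    W =O[nz] pw 0 := by
  obtain ⟨c, h⟩ := lemmaA' ha ha1 hR hW hb hb'
  have := (pw_le h (by linarith : (0:ℝ) ≤ _)).add (pw_const c le_rfl)
  simpa using this

lemma lemmaA_lim {W : ℂ → ℂ} {a R : ℝ} (ha : 0 ≤ a) (ha1 : a < 1) (hR : 0 < R)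
    (hW : ContDiffOn ℝ 1 W (pB R)) (hb : W =O[nz] pw (-a)) (hb' : dbar W =O[nz] pw (-a)) :
    ∃ c, Tendsto W nz (𝓝 c) := by
  obtain ⟨c, h⟩ := lemmaA' ha ha1 hR hW hb hb'
  refine ⟨c, ?_⟩
  have := (pw_tendsto (by linarith) h).add_const c
  simpa using this

lemma dbar_id_mul {F : ℂ → ℂ} {R : ℝ} (hF : ContDiffOn ℝ 1 F (pB R)) {z : ℂ} (hz : z ∈ pB R) :
    dbar (fun z => z * F z) z = z * dbar F z := by
  have h1 : DifferentiableAt ℝ F z := (hF.contDiffAt ((isOpen_pB R).mem_nhds hz)).differentiableAt (by norm_num)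
  rw [dbar_mul (F := fun z => z) differentiableAt_id h1, dbar_holo (F := fun z : ℂ => z) differentiableAt_id]
  ring

lemma dbar_bigO {F G : ℂ → ℂ} {R s : ℝ} (hR : 0 < R) (h : ∀ z ∈ pB R, dbar F z = G z) (hG : G =O[nz] pw s) :
    dbar F =O[nz] pw s := by
  refine hG.congr' ?_ EventuallyEq.rfl
  filter_upwards [pB_mem hR] with z hz using (h z hz).symm

/-- complex valued `log |z|` -/
def lg (z : ℂ) : ℂ := ((Real.log ‖z‖ : ℝ) : ℂ)

lemma lg_contDiff (R : ℝ) (n : WithTop ℕ∞) : ContDiffOn ℝ n lg (pB R) := by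
  intro z hz
  have hz0 := (mem_pB.1 hz).2
  apply ContDiffAt.contDiffWithinAt
  exact Complex.ofRealCLM.contDiff.contDiffAt.comp z
    ((contDiffAt_norm ℝ hz0).log (norm_ne_zero_iff.2 hz0))

lemma dbar_lg {z : ℂ} (hz : z ≠ 0) : dbar lg z = 1 / (2 * conj z) := by
  have h1 : HasFDerivAt (fun z : ℂ => ‖z‖ ^ 2) (2 • (innerSL ℝ z)) z := (hasStrictFDerivAt_norm_sq z).hasFDerivAt
  have h2 := (h1.log (by positivity)).const_mul (1/2:ℝ)
  have h3 : HasFDerivAt (fun z : ℂ => (((1/2) * Real.log (‖z‖ ^ 2) : ℝ) : ℂ)) _ z :=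
    Complex.ofRealCLM.hasFDerivAt.comp z h2
  have h4 : lg = fun z : ℂ => (((1/2) * Real.log (‖z‖ ^ 2) : ℝ) : ℂ) := by
    ext z; rw [lg]; congr 1; rw [Real.log_pow]; push_cast; ring
  rw [h4, h3.dbar_eq]
  have hc : conj z ≠ 0 := by simpa using hz
  have h5 : ((‖z‖:ℂ)) ^ 2 = z * conj z := by
    rw [← Complex.ofReal_pow, ← Complex.normSq_eq_norm_sq, Complex.mul_conj]
  simp only [ContinuousLinearMap.coe_comp', Function.comp_apply, ContinuousLinearMap.smul_apply,
    innerSL_apply_apply, Complex.ofRealCLM_apply, Complex.inner]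
  simp only [smul_eq_mul, nsmul_eq_mul]
  push_cast
  rw [h5]
  simp
  field_simp
  apply Complex.ext <;> simp <;> ring

lemma log_tendsto : Tendsto (fun z : ℂ => Real.log ‖z‖) nz atBot :=
  Real.tendsto_log_nhdsGT_zero.comp tendsto_norm_nhdsNE_zero

lemma littleO_lg {w : ℂ → ℂ} (h : w =o[nz] lg) {ε : ℝ} (hε : 0 < ε) :
    ∀ᶠ z in nz, ‖w z‖ ≤ ‖z‖ ^ (-ε) := by
  have h1 : (fun z : ℂ => Real.log ‖z‖) =o[nz] fun z => ‖z‖ ^ (-ε) :=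
    (isLittleO_log_rpow_nhdsGT_zero (by linarith : -ε < 0)).comp_tendsto tendsto_norm_nhdsNE_zero
  have h2 : w =o[nz] (fun z : ℂ => Real.log ‖z‖) := by
    refine h.trans_isBigO (Asymptotics.IsBigO.of_bound 1 (Eventually.of_forall fun z => by simp [lg]))
  filter_upwards [(h2.trans h1).bound one_pos] with z hz
  rw [one_mul, Real.norm_of_nonneg (by positivity)] at hz
  exact hz

lemma const_littleO {F : ℂ → ℂ} (h : F =O[nz] pw 0) : F =o[nz] lg := by
  refine h.trans_isLittleO ?_
  have : pw 0 = fun _ => (1:ℝ) := by ext z; simp [pw]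
  rw [this, Asymptotics.isLittleO_const_left]
  right
  have := tendsto_abs_atBot_atTop.comp log_tendsto
  refine this.congr fun z => by simp [lg]

lemma lg_coef {c : ℂ} (h : (fun z => c * lg z) =o[nz] lg) : c = 0 := by
  by_contra hc
  have h1 := h.bound (c := ‖c‖/2) (by positivity)
  have h2 := log_tendsto.eventually_lt_atBot 0
  obtain ⟨z, hz1, hz2⟩ := (h1.and h2).exists
  rw [norm_mul] at hz1
  have : 0 < ‖lg z‖ := by rw [lg, Complex.norm_real, Real.norm_eq_abs]; exact abs_pos.2 hz2.ne
  have : 0 < ‖c‖ := by positivity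
  nlinarith

lemma ray_lim {T : ℂ → ℂ} {L : ℂ} (h : Tendsto T nz (𝓝 L)) {ξ : ℂ} (hξ : ξ ≠ 0)
    (hT : ∀ t : ℝ, 0 < t → T (t * ξ) = T ξ) : T ξ = L := by
  have h1 : Tendsto (fun t : ℝ => (t:ℂ) * ξ) (𝓝[>] 0) nz := by
    rw [tendsto_nhdsWithin_iff]
    constructor
    · have : Tendsto (fun t : ℝ => (t:ℂ) * ξ) (𝓝 0) (𝓝 (((0:ℝ):ℂ) * ξ)) := by
        apply Continuous.tendsto; fun_prop
      simp only [Complex.ofReal_zero, zero_mul] at this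
      exact this.mono_left nhdsWithin_le_nhds
    · filter_upwards [self_mem_nhdsWithin] with t ht
      have : (t:ℂ) ≠ 0 := by exact_mod_cast (ne_of_gt ht)
      simp [this, hξ]
  have h2 := h.comp h1
  refine tendsto_nhds_unique (tendsto_const_nhds.congr' ?_) h2
  filter_upwards [self_mem_nhdsWithin] with t ht
  exact (hT t ht).symm

lemma Ez_O : Ez =O[nz] pw 0 :=
  Asymptotics.IsBigO.of_bound 4 (Eventually.of_forall fun z => by simpa [pw] using Ez_norm z)
lemma kz_O : kz =O[nz] pw 1 :=
  Asymptotics.IsBigO.of_bound 2 (Eventually.of_forall fun z => by simpa [pw] using kz_norm z)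

section chain
variable {R : ℝ} {w f h Φ : ℂ → ℂ}

lemma Sys.dh (S : Sys R w f h Φ) (hR : 0 < R) {s t ε : ℝ} (hw : w =O[nz] pw (-ε)) (hε : 0 ≤ ε)
    (hh : h =O[nz] pw s) (ht : t ≤ s - ε) : dbar h =O[nz] pw t := by
  refine dbar_bigO hR S.eh ?_
  have h1 : (fun z => Complex.I / 2 * ((h z).im:ℂ)) =O[nz] pw s :=
    pw_mul (pw_const _ le_rfl) (pw_im hh) (by linarith)
  exact (pw_mul h1 (pw_conj hw) (by linarith)).add (pw_mul kz_O hh (by linarith))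

lemma c_id (n : WithTop ℕ∞) : ContDiffOn ℝ n (fun z : ℂ => z) (pB R) := contDiffOn_id
lemma c_conj (n : WithTop ℕ∞) : ContDiffOn ℝ n (fun z : ℂ => conj z) (pB R) :=
  Complex.conjCLE.contDiff.contDiffOn
lemma c_inv (n : WithTop ℕ∞) : ContDiffOn ℝ n (fun z : ℂ => z⁻¹) (pB R) :=
  fun z hz => (contDiffAt_inv ℝ (mem_pB.1 hz).2).contDiffWithinAt
lemma c_inv' (n : WithTop ℕ∞) : ContDiffOn ℝ n (fun z : ℂ => (conj z)⁻¹) (pB R) :=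
  fun z hz => ((Complex.conjCLE.contDiff.contDiffAt (x := z)).inv
    (by simpa using (mem_pB.1 hz).2)).contDiffWithinAt

lemma dAt {F : ℂ → ℂ} (hF : ContDiffOn ℝ 1 F (pB R)) {z : ℂ} (hz : z ∈ pB R) : DifferentiableAt ℝ F z :=
  (hF.contDiffAt ((isOpen_pB R).mem_nhds hz)).differentiableAt (by norm_num)

lemma dbar_conj_mul_inv {z : ℂ} (hz : z ≠ 0) : dbar (fun z => conj z * z⁻¹) z = z⁻¹ := by
  have hz' : z ∈ pB (‖z‖ + 1) := mem_pB.2 ⟨by linarith, hz⟩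
  rw [dbar_mul (F := fun z => conj z) (G := fun z => z⁻¹) (dAt (c_conj 1) hz') (dAt (c_inv 1) hz'), dbar_conj,
    dbar_holo (F := fun z : ℂ => z⁻¹) (differentiableAt_inv hz)]
  ring

lemma dbar_mul_conj_inv {z : ℂ} (hz : z ≠ 0) : dbar (fun z => z * (conj z)⁻¹) z = - z * ((conj z)⁻¹) ^ 2 := by
  have hz' : z ∈ pB (‖z‖ + 1) := mem_pB.2 ⟨by linarith, hz⟩
  have hc : conj z ≠ 0 := by simpa using hz
  rw [dbar_id_mul (c_inv' 1) hz', dbar_comp_conj (F := fun z : ℂ => z⁻¹) (differentiableAt_inv hc)]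
  simp

lemma step2 (S : Sys R w f h Φ) (hR : 0 < R) {c : ℂ} (hw : w =O[nz] pw (-(1/20))) (hf : f =O[nz] pw (-(1/20)))
    (hh : (fun z => z * (z * h z) - c) =O[nz] pw (3/8)) : c = 0 := by
  set T : ℂ → ℂ := fun z => (c/4) * (conj z * z⁻¹) + (conj c/4) * (z * (conj z)⁻¹) with hT
  have cT : ContDiffOn ℝ 1 T (pB R) :=
    (contDiffOn_const.mul ((c_conj 1).mul (c_inv 1))).add (contDiffOn_const.mul ((c_id 1).mul (c_inv' 1)))
  have czw : ContDiffOn ℝ 1 (fun z => z * w z) (pB R) := (c_id 1).mul S.cw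
  have bic : (fun z : ℂ => (conj z)⁻¹) =O[nz] pw (-1) := by simpa using pw_conj pw_inv
  have bT : T =O[nz] pw 0 := by
    refine Asymptotics.IsBigO.add (pw_mul (pw_const _ le_rfl) (pw_mul (pw_conj pw_id) pw_inv (le_of_eq rfl)) (by norm_num))
      (pw_mul (pw_const _ le_rfl) (pw_mul pw_id bic (le_of_eq rfl)) (by norm_num))
  have bzw : (fun z => z * w z) =O[nz] pw (1/2) := pw_mul pw_id hw (by norm_num)
  have dT : ∀ z ∈ pB R, dbar T z = (c/4) * z⁻¹ - (conj c/4) * (z * ((conj z)⁻¹) ^ 2) := by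
    intro z hz
    have hz0 := (mem_pB.1 hz).2
    rw [hT, dbar_add (F := fun z => (c/4) * (conj z * z⁻¹)) (G := fun z => (conj c/4) * (z * (conj z)⁻¹)),
      dbar_const_mul (F := fun z => (conj z * z⁻¹)), dbar_const_mul (F := fun z => z * (conj z)⁻¹),
      dbar_conj_mul_inv hz0, dbar_mul_conj_inv hz0]
    · ring
    · exact dAt ((c_id 1).mul (c_inv' 1)) hz
    · exact dAt ((c_conj 1).mul (c_inv 1)) hz
    · exact dAt (contDiffOn_const.mul ((c_conj 1).mul (c_inv 1))) hz
    · exact dAt (contDiffOn_const.mul ((c_id 1).mul (c_inv' 1))) hz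
  set D : ℂ → ℂ := fun z => z * (z * h z) - c with hD
  have dQ : ∀ z ∈ pB R, dbar (fun z => z * w z - T z) z =
      (-(1/2)) * (z * (Ez z * f z)) + (1/4) * ((z⁻¹ * D z) - z * (conj (z⁻¹) * (conj (z⁻¹) * conj (D z)))) := by
    intro z hz
    have hz0 := (mem_pB.1 hz).2
    have hc : conj z ≠ 0 := by simpa using hz0
    rw [dbar_sub (F := fun z => z * w z) (dAt czw hz) (dAt cT hz), dbar_id_mul S.cw hz, dT z hz, S.ew z hz]
    have him : Complex.I * ((h z).im : ℂ) = (h z - conj (h z)) / 2 := by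
      apply Complex.ext <;> simp
    rw [him, hD]
    simp only [map_sub, map_mul, map_inv₀]
    field_simp
    ring
  have bD' := pw_conj hh
  have bi' := pw_conj pw_inv
  have bQ : dbar (fun z => z * w z - T z) =O[nz] pw (-(5/8)) := by
    refine dbar_bigO hR dQ ?_
    refine (pw_mul (pw_const _ le_rfl) (pw_mul pw_id (pw_mul Ez_O hf le_rfl) le_rfl) (by norm_num)).add
      (pw_mul (pw_const _ le_rfl) ((pw_mul pw_inv hh le_rfl).sub
        (pw_le (pw_mul pw_id (pw_mul bi' (pw_mul bi' bD' le_rfl) le_rfl) le_rfl) ?_)) (by norm_num)) <;> norm_num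
  obtain ⟨L, hL⟩ := lemmaA_lim (a := 5/8) (by norm_num) (by norm_num) hR (czw.sub cT)
    (((pw_le bzw (by norm_num)).sub bT).trans (pw_mono (by norm_num))) bQ
  have hTL : Tendsto T nz (𝓝 (0 - L)) := by
    refine ((pw_tendsto (by norm_num) bzw).sub hL).congr fun z => by ring
  have hom : ∀ ξ : ℂ, ξ ≠ 0 → T ξ = 0 - L := by
    intro ξ hξ
    refine ray_lim hTL hξ fun t ht => ?_
    have : (t:ℂ) ≠ 0 := by exact_mod_cast ht.ne'
    have hc : conj ξ ≠ 0 := by simpa using hξ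
    simp only [hT, map_mul, Complex.conj_ofReal]
    field_simp
  have e1 := hom 1 one_ne_zero
  have e2 := hom Complex.I Complex.I_ne_zero
  have e3 := hom (1 + Complex.I) (fun h => by simpa using congrArg Complex.re h)
  have hi : (1 + Complex.I)⁻¹ = (1 - Complex.I) / 2 :=
    inv_eq_of_mul_eq_one_right (by apply Complex.ext <;> simp <;> norm_num)
  have hi' : (1 + -Complex.I)⁻¹ = (1 + Complex.I) / 2 :=
    inv_eq_of_mul_eq_one_right (by apply Complex.ext <;> simp <;> norm_num)
  rw [← e1] at e2 e3
  simp only [hT, map_one, map_add, Complex.conj_I, hi, hi'] at e2 e3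
  have hre : c.re = 0 := by
    have := congrArg Complex.re e2
    simp at this
    linarith
  apply Complex.ext
  · simpa using hre
  · have := congrArg Complex.re e3
    simp [hre] at this ⊢
    linarith

lemma step3 (S : Sys R w f h Φ) (hR : 0 < R) {c : ℂ} (hw : w =O[nz] pw (-(1/20))) (hf : f =O[nz] pw (-(1/20)))
    (hwl : w =o[nz] lg)
    (hh : (fun z => z * h z - c) =O[nz] pw (1/8)) : c = 0 := by
  set T : ℂ → ℂ := fun z => (c/4) * (conj z * z⁻¹) with hT
  set T' : ℂ → ℂ := fun z => (-conj c/2) * lg z with hT'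
  have cT : ContDiffOn ℝ 1 T (pB R) := (contDiffOn_const.mul ((c_conj 1).mul (c_inv 1)))
  have cT' : ContDiffOn ℝ 1 T' (pB R) := (contDiffOn_const.mul (lg_contDiff R 1))
  have bT : T =O[nz] pw 0 :=
    (pw_mul (pw_const _ le_rfl) (pw_mul (pw_conj pw_id) pw_inv (le_of_eq rfl)) (by norm_num))
  have blg : lg =O[nz] pw (-(1/20)) := by
    have h1 : (fun z : ℂ => Real.log ‖z‖) =o[nz] fun z => ‖z‖ ^ (-(1/20:ℝ)) :=
      (isLittleO_log_rpow_nhdsGT_zero (by norm_num)).comp_tendsto tendsto_norm_nhdsNE_zero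
    exact Asymptotics.IsBigO.trans (Asymptotics.IsBigO.of_bound 1 (Eventually.of_forall fun z => by simp [lg])) h1.isBigO
  have bT' : T' =O[nz] pw (-(1/20)) := pw_mul (pw_const _ le_rfl) blg (by norm_num)
  have dT : ∀ z ∈ pB R, dbar (fun z => T z + T' z) z = (c/4) * z⁻¹ - (conj c/4) * (conj z)⁻¹ := by
    intro z hz
    have hz0 := (mem_pB.1 hz).2
    rw [dbar_add (dAt cT hz) (dAt cT' hz), hT, hT',
      dbar_const_mul (F := fun z => (conj z * z⁻¹)), dbar_const_mul (F := lg),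
      dbar_conj_mul_inv hz0, dbar_lg hz0]
    · rw [one_div, mul_inv]; ring
    · exact dAt (lg_contDiff R 1) hz
    · exact dAt ((c_conj 1).mul (c_inv 1)) hz
  set D : ℂ → ℂ := fun z => z * h z - c with hD
  have dQ : ∀ z ∈ pB R, dbar (fun z => w z - (T z + T' z)) z =
      (-(1/2)) * (Ez z * f z) + (1/4) * ((z⁻¹ * D z) - (conj (z⁻¹) * conj (D z))) := by
    intro z hz
    have hz0 := (mem_pB.1 hz).2
    have hc : conj z ≠ 0 := by simpa using hz0
    rw [dbar_sub (F := w) (G := fun z => T z + T' z) (dAt S.cw hz) (dAt (cT.add cT') hz), dT z hz, S.ew z hz]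
    have him : Complex.I * ((h z).im : ℂ) = (h z - conj (h z)) / 2 := by
      apply Complex.ext <;> simp
    rw [him, hD]
    simp only [map_sub, map_mul, map_inv₀]
    field_simp
    ring
  have bD' := pw_conj hh
  have bi' := pw_conj pw_inv
  have bQ : dbar (fun z => w z - (T z + T' z)) =O[nz] pw (-(7/8)) := by
    refine dbar_bigO hR dQ ?_
    refine (pw_mul (pw_const _ le_rfl) (pw_mul Ez_O hf le_rfl) (by norm_num)).add
      (pw_mul (pw_const _ le_rfl) ((pw_mul pw_inv hh le_rfl).sub
        (pw_le (pw_mul bi' bD' le_rfl) ?_)) (by norm_num)) <;> norm_num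
  have hbd := lemmaA_bdd (a := 7/8) (by norm_num) (by norm_num) hR (S.cw.sub (cT.add cT'))
    ((pw_le hw (by norm_num)).sub ((bT.trans (pw_mono (by norm_num))).add (bT'.trans (pw_mono (by norm_num))))) bQ
  have h1 : T' =o[nz] lg := by
    refine ((hwl.sub (const_littleO hbd)).sub (const_littleO bT)).congr_left fun z => ?_
    simp
  have := lg_coef h1
  simpa using this

lemma step4 (S : Sys R w f h Φ) (hR : 0 < R) {c : ℂ} (hw : w =O[nz] pw (-(1/20))) (hf : f =O[nz] pw (-(1/20)))
    (hfl : f =o[nz] lg)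
    (hh : (fun z => z * Φ z - c) =O[nz] pw (3/8)) : c = 0 := by
  set T' : ℂ → ℂ := fun z => conj c * lg z with hT'
  have cT' : ContDiffOn ℝ 1 T' (pB R) := (contDiffOn_const.mul (lg_contDiff R 1))
  have blg : lg =O[nz] pw (-(1/20)) := by
    have h1 : (fun z : ℂ => Real.log ‖z‖) =o[nz] fun z => ‖z‖ ^ (-(1/20:ℝ)) :=
      (isLittleO_log_rpow_nhdsGT_zero (by norm_num)).comp_tendsto tendsto_norm_nhdsNE_zero
    exact Asymptotics.IsBigO.trans (Asymptotics.IsBigO.of_bound 1 (Eventually.of_forall fun z => by simp [lg])) h1.isBigO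
  have bT' : T' =O[nz] pw (-(1/20)) := pw_mul (pw_const _ le_rfl) blg (by norm_num)
  have dT : ∀ z ∈ pB R, dbar T' z = (conj c/2) * (conj z)⁻¹ := by
    intro z hz
    have hz0 := (mem_pB.1 hz).2
    rw [hT', dbar_const_mul (F := lg) _ (dAt (lg_contDiff R 1) hz), dbar_lg hz0, one_div, mul_inv]
    ring
  set D : ℂ → ℂ := fun z => z * Φ z - c with hD
  have dQ : ∀ z ∈ pB R, dbar (fun z => f z + T' z) z =
      (1/2) * (conj (w z) * (conj (f z) + 2)) + (-(1/2)) * (conj (z⁻¹) * conj (D z)) := by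
    intro z hz
    have hz0 := (mem_pB.1 hz).2
    have hc : conj z ≠ 0 := by simpa using hz0
    have c2 : conj (2:ℂ) = 2 := by rw [map_ofNat]
    rw [dbar_add (dAt S.cf hz) (dAt cT' hz), dT z hz, S.ef z hz]
    rw [hD]
    simp only [map_sub, map_mul, map_inv₀, map_add, c2]
    field_simp
    ring
  have bD' := pw_conj hh
  have bi' := pw_conj pw_inv
  have bQ : dbar (fun z => f z + T' z) =O[nz] pw (-(5/8)) := by
    refine dbar_bigO hR dQ ?_
    refine (pw_mul (pw_const _ le_rfl) (pw_mul (pw_conj hw) ((pw_conj hf).add (pw_const _ ?_)) le_rfl) ?_).add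
      (pw_mul (pw_const _ le_rfl) (pw_mul bi' bD' le_rfl) ?_) <;> norm_num
  have hbd := lemmaA_bdd (a := 5/8) (by norm_num) (by norm_num) hR (S.cf.add cT')
    ((pw_le hf (by norm_num)).add (bT'.trans (pw_mono (by norm_num)))) bQ
  have h1 : T' =o[nz] lg := by
    refine ((const_littleO hbd).sub hfl).congr_left fun z => ?_
    simp
  have := lg_coef h1
  simpa using this
end chain

lemma rpow_le_half {r ε : ℝ} (h0 : 0 < r) (h1 : r ≤ 1) (h : ε ≤ 1/2) : r ^ (-ε) ≤ r ^ (-(1/2:ℝ)) :=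
  Real.rpow_le_rpow_of_exponent_ge h0 h1 (by linarith)

lemma chain_h {R : ℝ} {w f h Φ : ℂ → ℂ} (hR : 0 < R) (S : Sys R w f h Φ) (hw : w =o[nz] lg) (hf : f =o[nz] lg) :
    w =O[nz] pw 0 ∧ h =O[nz] pw 0 := by
  have hwe := littleO_lg hw (show (0:ℝ) < 1/20 by norm_num)
  have hfe := littleO_lg hf (show (0:ℝ) < 1/20 by norm_num)
  obtain ⟨R1, hR1, hb⟩ := exists_pB (hwe.and hfe)
  have bw : w =O[nz] pw (-(1/20)) := bigO_of_pB (C := 1) hR1 (fun z hz => by simpa using (hb z hz).1)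
  have bf : f =O[nz] pw (-(1/20)) := bigO_of_pB (C := 1) hR1 (fun z hz => by simpa using (hb z hz).2)
  set R2 := min R (min R1 1) with hR2
  have h2 : 0 < R2 := by positivity
  have h2R : R2 ≤ R := min_le_left _ _
  have h2R1 : R2 ≤ R1 := (min_le_right _ _).trans (min_le_left _ _)
  have h21 : R2 ≤ 1 := (min_le_right _ _).trans (min_le_right _ _)
  have S2 := S.restrict h2R
  have hwk := weak_h S2 h21 (ε := 1/20) (by norm_num) (by norm_num) (fun z hz => (hb z (pB_mono h2R1 hz)).1)
    (fun z hz => (hb z (pB_mono h2R1 hz)).2)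
  obtain ⟨R3, C3, hR3, h32, hC3, hh⟩ := lemmaB' (A := 3) (by norm_num) h2 h21 (by norm_num) S2.ch (by
    intro z hz
    have hz' := mem_pB.1 hz
    have h0 := norm_pos_iff.2 hz'.2
    have hz1 : ‖z‖ ≤ 1 := by linarith
    rw [S2.eh z hz]
    have e1 : ‖w z‖ ≤ ‖z‖ ^ (-(1/2:ℝ)) := ((hb z (pB_mono h2R1 hz)).1).trans (rpow_le_half h0 hz1 (by norm_num))
    have e2 : 1 ≤ ‖z‖ ^ (-(1/2:ℝ)) := Real.one_le_rpow_of_pos_of_le_one_of_nonpos h0 hz1 (by norm_num)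
    have e3 := kz_norm z
    have e4 := Complex.abs_im_le_norm (h z)
    refine (norm_add_le _ _).trans ?_
    simp only [norm_mul, norm_div, Complex.norm_I, Complex.norm_real, Complex.norm_conj, Complex.norm_ofNat, Real.norm_eq_abs]
    have e5 : ‖kz z‖ ≤ 2 * ‖z‖ ^ (-(1/2:ℝ)) := by linarith
    calc 1 / 2 * |(h z).im| * ‖w z‖ + ‖kz z‖ * ‖h z‖ ≤ 1 / 2 * ‖h z‖ * ‖z‖ ^ (-(1/2:ℝ)) + 2 * ‖z‖ ^ (-(1/2:ℝ)) * ‖h z‖ := by gcongr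
      _ ≤ _ := by
        have : 0 ≤ ‖z‖ ^ (-(1/2:ℝ)) * ‖h z‖ := by positivity
        nlinarith) hwk
  have bh : h =O[nz] pw (-(2 + 2 * (1/20))) := bigO_of_pB hR3 hh
  have czh : ContDiffOn ℝ 1 (fun z => z * h z) (pB R) := (c_id 1).mul S.ch
  have czzh : ContDiffOn ℝ 1 (fun z => z * (z * h z)) (pB R) := (c_id 1).mul czh
  have dzh : ∀ z ∈ pB R, dbar (fun z => z * h z) z = z * dbar h z := fun z hz => dbar_id_mul S.ch hz
  have dzzh : ∀ z ∈ pB R, dbar (fun z => z * (z * h z)) z = z * (z * dbar h z) := fun z hz => by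
    rw [dbar_id_mul czh hz, dzh z hz]
  obtain ⟨c2, hc2⟩ := lemmaA' (a := 1/4) (by norm_num) (by norm_num) hR czzh
    (pw_mul pw_id (pw_mul pw_id bh le_rfl) (by norm_num))
    (dbar_bigO hR dzzh (pw_mul pw_id (pw_mul pw_id (S.dh hR bw (by norm_num) bh le_rfl) le_rfl) (by norm_num)))
  have hc2' := step2 S hR bw bf (pw_le hc2 (by norm_num))
  subst hc2'
  simp only [sub_zero] at hc2
  have bh2 : h =O[nz] pw (-(13/8)) := by
    refine (pw_mul pw_inv (pw_mul pw_inv hc2 le_rfl) (by norm_num : -(13/8:ℝ) ≤ _)).congr' ?_ EventuallyEq.rfl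
    filter_upwards [self_mem_nhdsWithin] with z hz
    have : z ≠ 0 := hz
    field_simp
  obtain ⟨c1, hc1⟩ := lemmaA' (a := 3/4) (by norm_num) (by norm_num) hR czh
    (pw_mul pw_id bh2 (by norm_num))
    (dbar_bigO hR dzh (pw_mul pw_id (S.dh hR bw (by norm_num) bh2 le_rfl) (by norm_num)))
  have hc1' := step3 S hR bw bf hw (pw_le hc1 (by norm_num))
  subst hc1'
  simp only [sub_zero] at hc1
  have bh3 : h =O[nz] pw (-(7/8)) := by
    refine (pw_mul pw_inv hc1 (by norm_num : -(7/8:ℝ) ≤ _)).congr' ?_ EventuallyEq.rfl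
    filter_upwards [self_mem_nhdsWithin] with z hz
    have : z ≠ 0 := hz
    field_simp
  have bh4 : h =O[nz] pw 0 := lemmaA_bdd (a := 15/16) (by norm_num) (by norm_num) hR S.ch (pw_le bh3 (by norm_num))
    (S.dh hR bw (by norm_num) bh3 (by norm_num))
  refine ⟨?_, bh4⟩
  refine lemmaA_bdd (a := 1/4) (by norm_num) (by norm_num) hR S.cw (pw_le bw (by norm_num)) (dbar_bigO hR S.ew ?_)
  refine pw_mul (pw_const _ le_rfl) ((pw_le (pw_mul Ez_O bf le_rfl) ?_).sub (pw_mul (pw_const _ le_rfl) (pw_im bh4) ?_))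
    (le_of_eq (zero_add _).symm) <;> norm_num

lemma chain {R : ℝ} {w f h Φ : ℂ → ℂ} (hR : 0 < R) (S : Sys R w f h Φ) (hw : w =o[nz] lg) (hf : f =o[nz] lg) :
    w =O[nz] pw 0 ∧ f =O[nz] pw 0 ∧ h =O[nz] pw 0 ∧ Φ =O[nz] pw 0 := by
  obtain ⟨bw0, bh0⟩ := chain_h hR S hw hf
  have hwe := littleO_lg hw (show (0:ℝ) < 1/20 by norm_num)
  have hfe := littleO_lg hf (show (0:ℝ) < 1/20 by norm_num)
  obtain ⟨R1, hR1, hb⟩ := exists_pB (hwe.and hfe)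
  have bw : w =O[nz] pw (-(1/20)) := bigO_of_pB (C := 1) hR1 (fun z hz => by simpa using (hb z hz).1)
  have bf : f =O[nz] pw (-(1/20)) := bigO_of_pB (C := 1) hR1 (fun z hz => by simpa using (hb z hz).2)
  obtain ⟨R0, C0, hR0, hC0, hbh⟩ := bigO_pB bh0
  set R2 := min R (min R1 (min R0 1)) with hR2
  have h2 : 0 < R2 := by positivity
  have h2R : R2 ≤ R := min_le_left _ _
  have h2R1 : R2 ≤ R1 := (min_le_right _ _).trans (min_le_left _ _)
  have h2R0 : R2 ≤ R0 := (min_le_right _ _).trans ((min_le_right _ _).trans (min_le_left _ _))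
  have h21 : R2 ≤ 1 := (min_le_right _ _).trans ((min_le_right _ _).trans (min_le_right _ _))
  have S2 := S.restrict h2R
  have hwk := weak_Φ S2 h21 (ε := 1/20) (by norm_num) (by norm_num) (fun z hz => (hb z (pB_mono h2R1 hz)).1)
    (fun z hz => (hb z (pB_mono h2R1 hz)).2)
  obtain ⟨R3, C3, hR3, h32, hC3, hΦ⟩ := lemmaB' (A := 3 * C0 + 1) (by positivity) h2 h21 (by norm_num) S2.cΦ (by
    intro z hz
    have hz' := mem_pB.1 hz
    have h0 := norm_pos_iff.2 hz'.2
    have hz1 : ‖z‖ ≤ 1 := by linarith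
    rw [S2.eΦ z hz]
    have e1 : ‖w z‖ ≤ ‖z‖ ^ (-(1/2:ℝ)) := ((hb z (pB_mono h2R1 hz)).1).trans (rpow_le_half h0 hz1 (by norm_num))
    have e1' : ‖f z‖ ≤ ‖z‖ ^ (-(1/2:ℝ)) := ((hb z (pB_mono h2R1 hz)).2).trans (rpow_le_half h0 hz1 (by norm_num))
    have e2 : 1 ≤ ‖z‖ ^ (-(1/2:ℝ)) := Real.one_le_rpow_of_pos_of_le_one_of_nonpos h0 hz1 (by norm_num)
    have e3 : ‖h z‖ ≤ C0 := by simpa using hbh z (pB_mono h2R0 hz)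
    have e4 := (Complex.abs_im_le_norm (h z)).trans e3
    have e4' := (Complex.abs_re_le_norm (h z)).trans e3
    have e6 := Complex.abs_im_le_norm (w z * conj (Φ z))
    rw [norm_mul, Complex.norm_conj] at e6
    have e7 : ‖f z + 2‖ ≤ 3 * ‖z‖ ^ (-(1/2:ℝ)) := by
      refine (norm_add_le _ _).trans ?_
      rw [Complex.norm_ofNat]; linarith
    have e8 : ‖Complex.I / 2 * (-(f z + 2) * (h z).im + (w z * conj (Φ z)).im)‖ ≤
        1 / 2 * (3 * ‖z‖ ^ (-(1/2:ℝ)) * C0 + ‖z‖ ^ (-(1/2:ℝ)) * ‖Φ z‖) := by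
      rw [norm_mul, norm_div, Complex.norm_I, Complex.norm_ofNat]
      gcongr
      refine (norm_add_le _ _).trans ?_
      rw [norm_mul, norm_neg, Complex.norm_real, Complex.norm_real, Real.norm_eq_abs, Real.norm_eq_abs]
      gcongr
      exact e6.trans (by gcongr)
    refine (norm_sub_le _ _).trans ?_
    rw [Complex.norm_real, Real.norm_eq_abs]
    set P := ‖z‖ ^ (-(1/2:ℝ))
    have e9 : C0 ≤ C0 * P := by nlinarith
    have e10 : 0 ≤ P * C0 * ‖Φ z‖ := by positivity
    have e11 : 0 ≤ P * ‖Φ z‖ := by positivity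
    nlinarith) hwk
  have bΦ : Φ =O[nz] pw (-(1 + 2 * (1/20))) := bigO_of_pB hR3 hΦ
  have bf2 : (fun z => (f z + 2)) =O[nz] pw (-(1/20)) := bf.add (pw_const _ (by norm_num))
  have dΦ : ∀ s : ℝ, s ≤ -(1/20) → Φ =O[nz] pw s → dbar Φ =O[nz] pw s := by
    intro s hs hs'
    refine dbar_bigO hR S.eΦ ?_
    have h1 : (fun z => (-(f z + 2) * ((h z).im:ℂ))) =O[nz] pw s :=
      pw_mul bf2.neg_left (pw_im bh0) (by linarith)
    have h2 : (fun z => (((w z * conj (Φ z)).im:ℝ):ℂ)) =O[nz] pw s :=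
      pw_im (pw_mul bw0 (pw_conj hs') (by linarith))
    exact (pw_le (pw_re bh0) (by linarith)).sub (pw_mul (pw_const _ le_rfl) (h1.add h2) (by linarith))
  have czΦ : ContDiffOn ℝ 1 (fun z => z * Φ z) (pB R) := (c_id 1).mul S.cΦ
  obtain ⟨c1, hc1⟩ := lemmaA' (a := 1/4) (by norm_num) (by norm_num) hR czΦ
    (pw_mul pw_id bΦ (by norm_num))
    (dbar_bigO hR (fun z hz => dbar_id_mul S.cΦ hz) (pw_mul pw_id (dΦ _ (by norm_num) bΦ) (by norm_num)))
  have hc1' := step4 S hR bw bf hf (pw_le hc1 (by norm_num))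
  subst hc1'
  simp only [sub_zero] at hc1
  have bΦ2 : Φ =O[nz] pw (-(5/8)) := by
    refine (pw_mul pw_inv hc1 (by norm_num : -(5/8:ℝ) ≤ _)).congr' ?_ EventuallyEq.rfl
    filter_upwards [self_mem_nhdsWithin] with z hz
    have : z ≠ 0 := hz
    field_simp
  have bΦ3 : Φ =O[nz] pw 0 := lemmaA_bdd (a := 5/8) (by norm_num) (by norm_num) hR S.cΦ bΦ2 (dΦ _ (by norm_num) bΦ2)
  refine ⟨bw0, ?_, bh0, bΦ3⟩
  refine lemmaA_bdd (a := 1/4) (by norm_num) (by norm_num) hR S.cf (pw_le bf (by norm_num)) (dbar_bigO hR S.ef ?_)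
  exact pw_mul (pw_const _ le_rfl) (pw_conj ((pw_mul bw0 bf2 (by norm_num : -(1/4:ℝ) ≤ _)).sub (pw_le bΦ3 (by norm_num))))
    (le_of_eq (zero_add _).symm)

lemma conv_right {f g : ℂ → ℂ} (hf : LocallyIntegrable f) (hg : ContDiff ℝ 1 g) (hgc : HasCompactSupport g) :
    ContDiff ℝ 1 (fun z => ∫ t, f t * g (z - t)) ∧ ∀ z v, fderiv ℝ (fun z => ∫ t, f t * g (z - t)) z v =
      ∫ t, f t * fderiv ℝ g (z - t) v := by
  have h0 : (fun z => ∫ t, f t * g (z - t)) = convolution f g (ContinuousLinearMap.mul ℝ ℂ) volume := by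
    ext z; simp [convolution_def]
  rw [h0]
  refine ⟨hgc.contDiff_convolution_right (n := 1) _ hf hg, fun z v => ?_⟩
  rw [(hgc.hasFDerivAt_convolution_right (ContinuousLinearMap.mul ℝ ℂ) hf hg z).fderiv,
    convolution_precompR_apply _ hf (hgc.fderiv ℝ) (hg.continuous_fderiv (by norm_num))]
  simp [convolution_def]

lemma conv_left {f g : ℂ → ℂ} (hf : LocallyIntegrable f) (hg : ContDiff ℝ 1 g) (hgc : HasCompactSupport g) :
    ContDiff ℝ 1 (fun z => ∫ t, g t * f (z - t)) ∧ ∀ z v, fderiv ℝ (fun z => ∫ t, g t * f (z - t)) z v =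
      ∫ t, fderiv ℝ g t v * f (z - t) := by
  have h0 : ∀ (k : ℂ → ℂ) z, ∫ t, k t * f (z - t) = ∫ t, f t * k (z - t) := by
    intro k z
    rw [← integral_sub_left_eq_self (fun t => f t * k (z - t)) volume z]
    congr 1; ext t; simp [mul_comm]
  simp_rw [h0]
  have := conv_right hf hg hgc
  refine ⟨this.1, fun z v => ?_⟩
  rw [this.2]

lemma CT_eq (G : ℂ → ℂ) (z : ℂ) : CT G z = ∫ t, t⁻¹ * G (z - t) := by
  rw [CT, ← integral_sub_left_eq_self (fun ζ => G ζ * (z - ζ)⁻¹) volume z]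
  congr 1; ext t; simp [mul_comm]

lemma locInt_inv : LocallyIntegrable (fun ζ : ℂ => ζ⁻¹) := by
  refine (locInt_norm_rpow (σ := 1) (by norm_num)).mono (by fun_prop) (Eventually.of_forall fun z => ?_)
  simp [Real.rpow_neg_one]

lemma CT_C1 {G : ℂ → ℂ} (hG : ContDiff ℝ 1 G) (hc : HasCompactSupport G) :
    ContDiff ℝ 1 (CT G) ∧ ∀ z v, fderiv ℝ (CT G) z v = CT (fun ζ => fderiv ℝ G ζ v) z := by
  have h0 : CT G = fun z => ∫ t, t⁻¹ * G (z - t) := by ext z; exact CT_eq G z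
  rw [h0]
  have := conv_right locInt_inv hG hc
  refine ⟨this.1, fun z v => ?_⟩
  rw [this.2, CT_eq]

/-- dyadic piece of the Cauchy kernel -/
def kk0 (ζ : ℂ) : ℂ := (cut 1 ζ - cut 2 ζ) * ζ⁻¹
/-- rescaled dyadic pieces -/
def kk (n : ℕ) (ζ : ℂ) : ℂ := 2 ^ n * kk0 ((2:ℝ) ^ n • ζ)

lemma kk0_C1 : ContDiff ℝ 1 kk0 := by
  rw [contDiff_iff_contDiffAt]
  intro z
  by_cases hz : z = 0
  · subst hz
    have h1 := cut_eventually_one (s := 1) (ζ := 0) (by norm_num) (by simp)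
    have h2 := cut_eventually_one (s := 2) (ζ := 0) (by norm_num) (by simp)
    refine (contDiffAt_const (c := (0:ℂ))).congr_of_eventuallyEq ?_
    filter_upwards [h1, h2] with z hz1 hz2
    simp [kk0, hz1, hz2]
  · exact (((contDiff_cut1 1).contDiffAt).sub ((contDiff_cut1 2).contDiffAt)).mul (contDiffAt_inv ℝ hz)

lemma kk0_hcs : HasCompactSupport kk0 := by
  apply HasCompactSupport.of_support_subset_isCompact (isCompact_closedBall (0:ℂ) (3/2))
  intro ζ hζ
  by_contra h
  simp at h
  apply hζ
  rw [kk0, cut_eq_zero (by norm_num) (by linarith), cut_eq_zero (by norm_num) (by linarith)]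
  simp

lemma kk_C1 (n : ℕ) : ContDiff ℝ 1 (kk n) :=
  contDiff_const.mul (kk0_C1.comp (contDiff_const_smul _))

lemma kk_hcs (n : ℕ) : HasCompactSupport (kk n) :=
  (kk0_hcs.comp_smul (by positivity : (2:ℝ)^n ≠ 0)).mul_left

lemma kk_fderiv (n : ℕ) (ζ v : ℂ) : fderiv ℝ (kk n) ζ v = (4:ℝ) ^ n * fderiv ℝ kk0 ((2:ℝ) ^ n • ζ) v := by
  have h1 : HasFDerivAt kk0 (fderiv ℝ kk0 ((2:ℝ)^n • ζ)) ((2:ℝ)^n • ζ) :=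
    (kk0_C1.differentiable (by norm_num) _).hasFDerivAt
  have h2 : HasFDerivAt (fun ζ : ℂ => (2:ℝ)^n • ζ) ((2:ℝ)^n • ContinuousLinearMap.id ℝ ℂ) ζ :=
    ((2:ℝ)^n • ContinuousLinearMap.id ℝ ℂ).hasFDerivAt
  have h3 := (h1.comp ζ h2).const_mul ((2:ℂ)^n)
  have h4 : HasFDerivAt (kk n) _ ζ := h3
  rw [h4.fderiv]
  have h5 : fderiv ℝ kk0 ((2:ℝ)^n • ζ) ((2:ℝ)^n • v) = (2:ℝ)^n • fderiv ℝ kk0 ((2:ℝ)^n • ζ) v :=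
    map_smul (fderiv ℝ kk0 ((2:ℝ)^n • ζ)) ((2:ℝ)^n) v
  simp only [smul_apply, ContinuousLinearMap.comp_apply, ContinuousLinearMap.id_apply]
  rw [h5, smul_eq_mul, Complex.real_smul]
  push_cast
  rw [show (4:ℂ) = 2 * 2 by norm_num, mul_pow]; ring

lemma scale_int (n : ℕ) (φ : ℂ → ℝ) : ∫ ζ, φ ((2:ℝ)^n • ζ) = ((4:ℝ)^n)⁻¹ * ∫ ζ, φ ζ := by
  rw [Measure.integral_comp_smul, Complex.finrank_real_complex, abs_of_pos (by positivity), smul_eq_mul, ← pow_mul,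
    mul_comm n 2, pow_mul]
  norm_num

lemma kk_int (n : ℕ) : ∫ ζ, ‖kk n ζ‖ = (1/2) ^ n * ∫ ζ, ‖kk0 ζ‖ := by
  simp_rw [kk, norm_mul, norm_pow, Complex.norm_ofNat]
  rw [integral_const_mul, scale_int n (fun ζ => ‖kk0 ζ‖), ← mul_assoc]
  congr 1
  rw [show (4:ℝ) = 2 * 2 by norm_num, mul_pow]
  field_simp
  rw [← mul_pow]; norm_num

lemma kk_dint (n : ℕ) (v : ℂ) : ∫ ζ, ‖fderiv ℝ (kk n) ζ v‖ * ‖ζ‖ ^ (1/2:ℝ) =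
    ((1/2) ^ (1/2:ℝ)) ^ n * ∫ ζ, ‖fderiv ℝ kk0 ζ v‖ * ‖ζ‖ ^ (1/2:ℝ) := by
  have h : ∀ ζ : ℂ, ‖fderiv ℝ (kk n) ζ v‖ * ‖ζ‖ ^ (1/2:ℝ) = (4:ℝ)^n * ((1/2) ^ (1/2:ℝ)) ^ n *
      (‖fderiv ℝ kk0 ((2:ℝ)^n • ζ) v‖ * ‖(2:ℝ)^n • ζ‖ ^ (1/2:ℝ)) := by
    intro ζ
    rw [kk_fderiv, norm_mul, Complex.ofReal_ofNat, norm_pow, Complex.norm_ofNat, norm_smul, norm_pow, Real.norm_ofNat,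
      Real.mul_rpow (by positivity) (by positivity)]
    have : ((1/2:ℝ) ^ (1/2:ℝ)) ^ n * ((2:ℝ)^n)^(1/2:ℝ) = 1 := by
      rw [← Real.rpow_natCast, ← Real.rpow_mul (by norm_num), mul_comm (1/2:ℝ) (n:ℝ), Real.rpow_mul (by norm_num), Real.rpow_natCast,
        ← Real.mul_rpow (by positivity) (by positivity), ← mul_pow]
      norm_num
    linear_combination (-(4:ℝ)^n * ‖fderiv ℝ kk0 ((2:ℝ)^n • ζ) v‖ * ‖ζ‖ ^ (1/2:ℝ)) * this
  simp_rw [h]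
  rw [integral_const_mul, scale_int n (fun ζ => ‖fderiv ℝ kk0 ζ v‖ * ‖ζ‖ ^ (1/2:ℝ))]
  field_simp

lemma kk_sum {ζ : ℂ} (hζ : ζ ≠ 0) : HasSum (fun n => kk n ζ) (cut 1 ζ * ζ⁻¹) := by
  have h1 : ∀ n : ℕ, kk n ζ = (cut (2^n) ζ - cut (2^(n+1)) ζ) * ζ⁻¹ := by
    intro n
    rw [kk, kk0, cut_scale (2^n), cut_scale (2^(n+1)), cut_scale 2 (_ • _)]
    have : (2:ℂ)^n ≠ 0 := pow_ne_zero _ two_ne_zero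
    rw [Complex.real_smul]; push_cast
    rw [show (2:ℂ)^(n+1) * ζ = 2 * (2^n * ζ) by ring]
    field_simp
  have h0 : 0 < ‖ζ‖ := norm_pos_iff.2 hζ
  obtain ⟨N, hN⟩ := pow_unbounded_of_one_lt (3/2/‖ζ‖) (one_lt_two (α := ℝ))
  have hz : ∀ n, N ≤ n → cut (2^n) ζ = 0 := by
    intro n hn
    apply cut_eq_zero (by positivity)
    rw [div_lt_iff₀ h0] at hN
    have : (2:ℝ)^N ≤ 2^n := pow_le_pow_right₀ one_le_two hn
    nlinarith
  have h2 : cut 1 ζ * ζ⁻¹ = ∑ n ∈ Finset.range N, kk n ζ := by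
    simp_rw [h1]
    rw [← Finset.sum_mul, Finset.sum_range_sub' (fun n => cut (2^n) ζ), hz N le_rfl]
    simp
  rw [h2]
  apply hasSum_sum_of_ne_finset_zero
  intro n hn
  rw [h1, hz n (by simpa using hn), hz (n+1) (by simp at hn; omega)]
  simp

lemma opn_le (L : ℂ →L[ℝ] ℂ) : ‖L‖ ≤ ‖L 1‖ + ‖L Complex.I‖ := by
  refine ContinuousLinearMap.opNorm_le_bound _ (by positivity) fun z => ?_
  have : z = z.re • (1:ℂ) + z.im • Complex.I := by
    rw [Complex.real_smul, Complex.real_smul, mul_one]; exact (Complex.re_add_im z).symm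
  conv_lhs => rw [this, map_add, map_smul, map_smul]
  refine (norm_add_le _ _).trans ?_
  rw [norm_smul, norm_smul, Real.norm_eq_abs, Real.norm_eq_abs, add_mul, mul_comm |z.re|, mul_comm |z.im|]
  gcongr
  · exact Complex.abs_re_le_norm z
  · exact Complex.abs_im_le_norm z

lemma holder_cont {G : ℂ → ℂ} {M : ℝ} (hM : ∀ z z', ‖G z - G z'‖ ≤ M * ‖z - z'‖ ^ (1/2:ℝ)) : Continuous G := by
  rw [continuous_iff_continuousAt]
  intro z
  rw [ContinuousAt, tendsto_iff_norm_sub_tendsto_zero]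
  have h1 : Tendsto (fun x : ℂ => M * ‖x - z‖ ^ (1/2:ℝ)) (𝓝 z) (𝓝 (M * ‖z - z‖ ^ (1/2:ℝ))) := by
    apply Continuous.tendsto
    exact continuous_const.mul ((continuous_norm.comp (continuous_id.sub continuous_const)).rpow_const (fun _ => Or.inr (by norm_num)))
  rw [sub_self, norm_zero, Real.zero_rpow (by norm_num), mul_zero] at h1
  exact squeeze_zero (fun _ => norm_nonneg _) (fun x => hM x z) h1

lemma CT_A {G : ℂ → ℂ} {M : ℝ} (hs : ∀ ζ, 1/2 < ‖ζ‖ → G ζ = 0)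
    (hM : ∀ z z', ‖G z - G z'‖ ≤ M * ‖z - z'‖ ^ (1/2:ℝ)) :
    ∃ F, ContDiff ℝ 1 F ∧ ∀ z ∈ ball (0:ℂ) (1/2), CT G z = F z := by
  have cG := holder_cont hM
  have hc : HasCompactSupport G := by
    apply HasCompactSupport.of_support_subset_isCompact (isCompact_closedBall (0:ℂ) (1/2))
    intro ζ hζ
    by_contra h
    simp at h
    exact hζ (hs ζ (by linarith))
  obtain ⟨B, hB⟩ := cG.bounded_above_of_compact_support hc
  have hB0 : 0 ≤ B := (norm_nonneg _).trans (hB 0)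
  have hM0 : 0 ≤ M := by
    have := (norm_nonneg _).trans (hM 1 0)
    simpa using this
  have liG : LocallyIntegrable G := cG.locallyIntegrable
  have lem := fun n => conv_left liG (kk_C1 n) (kk_hcs n)
  have kki : ∀ n, Integrable (kk n) := fun n => (kk_C1 n).continuous.integrable_of_hasCompactSupport (kk_hcs n)
  have dki : ∀ n v, Continuous (fun ζ => fderiv ℝ (kk n) ζ v) := fun n v =>
    ((kk_C1 n).continuous_fderiv (by norm_num)).clm_apply continuous_const
  have dkc : ∀ n v, HasCompactSupport (fun ζ => fderiv ℝ (kk n) ζ v) := fun n v =>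
    (kk_hcs n).fderiv_apply (𝕜 := ℝ) v
  have int1 : ∀ n z, Integrable (fun t => kk n t * G (z - t)) := fun n z => by
    refine ((kk_C1 n).continuous.mul (cG.comp (continuous_const.sub continuous_id))).integrable_of_hasCompactSupport ?_
    exact (kk_hcs n).mul_right
  have bd1 : ∀ n z, ∫ t, ‖kk n t * G (z - t)‖ ≤ (1/2)^n * ((∫ ζ, ‖kk0 ζ‖) * B) := by
    intro n z
    rw [← mul_assoc, ← kk_int, ← integral_mul_const]
    refine integral_mono (int1 n z).norm ((kki n).norm.mul_const _) fun t => ?_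
    simp only [norm_mul]
    gcongr
    exact hB _
  have sm1 : ∀ z, Summable fun n => ∫ t, ‖kk n t * G (z - t)‖ := fun z =>
    Summable.of_nonneg_of_le (fun n => integral_nonneg fun t => norm_nonneg _) (fun n => bd1 n z)
      ((summable_geometric_of_lt_one (by norm_num) (by norm_num)).mul_right _)
  set q : ℝ := (1/2) ^ (1/2:ℝ) with hq
  have hq0 : 0 ≤ q := by positivity
  have hq1 : q < 1 := Real.rpow_lt_one (by norm_num) (by norm_num) (by norm_num)
  set J : ℂ → ℝ := fun v => ∫ ζ, ‖fderiv ℝ kk0 ζ v‖ * ‖ζ‖ ^ (1/2:ℝ) with hJ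
  have bd2 : ∀ n z v, ‖∫ t, fderiv ℝ (kk n) t v * G (z - t)‖ ≤ q ^ n * (J v * M) := by
    intro n z v
    have e1 : ∫ t, fderiv ℝ (kk n) t v * G (z - t) = ∫ t, fderiv ℝ (kk n) t v * (G (z - t) - G z) := by
      have : ∫ t, fderiv ℝ (kk n) t v * G z = 0 := by
        rw [integral_mul_const, integral_fderiv_zero (kk_C1 n) (kk_hcs n), zero_mul]
      simp_rw [mul_sub]
      rw [integral_sub, this, sub_zero]
      · exact ((dki n v).mul (cG.comp (continuous_const.sub continuous_id))).integrable_of_hasCompactSupport (dkc n v).mul_right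
      · exact ((dki n v).mul continuous_const).integrable_of_hasCompactSupport (dkc n v).mul_right
    rw [e1, ← mul_assoc, hJ, hq, ← kk_dint, ← integral_mul_const]
    refine norm_integral_le_of_norm_le ?_ (Eventually.of_forall fun t => ?_)
    · apply Integrable.mul_const
      refine Continuous.integrable_of_hasCompactSupport ((dki n v).norm.mul (continuous_norm.rpow_const (fun _ => Or.inr (by norm_num)))) ?_
      exact (dkc n v).norm.mul_right
    · rw [norm_mul, mul_assoc]
      gcongr
      have := hM (z - t) z
      rw [mul_comm]
      simpa using this
  set Fn : ℕ → ℂ → ℂ := fun n z => ∫ t, kk n t * G (z - t) with hFn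
  set un : ℕ → ℝ := fun n => q^n * (J 1 * M + J Complex.I * M) with hun
  have su : Summable un := (summable_geometric_of_lt_one hq0 hq1).mul_right _
  have bdF : ∀ n z, ‖fderiv ℝ (Fn n) z‖ ≤ un n := by
    intro n z
    refine (opn_le _).trans ?_
    rw [(lem n).2, (lem n).2, hun]
    simp only [mul_add]
    exact add_le_add (bd2 n z 1) (bd2 n z Complex.I)
  have hs1 : ∀ z, HasSum (fun n => Fn n z) (∫ t, ∑' n, kk n t * G (z - t)) := fun z =>
    hasSum_integral_of_summable_integral_norm (fun n => int1 n z) (sm1 z)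
  have hd : ∀ n, Differentiable ℝ (Fn n) := fun n => (lem n).1.differentiable (by norm_num)
  refine ⟨fun z => ∑' n, Fn n z, ?_, fun z hz => ?_⟩
  · rw [contDiff_one_iff_fderiv]
    refine ⟨fun z => (hasFDerivAt_tsum su (fun n x => (hd n x).hasFDerivAt) bdF (hs1 0).summable z).differentiableAt, ?_⟩
    rw [fderiv_tsum su hd bdF (hs1 0).summable]
    exact continuous_tsum (fun n => (lem n).1.continuous_fderiv (by norm_num)) su bdF
  · show CT G z = ∑' n, Fn n z
    rw [(hs1 z).tsum_eq, CT_eq]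
    apply integral_congr_ae
    filter_upwards [ae_ne 0] with t ht
    rw [tsum_mul_right, (kk_sum ht).tsum_eq]
    by_cases h : G (z - t) = 0
    · simp [h]
    · rw [cut_eq_one zero_le_one, one_mul]
      have h1 : ‖z - t‖ ≤ 1/2 := not_lt.1 fun h' => h (hs _ h')
      rw [mem_ball_zero_iff] at hz
      have := norm_sub_norm_le t z
      rw [norm_sub_rev] at this
      linarith

lemma fderiv_decomp (L : ℂ →L[ℝ] ℂ) :
    L = Complex.reCLM.smulRight (L 1) + Complex.imCLM.smulRight (L Complex.I) := by
  ext x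
  have : x = x.re • (1:ℂ) + x.im • Complex.I := by
    rw [Complex.real_smul, Complex.real_smul, mul_one]; exact (Complex.re_add_im x).symm
  conv_lhs => rw [this, map_add, map_smul, map_smul]
  simp

lemma CT_C {G : ℂ → ℂ} {M : ℝ} (hs : ∀ ζ, 1/2 < ‖ζ‖ → G ζ = 0) (hG : ContDiff ℝ 1 G)
    (hM : ∀ v, v = 1 ∨ v = Complex.I → ∀ z z', ‖fderiv ℝ G z v - fderiv ℝ G z' v‖ ≤ M * ‖z - z'‖ ^ (1/2:ℝ)) :
    ContDiffOn ℝ 2 (CT G) (ball 0 (1/2)) := by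
  have hc : HasCompactSupport G := by
    apply HasCompactSupport.of_support_subset_isCompact (isCompact_closedBall (0:ℂ) (1/2))
    intro ζ hζ
    by_contra h
    simp at h
    exact hζ (hs ζ (by linarith))
  obtain ⟨h1, h2⟩ := CT_C1 hG hc
  have hs' : ∀ v ζ, 1/2 < ‖ζ‖ → fderiv ℝ G ζ v = 0 := by
    intro v ζ hζ
    have : G =ᶠ[𝓝 ζ] fun _ => 0 := by
      have : ∀ᶠ x in 𝓝 ζ, 1/2 < ‖x‖ := continuous_norm.continuousAt.eventually (lt_mem_nhds hζ)
      filter_upwards [this] with x hx using hs x hx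
    rw [this.fderiv_eq]; simp
  obtain ⟨F1, c1, e1⟩ := CT_A (hs' 1) (hM 1 (Or.inl rfl))
  obtain ⟨F2, c2, e2⟩ := CT_A (hs' Complex.I) (hM Complex.I (Or.inr rfl))
  rw [show (2 : WithTop ℕ∞) = 1 + 1 by norm_num, contDiffOn_succ_iff_fderiv_of_isOpen isOpen_ball]
  refine ⟨(h1.differentiable (by norm_num)).differentiableOn, by simp, ?_⟩
  have : ContDiffOn ℝ 1 (fun z => Complex.reCLM.smulRight (F1 z) + Complex.imCLM.smulRight (F2 z)) (ball (0:ℂ) (1/2)) := by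
    have a1 := ((ContinuousLinearMap.smulRightL ℝ ℂ ℂ) Complex.reCLM).contDiff.comp c1
    have a2 := ((ContinuousLinearMap.smulRightL ℝ ℂ ℂ) Complex.imCLM).contDiff.comp c2
    exact (a1.add a2).contDiffOn
  refine this.congr fun z hz => ?_
  rw [fderiv_decomp (fderiv ℝ (CT G) z), h2, h2, e1 z hz, e2 z hz]

/-- bounded -/
def K0 (r : ℝ) (F : ℂ → ℂ) : Prop := ∃ C, 0 ≤ C ∧ ∀ z ∈ pB r, ‖F z‖ ≤ C
/-- Hölder -/
def Kh (r : ℝ) (F : ℂ → ℂ) : Prop := ∃ M, 0 ≤ M ∧ ∀ z ∈ ball (0:ℂ) r, ∀ z' ∈ ball (0:ℂ) r, ‖F z - F z'‖ ≤ M * ‖z - z'‖ ^ (1/2:ℝ)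
/-- C^1 -/
def K1 (r : ℝ) (F : ℂ → ℂ) : Prop := ContDiffOn ℝ 1 F (ball 0 r)
/-- C^{1,1/2} -/
def K1h (r : ℝ) (F : ℂ → ℂ) : Prop := ContDiffOn ℝ 1 F (ball 0 r) ∧ ∀ v, Kh r (fun z => fderiv ℝ F z v)
/-- C^2 -/
def K2 (r : ℝ) (F : ℂ → ℂ) : Prop := ContDiffOn ℝ 2 F (ball 0 r)

/-- closure properties -/
structure Alg (K : (ℂ → ℂ) → Prop) : Prop where
  sm : ∀ F, ContDiff ℝ 2 F → K F
  add : ∀ F G, K F → K G → K (fun z => F z + G z)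
  mul : ∀ F G, K F → K G → K (fun z => F z * G z)
  cj : ∀ F, K F → K (fun z => conj (F z))

lemma Alg.c {K : (ℂ → ℂ) → Prop} (A : Alg K) (c : ℂ) : K (fun _ => c) := A.sm _ contDiff_const
lemma Alg.sub {K : (ℂ → ℂ) → Prop} (A : Alg K) (F G : ℂ → ℂ) (hF : K F) (hG : K G) : K (fun z => F z - G z) := by
  have := A.add _ _ hF (A.mul _ _ (A.c (-1)) hG)
  convert this using 2; ring

lemma Ez_smooth : ContDiff ℝ 2 Ez := by
  unfold Ez
  refine Complex.ofRealCLM.contDiff.comp (contDiff_const.div ((contDiff_const.add (contDiff_norm_sq ℝ)).pow 2) ?_)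
  intro z; positivity

lemma kz_smooth : ContDiff ℝ 2 kz := by
  unfold kz
  refine (Complex.ofRealCLM.contDiff.comp (contDiff_const.div ((contDiff_const.add (contDiff_norm_sq ℝ))) ?_)).mul contDiff_id
  intro z; positivity

lemma im_cj (z : ℂ) : ((z.im : ℝ) : ℂ) = -(Complex.I / 2) * (z - conj z) := by
  apply Complex.ext <;> simp <;> ring
lemma re_cj (z : ℂ) : ((z.re : ℝ) : ℂ) = (1/2) * (z + conj z) := by
  apply Complex.ext <;> simp <;> ring

lemma Alg.im {K : (ℂ → ℂ) → Prop} (A : Alg K) {F : ℂ → ℂ} (hF : K F) : K (fun z => ((F z).im : ℂ)) := by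
  simp_rw [im_cj]
  exact A.mul _ _ (A.c _) (A.sub _ _ hF (A.cj _ hF))
lemma Alg.re {K : (ℂ → ℂ) → Prop} (A : Alg K) {F : ℂ → ℂ} (hF : K F) : K (fun z => ((F z).re : ℂ)) := by
  simp_rw [re_cj]
  exact A.mul _ _ (A.c _) (A.add _ _ hF (A.cj _ hF))

lemma Alg.rhs {K : (ℂ → ℂ) → Prop} (A : Alg K) {w f h Φ : ℂ → ℂ} (hw : K w) (hf : K f) (hh : K h) (hΦ : K Φ) :
    K (fun z => -(1/2) * (Ez z * f z - Complex.I * (h z).im)) ∧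
    K (fun z => (1/2) * conj (w z * (f z + 2) - Φ z)) ∧
    K (fun z => Complex.I / 2 * (h z).im * conj (w z) + kz z * h z) ∧
    K (fun z => (h z).re - Complex.I / 2 * (-(f z + 2) * (h z).im + (w z * conj (Φ z)).im)) := by
  have f2 := A.add _ _ hf (A.c 2)
  refine ⟨A.mul _ _ (A.c _) (A.sub _ _ (A.mul _ _ (A.sm _ Ez_smooth) hf) (A.mul _ _ (A.c _) (A.im hh))),
    A.mul _ _ (A.c _) (A.cj _ (A.sub _ _ (A.mul _ _ hw f2) hΦ)),
    A.add _ _ (A.mul _ _ (A.mul _ _ (A.c _) (A.im hh)) (A.cj _ hw)) (A.mul _ _ (A.sm _ kz_smooth) hh), ?_⟩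
  refine A.sub _ _ (A.re hh) (A.mul _ _ (A.c _) (A.add _ _ (A.mul _ _ ?_ (A.im hh)) (A.im (A.mul _ _ hw (A.cj _ hΦ)))))
  simpa using A.mul _ _ (A.c (-1)) f2

lemma Alg.cutG {K : (ℂ → ℂ) → Prop} (A : Alg K) {r : ℝ} {W G : ℂ → ℂ} (hW : K W) (hG : K G) : K (cutG r W G) := by
  unfold _root_.cutG
  refine A.add _ _ (A.mul _ _ (A.sm _ (contDiff_cut _ (n := 2))) hG) (A.mul _ _ (A.sm _ ?_) hW)
  exact ContDiff.dbar' (n := 3) (contDiff_cut _ (n := 3)) (by norm_num)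

lemma alg0 (r : ℝ) : Alg (K0 r) where
  sm F hF := by
    obtain ⟨C, hC⟩ := (isCompact_closedBall (0:ℂ) r).exists_bound_of_continuousOn hF.continuous.continuousOn
    refine ⟨max C 0, le_max_right _ _, fun z hz => (hC z ?_).trans (le_max_left _ _)⟩
    rw [mem_pB] at hz; simpa using hz.1.le
  add F G := by
    rintro ⟨C, h0, hC⟩ ⟨D, h1, hD⟩
    exact ⟨C + D, by positivity, fun z hz => (norm_add_le _ _).trans (add_le_add (hC z hz) (hD z hz))⟩
  mul F G := by
    rintro ⟨C, h0, hC⟩ ⟨D, h1, hD⟩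
    refine ⟨C * D, by positivity, fun z hz => ?_⟩
    rw [norm_mul]
    exact mul_le_mul (hC z hz) (hD z hz) (norm_nonneg _) h0
  cj F := by
    rintro ⟨C, h0, hC⟩
    refine ⟨C, h0, fun z hz => ?_⟩
    rw [RCLike.norm_conj]; exact hC z hz

lemma Kh.bdd {r : ℝ} {F : ℂ → ℂ} (h : Kh r F) : ∃ C, 0 ≤ C ∧ ∀ z ∈ ball (0:ℂ) r, ‖F z‖ ≤ C := by
  obtain ⟨M, h0, hM⟩ := h
  refine ⟨‖F 0‖ + M * |r| ^ (1/2:ℝ), by positivity, fun z hz => ?_⟩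
  have hr : 0 < r := by
    by_contra h'
    rw [ball_eq_empty.2 (not_lt.1 h')] at hz; exact hz
  have h1 := hM z hz 0 (mem_ball_self hr)
  have h2 := norm_sub_norm_le (F z) (F 0)
  rw [mem_ball_zero_iff] at hz
  rw [sub_zero] at h1
  have h3 : M * ‖z‖ ^ (1/2:ℝ) ≤ M * |r| ^ (1/2:ℝ) := by
    gcongr; rw [abs_of_pos hr]; exact hz.le
  linarith

lemma Kh_of_fderiv {r C : ℝ} (hr : r ≤ 1/2) {F : ℂ → ℂ} (hC : 0 ≤ C) (hF : ContDiffOn ℝ 1 F (ball 0 r))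
    (h : ∀ z ∈ ball (0:ℂ) r, ‖fderiv ℝ F z‖ ≤ C) : Kh r F := by
  refine ⟨C, hC, fun z hz z' hz' => ?_⟩
  have h1 := (convex_ball (0:ℂ) r).norm_image_sub_le_of_norm_fderiv_le (𝕜 := ℝ)
    (fun x hx => (hF.contDiffAt (isOpen_ball.mem_nhds hx)).differentiableAt one_ne_zero) h hz' hz
  refine h1.trans (mul_le_mul_of_nonneg_left ?_ hC)
  have h2 : ‖z - z'‖ ≤ 1 := by
    refine (norm_sub_le _ _).trans ?_
    rw [mem_ball_zero_iff] at *; linarith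
  conv_lhs => rw [← Real.rpow_one ‖z - z'‖]
  exact Real.rpow_le_rpow_of_exponent_ge' (norm_nonneg _) h2 (by norm_num) (by norm_num)

lemma algh {r : ℝ} (hr : r ≤ 1/2) : Alg (Kh r) where
  sm F hF := by
    obtain ⟨C, hC⟩ := (isCompact_closedBall (0:ℂ) r).exists_bound_of_continuousOn (hF.continuous_fderiv (by norm_num)).continuousOn
    exact Kh_of_fderiv hr (le_max_right C 0) (hF.of_le (by norm_num)).contDiffOn
      fun z hz => (hC z (ball_subset_closedBall hz)).trans (le_max_left _ _)
  add F G := by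
    rintro ⟨C, h0, hC⟩ ⟨D, h1, hD⟩
    refine ⟨C + D, by positivity, fun z hz z' hz' => ?_⟩
    rw [add_sub_add_comm, add_mul]
    exact (norm_add_le _ _).trans (add_le_add (hC z hz z' hz') (hD z hz z' hz'))
  mul F G := by
    rintro hF hG
    obtain ⟨CF, hF0, hF⟩ := hF.bdd
    obtain ⟨CG, hG0, hG⟩ := hG.bdd
    rename_i hF' hG'
    obtain ⟨C, h0, hC⟩ := hF'
    obtain ⟨D, h1, hD⟩ := hG'
    refine ⟨CF * D + CG * C, by positivity, fun z hz z' hz' => ?_⟩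
    rw [show F z * G z - F z' * G z' = F z * (G z - G z') + G z' * (F z - F z') by ring, add_mul]
    refine (norm_add_le _ _).trans (add_le_add ?_ ?_)
    · rw [norm_mul, mul_assoc]
      exact mul_le_mul (hF z hz) (hD z hz z' hz') (norm_nonneg _) hF0
    · rw [norm_mul, mul_assoc]
      exact mul_le_mul (hG z' hz') (hC z hz z' hz') (norm_nonneg _) hG0
  cj F := by
    rintro ⟨C, h0, hC⟩
    refine ⟨C, h0, fun z hz z' hz' => ?_⟩
    rw [← map_sub, RCLike.norm_conj]; exact hC z hz z' hz'

lemma alg1 (r : ℝ) : Alg (K1 r) where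
  sm F hF := (hF.of_le (by norm_num)).contDiffOn
  add F G hF hG := ContDiffOn.add hF hG
  mul F G hF hG := ContDiffOn.mul hF hG
  cj F hF := Complex.conjCLE.contDiff.comp_contDiffOn hF

lemma Kh.congr {r : ℝ} {F G : ℂ → ℂ} (h : Kh r F) (e : ∀ z ∈ ball (0:ℂ) r, G z = F z) : Kh r G := by
  obtain ⟨M, h0, hM⟩ := h
  refine ⟨M, h0, fun z hz z' hz' => ?_⟩
  rw [e z hz, e z' hz']; exact hM z hz z' hz'

lemma K1h.kh {r : ℝ} (hr : r ≤ 1/2) {F : ℂ → ℂ} (h : K1h r F) : Kh r F := by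
  obtain ⟨C, h0, hC⟩ := (h.2 1).bdd
  obtain ⟨D, h1, hD⟩ := (h.2 Complex.I).bdd
  exact Kh_of_fderiv hr (add_nonneg h0 h1) h.1 fun z hz => (opn_le _).trans (add_le_add (hC z hz) (hD z hz))

lemma alg1h {r : ℝ} (hr : r ≤ 1/2) : Alg (K1h r) where
  sm F hF := by
    refine ⟨(hF.of_le (by norm_num)).contDiffOn, fun v => ?_⟩
    have h1 : ContDiff ℝ 1 (fun z => fderiv ℝ F z v) := (hF.fderiv_right (m := 1) (by norm_num)).clm_apply contDiff_const
    obtain ⟨C, hC⟩ := (isCompact_closedBall (0:ℂ) r).exists_bound_of_continuousOn (h1.continuous_fderiv (by norm_num)).continuousOn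
    exact Kh_of_fderiv hr (le_max_right C 0) (h1.of_le (by norm_num)).contDiffOn
      fun z hz => (hC z (ball_subset_closedBall hz)).trans (le_max_left _ _)
  add F G hF hG := by
    refine ⟨hF.1.add hG.1, fun v => ((algh hr).add _ _ (hF.2 v) (hG.2 v)).congr fun z hz => ?_⟩
    have a := ((hF.1.contDiffAt (isOpen_ball.mem_nhds hz)).differentiableAt one_ne_zero)
    have b := ((hG.1.contDiffAt (isOpen_ball.mem_nhds hz)).differentiableAt one_ne_zero)
    rw [fderiv_fun_add a b]; rfl
  mul F G hF hG := by
    refine ⟨hF.1.mul hG.1, fun v => ((algh hr).add _ _ ((algh hr).mul _ _ (hF.kh hr) (hG.2 v))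
      ((algh hr).mul _ _ (hG.kh hr) (hF.2 v))).congr fun z hz => ?_⟩
    have a := ((hF.1.contDiffAt (isOpen_ball.mem_nhds hz)).differentiableAt one_ne_zero)
    have b := ((hG.1.contDiffAt (isOpen_ball.mem_nhds hz)).differentiableAt one_ne_zero)
    rw [fderiv_fun_mul a b]; rfl
  cj F hF := by
    refine ⟨Complex.conjCLE.contDiff.comp_contDiffOn hF.1, fun v => ((algh hr).cj _ (hF.2 v)).congr fun z hz => ?_⟩
    have a := ((hF.1.contDiffAt (isOpen_ball.mem_nhds hz)).differentiableAt one_ne_zero)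
    have := (Complex.conjCLE.toContinuousLinearMap.hasFDerivAt.comp z a.hasFDerivAt)
    have h' : HasFDerivAt (fun z => conj (F z)) _ z := this
    rw [h'.fderiv]; rfl

lemma glob_holder {r : ℝ} (hr : 0 < r) {G : ℂ → ℂ} (hs : ∀ ζ, 3/4 * r < ‖ζ‖ → G ζ = 0) (h : Kh r G) :
    ∃ M, ∀ z z', ‖G z - G z'‖ ≤ M * ‖z - z'‖ ^ (1/2:ℝ) := by
  obtain ⟨M, h0, hM⟩ := h
  have key : ∀ z z', ‖z‖ ≤ 3/4 * r → r ≤ ‖z'‖ → ‖G z - G z'‖ ≤ M * 8 ^ (1/2:ℝ) * ‖z - z'‖ ^ (1/2:ℝ) := by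
    intro z z' hz hz'
    have hy : ‖((7/8 * r : ℝ) : ℂ)‖ = 7/8 * r := by rw [Complex.norm_real, Real.norm_eq_abs, abs_of_pos (by positivity)]
    have h1 := hM z (by rw [mem_ball_zero_iff]; linarith) ((7/8 * r : ℝ) : ℂ) (by rw [mem_ball_zero_iff, hy]; linarith)
    rw [hs ((7/8 * r : ℝ) : ℂ) (by rw [hy]; linarith)] at h1
    rw [hs z' (by linarith)]
    refine h1.trans ?_
    rw [mul_assoc, ← Real.mul_rpow (by norm_num) (norm_nonneg _)]
    have h2 := norm_sub_le z ((7/8 * r : ℝ) : ℂ)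
    have h3 := norm_sub_norm_le z' z
    rw [norm_sub_rev] at h3
    rw [hy] at h2
    gcongr
    linarith
  have hM8 : M ≤ M * 8 ^ (1/2:ℝ) := by
    have : (1:ℝ) ≤ 8 ^ (1/2:ℝ) := Real.one_le_rpow (by norm_num) (by norm_num)
    nlinarith
  refine ⟨M * 8 ^ (1/2:ℝ), fun z z' => ?_⟩
  by_cases hz : ‖z‖ < r
  · by_cases hz' : ‖z'‖ < r
    · exact (hM z (by simpa using hz) z' (by simpa using hz')).trans (by gcongr)
    · by_cases hz1 : ‖z‖ ≤ 3/4 * r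
      · exact key z z' hz1 (not_lt.1 hz')
      · rw [hs z (by linarith), hs z' (by linarith)]
        simp; positivity
  · by_cases hz' : ‖z'‖ ≤ 3/4 * r
    · have := key z' z hz' (not_lt.1 hz)
      rwa [norm_sub_rev, norm_sub_rev z'] at this
    · rw [hs z (by linarith), hs z' (by linarith)]
      simp; positivity

lemma glob_C1 {r : ℝ} (hr : 0 < r) {G : ℂ → ℂ} (hs : ∀ ζ, 3/4 * r < ‖ζ‖ → G ζ = 0) (h : K1 r G) : ContDiff ℝ 1 G := by
  rw [contDiff_iff_contDiffAt]
  intro z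
  by_cases hz : ‖z‖ < r
  · exact h.contDiffAt (isOpen_ball.mem_nhds (by simpa using hz))
  · have : G =ᶠ[𝓝 z] fun _ => 0 := by
      have : ∀ᶠ x in 𝓝 z, 3/4 * r < ‖x‖ := continuous_norm.continuousAt.eventually (lt_mem_nhds (by linarith))
      filter_upwards [this] with x hx using hs x hx
    exact contDiffAt_const.congr_of_eventuallyEq this

lemma glob_fd {r : ℝ} {G : ℂ → ℂ} (hs : ∀ ζ, 3/4 * r < ‖ζ‖ → G ζ = 0) (v ζ : ℂ) (hζ : 3/4 * r < ‖ζ‖) : fderiv ℝ G ζ v = 0 := by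
  have : G =ᶠ[𝓝 ζ] fun _ => 0 := by
    have : ∀ᶠ x in 𝓝 ζ, 3/4 * r < ‖x‖ := continuous_norm.continuousAt.eventually (lt_mem_nhds (by linarith))
    filter_upwards [this] with x hx using hs x hx
  rw [this.fderiv_eq]; simp

/-- one regularity step for the Cauchy transform -/
def Step (K K' : ℝ → (ℂ → ℂ) → Prop) : Prop := ∀ (r : ℝ) (W V G : ℂ → ℂ), 0 < r → r ≤ 1/2 →
  ContDiffOn ℝ 1 W (pB r) → K0 r W → K0 r (dbar W) → K r V → K r G → (∀ z ∈ pB r, V z = W z) → (∀ z ∈ pB r, G z = dbar W z) →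
  ∃ V', K' (r/2) V' ∧ ∀ z ∈ pB (r/2), V' z = W z

lemma rep_step {r : ℝ} {W V G : ℂ → ℂ} (hr : 0 < r) (hW : ContDiffOn ℝ 1 W (pB r)) (hb : K0 r W) (hb' : K0 r (dbar W))
    (hV : ∀ z ∈ pB r, V z = W z) (hG : ∀ z ∈ pB r, G z = dbar W z) :
    ∀ z ∈ pB (r/2), (c0:ℂ)⁻¹ * CT (cutG r V G) z = W z := by
  intro z hz
  rw [mem_pB] at hz
  obtain ⟨C, h0, hC⟩ := hb
  obtain ⟨D, h1, hD⟩ := hb'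
  have := rep_cut (a := 0) (C := C + D) le_rfl one_pos hr hW (fun ζ hζ => by simpa using (hC ζ hζ).trans (by linarith))
    (fun ζ hζ => by simpa using (hD ζ hζ).trans (by linarith)) hz.2
  rw [CT_congr (G' := cutG r W (dbar W)), this, cut_eq_one (by positivity), one_mul, inv_mul_cancel_left₀]
  · exact_mod_cast c0_ne
  · rw [div_mul_eq_mul_div, div_le_one hr]; linarith
  · intro ζ hζ
    by_cases h : ‖ζ‖ < r
    · have hm : ζ ∈ pB r := mem_pB.2 ⟨h, hζ⟩
      rw [cutG, cutG, hV ζ hm, hG ζ hm]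
    · rw [cutG_zero hr _ _ (by linarith), cutG_zero hr _ _ (by linarith)]

lemma Kh.smul {r : ℝ} {F : ℂ → ℂ} (h : Kh r F) (c : ℂ) : Kh r (fun z => c * F z) := by
  obtain ⟨M, h0, hM⟩ := h
  refine ⟨‖c‖ * M, by positivity, fun z hz z' hz' => ?_⟩
  rw [← mul_sub, norm_mul, mul_assoc]
  exact mul_le_mul_of_nonneg_left (hM z hz z' hz') (norm_nonneg _)

lemma CT_kh {r C : ℝ} (hr : 0 < r) {G : ℂ → ℂ} (hm : AEStronglyMeasurable G) (hs : ∀ ζ, 3/4 * r < ‖ζ‖ → G ζ = 0)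
    (hb : ∀ ζ, ζ ≠ 0 → ‖G ζ‖ ≤ C) : Kh (r/2) (CT G) := by
  obtain ⟨M, h0, hM⟩ := CT_holder (a := 0) (b := 1/2) (R := r) (C := C) le_rfl (by norm_num) (by norm_num) hr.le hm
    (fun ζ hζ => hs ζ (by simp at hζ; linarith)) (fun ζ hζ => by simpa using hb ζ hζ)
  refine ⟨M, h0, fun z hz z' hz' => hM z ?_ z' ?_⟩ <;>
  · rw [mem_ball_zero_iff] at *; rw [mem_closedBall_zero_iff]; linarith

lemma step0 : Step K0 Kh := by
  intro r W V G hr hr2 hW hb hb' _ _ hV hG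
  refine ⟨_, ?_, rep_step hr hW hb hb' (fun _ _ => rfl) (fun _ _ => rfl)⟩
  obtain ⟨C, h0, hC⟩ := hb
  obtain ⟨D, h1, hD⟩ := hb'
  obtain ⟨M, hM, hMb⟩ := cutG_bound hr
  refine (CT_kh hr (cutG_meas hr hW) (fun ζ hζ => cutG_zero hr _ _ hζ) (C := (C + D) * M) fun ζ hζ => ?_).smul _
  have := hMb W (dbar W) (C + D) 0 (fun ζ hζ => by simpa using (hC ζ hζ).trans (by linarith))
    (fun ζ hζ => by simpa using (hD ζ hζ).trans (by linarith)) ζ hζ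
  simpa using this

lemma stepA : Step Kh K1 := by
  intro r W V G hr hr2 hW hb hb' kV kG hV hG
  refine ⟨_, ?_, rep_step hr hW hb hb' hV hG⟩
  obtain ⟨M, hM⟩ := glob_holder hr (fun ζ hζ => cutG_zero hr V G hζ) ((algh hr2).cutG kV kG)
  obtain ⟨F, hF, e⟩ := CT_A (fun ζ hζ => cutG_zero hr V G (by linarith)) hM
  refine ContDiffOn.mul contDiffOn_const (hF.contDiffOn.congr fun z hz => e z ?_)
  rw [mem_ball_zero_iff] at *; linarith

lemma hcs_of {r : ℝ} {G : ℂ → ℂ} (hs : ∀ ζ, 3/4 * r < ‖ζ‖ → G ζ = 0) : HasCompactSupport G := by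
  apply HasCompactSupport.of_support_subset_isCompact (isCompact_closedBall (0:ℂ) (3/4 * r))
  intro ζ hζ
  by_contra h
  simp at h
  exact hζ (hs ζ (by linarith))

lemma stepB : Step K1 K1h := by
  intro r W V G hr hr2 hW hb hb' kV kG hV hG
  refine ⟨_, ?_, rep_step hr hW hb hb' hV hG⟩
  have hs := fun ζ (hζ : 3/4 * r < ‖ζ‖) => cutG_zero hr V G hζ
  have c1 := glob_C1 hr hs ((alg1 r).cutG kV kG)
  have hc := hcs_of hs
  obtain ⟨h1, h2⟩ := CT_C1 c1 hc
  refine ⟨(contDiff_const.mul h1).contDiffOn, fun v => ?_⟩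
  have e : (fun z => fderiv ℝ (fun z => (c0:ℂ)⁻¹ * CT (cutG r V G) z) z v) =
      fun z => (c0:ℂ)⁻¹ * CT (fun ζ => fderiv ℝ (cutG r V G) ζ v) z := by
    ext z
    rw [fderiv_const_mul (h1.differentiable one_ne_zero z)]
    show (c0:ℂ)⁻¹ • (fderiv ℝ (CT (cutG r V G)) z v) = _
    rw [h2, smul_eq_mul]
  rw [e]
  have cf : Continuous (fun ζ => fderiv ℝ (cutG r V G) ζ v) :=
    (c1.continuous_fderiv one_ne_zero).clm_apply continuous_const
  have hs' := glob_fd hs v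
  obtain ⟨C, hC⟩ := cf.bounded_above_of_compact_support (hcs_of hs')
  exact (CT_kh hr cf.aestronglyMeasurable hs' (fun ζ _ => hC ζ)).smul _

lemma stepC : Step K1h K2 := by
  intro r W V G hr hr2 hW hb hb' kV kG hV hG
  refine ⟨_, ?_, rep_step hr hW hb hb' hV hG⟩
  have hs := fun ζ (hζ : 3/4 * r < ‖ζ‖) => cutG_zero hr V G hζ
  have hk := (alg1h hr2).cutG (r := r) kV kG
  have c1 := glob_C1 hr hs hk.1
  obtain ⟨M1, h1⟩ := glob_holder hr (glob_fd hs 1) (hk.2 1)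
  obtain ⟨M2, h2⟩ := glob_holder hr (glob_fd hs Complex.I) (hk.2 Complex.I)
  have := CT_C (M := max M1 M2) (fun ζ hζ => hs ζ (by linarith)) c1 (by
    rintro v (rfl | rfl) z z'
    · exact (h1 z z').trans (by gcongr; exact le_max_left _ _)
    · exact (h2 z z').trans (by gcongr; exact le_max_right _ _))
  exact contDiffOn_const.mul (this.mono (ball_subset_ball (by linarith)))

/-- extension property of a quadruple -/
def Ext4 (K : ℝ → (ℂ → ℂ) → Prop) (r : ℝ) (w f h Φ : ℂ → ℂ) : Prop := ∃ w' f' h' Φ' : ℂ → ℂ,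
  (K r w' ∧ K r f' ∧ K r h' ∧ K r Φ') ∧ ∀ z ∈ pB r, w' z = w z ∧ f' z = f z ∧ h' z = h z ∧ Φ' z = Φ z

lemma K0.mono {r r' : ℝ} (hr : r' ≤ r) {F : ℂ → ℂ} (h : K0 r F) : K0 r' F := by
  obtain ⟨C, h0, hC⟩ := h
  exact ⟨C, h0, fun z hz => hC z (pB_mono hr hz)⟩

lemma K0.congr {r : ℝ} {F G : ℂ → ℂ} (h : K0 r F) (e : ∀ z ∈ pB r, G z = F z) : K0 r G := by
  obtain ⟨C, h0, hC⟩ := h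
  exact ⟨C, h0, fun z hz => by rw [e z hz]; exact hC z hz⟩

lemma step4' {K K' : ℝ → (ℂ → ℂ) → Prop} (hs : Step K K') {r : ℝ} (A : Alg (K r)) {w f h Φ : ℂ → ℂ} (hr : 0 < r) (hr2 : r ≤ 1/2)
    (S : Sys r w f h Φ) (hb : K0 r w ∧ K0 r f ∧ K0 r h ∧ K0 r Φ) (H : Ext4 K r w f h Φ) :
    Ext4 K' (r/2) w f h Φ := by
  obtain ⟨w', f', h', Φ', ⟨kw, kf, kh, kΦ⟩, e⟩ := H
  obtain ⟨a1, a2, a3, a4⟩ := A.rhs kw kf kh kΦ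
  obtain ⟨b1, b2, b3, b4⟩ := (alg0 r).rhs hb.1 hb.2.1 hb.2.2.1 hb.2.2.2
  obtain ⟨W1, k1, e1⟩ := hs r w w' _ hr hr2 S.cw hb.1 (b1.congr S.ew) kw a1 (fun z hz => (e z hz).1) (fun z hz => by
    obtain ⟨e1, e2, e3, e4⟩ := e z hz
    rw [S.ew z hz, e2, e3])
  obtain ⟨W2, k2, e2⟩ := hs r f f' _ hr hr2 S.cf hb.2.1 (b2.congr S.ef) kf a2 (fun z hz => (e z hz).2.1) (fun z hz => by
    obtain ⟨e1, e2, e3, e4⟩ := e z hz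
    rw [S.ef z hz, e1, e2, e4])
  obtain ⟨W3, k3, e3⟩ := hs r h h' _ hr hr2 S.ch hb.2.2.1 (b3.congr S.eh) kh a3 (fun z hz => (e z hz).2.2.1) (fun z hz => by
    obtain ⟨e1, e2, e3, e4⟩ := e z hz
    rw [S.eh z hz, e1, e3])
  obtain ⟨W4, k4, e4⟩ := hs r Φ Φ' _ hr hr2 S.cΦ hb.2.2.2 (b4.congr S.eΦ) kΦ a4 (fun z hz => (e z hz).2.2.2) (fun z hz => by
    obtain ⟨e1, e2, e3, e4⟩ := e z hz
    rw [S.eΦ z hz, e1, e2, e3, e4])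
  exact ⟨W1, W2, W3, W4, ⟨k1, k2, k3, k4⟩, fun z hz => ⟨e1 z hz, e2 z hz, e3 z hz, e4 z hz⟩⟩

theorem core {R : ℝ} {w f h Φ : ℂ → ℂ} (hR : 0 < R) (S : Sys R w f h Φ) (hw : w =o[nz] lg) (hf : f =o[nz] lg) :
    ∃ r, 0 < r ∧ r ≤ R ∧ ∃ w' f' h' : ℂ → ℂ, ContDiffOn ℝ 2 w' (ball 0 r) ∧ ContDiffOn ℝ 2 f' (ball 0 r) ∧
      ContDiffOn ℝ 2 h' (ball 0 r) ∧ ∀ z ∈ pB r, w' z = w z ∧ f' z = f z ∧ h' z = h z := by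
  obtain ⟨b1, b2, b3, b4⟩ := chain hR S hw hf
  obtain ⟨R1, C1, p1, q1, b1⟩ := bigO_pB b1
  obtain ⟨R2, C2, p2, q2, b2⟩ := bigO_pB b2
  obtain ⟨R3, C3, p3, q3, b3⟩ := bigO_pB b3
  obtain ⟨R4, C4, p4, q4, b4⟩ := bigO_pB b4
  obtain ⟨r, hr, hrR, hr2, l1, l2, l3, l4⟩ : ∃ r, 0 < r ∧ r ≤ R ∧ r ≤ 1/2 ∧ r ≤ R1 ∧ r ≤ R2 ∧ r ≤ R3 ∧ r ≤ R4 := by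
    refine ⟨min R (min (1/2) (min R1 (min R2 (min R3 R4)))), by positivity, ?_, ?_, ?_, ?_, ?_, ?_⟩ <;> simp
  have B : K0 r w ∧ K0 r f ∧ K0 r h ∧ K0 r Φ :=
    ⟨⟨C1, q1, fun z hz => by simpa using b1 z (pB_mono l1 hz)⟩, ⟨C2, q2, fun z hz => by simpa using b2 z (pB_mono l2 hz)⟩,
      ⟨C3, q3, fun z hz => by simpa using b3 z (pB_mono l3 hz)⟩, ⟨C4, q4, fun z hz => by simpa using b4 z (pB_mono l4 hz)⟩⟩
  have Bm : ∀ r', r' ≤ r → K0 r' w ∧ K0 r' f ∧ K0 r' h ∧ K0 r' Φ := fun r' h =>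
    ⟨B.1.mono h, B.2.1.mono h, B.2.2.1.mono h, B.2.2.2.mono h⟩
  have H0 : Ext4 K0 r w f h Φ := ⟨w, f, h, Φ, B, fun z hz => ⟨rfl, rfl, rfl, rfl⟩⟩
  have H1 := step4' step0 (alg0 r) hr hr2 (S.restrict hrR) B H0
  have H2 := step4' stepA (algh (by linarith)) (by positivity) (by linarith) (S.restrict (by linarith)) (Bm _ (by linarith)) H1
  have H3 := step4' stepB (alg1 _) (by positivity) (by linarith) (S.restrict (by linarith)) (Bm _ (by linarith)) H2
  have H4 := step4' stepC (alg1h (by linarith)) (by positivity) (by linarith) (S.restrict (by linarith)) (Bm _ (by linarith)) H3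
  obtain ⟨w', f', h', Φ', ⟨kw, kf, kh, kΦ⟩, e⟩ := H4
  exact ⟨_, by positivity, by linarith, w', f', h', kw, kf, kh, fun z hz => ⟨(e z hz).1, (e z hz).2.1, (e z hz).2.2.1⟩⟩

/-- real partial derivatives on `ℂ` -/
def HasP (F : ℂ → ℝ) (z : ℂ) (a b : ℝ) : Prop := HasFDerivAt F (a • Complex.reCLM + b • Complex.imCLM) z

namespace HasP
variable {F G : ℂ → ℝ} {z : ℂ} {a b c d : ℝ}
lemma mk' (h : HasP F z a b) (hc : a = c) (hd : b = d) : HasP F z c d := by rw [← hc, ← hd]; exact h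
lemma add (h : HasP F z a b) (h' : HasP G z c d) : HasP (fun z => F z + G z) z (a + c) (b + d) := by
  refine (HasFDerivAt.fun_add h h').congr_fderiv ?_
  ext; simp; ring
lemma sub (h : HasP F z a b) (h' : HasP G z c d) : HasP (fun z => F z - G z) z (a - c) (b - d) := by
  refine (HasFDerivAt.fun_sub h h').congr_fderiv ?_
  ext; simp; ring
lemma neg (h : HasP F z a b) : HasP (fun z => - F z) z (-a) (-b) := by
  refine (HasFDerivAt.fun_neg h).congr_fderiv ?_
  ext; simp; ring
lemma mul (h : HasP F z a b) (h' : HasP G z c d) : HasP (fun z => F z * G z) z (a * G z + F z * c) (b * G z + F z * d) := by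
  refine (HasFDerivAt.fun_mul h h').congr_fderiv ?_
  ext <;> simp <;> ring
lemma const (c : ℝ) : HasP (fun _ => c) z 0 0 := by
  refine (hasFDerivAt_const c z).congr_fderiv ?_
  ext <;> simp
lemma re : HasP (fun z => z.re) z 1 0 := by
  refine (Complex.reCLM.hasFDerivAt).congr_fderiv ?_
  ext <;> simp
lemma im : HasP (fun z => z.im) z 0 1 := by
  refine (Complex.imCLM.hasFDerivAt).congr_fderiv ?_
  ext <;> simp
lemma of_fd {L : ℂ →L[ℝ] ℝ} (h : HasFDerivAt F L z) : HasP F z (L 1) (L Complex.I) := by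
  refine h.congr_fderiv ?_
  ext x
  have : x = x.re • (1:ℂ) + x.im • Complex.I := by
    rw [Complex.real_smul, Complex.real_smul, mul_one]; exact (Complex.re_add_im x).symm
  conv_lhs => rw [this, map_add, map_smul, map_smul]
  simp [mul_comm]
lemma inv (h : HasP F z a b) (h0 : F z ≠ 0) : HasP (fun z => (F z)⁻¹) z (-a * ((F z)⁻¹) ^ 2) (-b * ((F z)⁻¹) ^ 2) := by
  have := of_fd ((hasDerivAt_inv h0).comp_hasFDerivAt z h)
  refine mk' this ?_ ?_ <;> simp <;> ring
lemma congr (h : HasP F z a b) (e : G =ᶠ[𝓝 z] F) : HasP G z a b := HasFDerivAt.congr_of_eventuallyEq h e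
lemma uniq (h : HasP F z a b) (h' : HasP F z c d) : a = c ∧ b = d := by
  have := HasFDerivAt.unique h h'
  refine ⟨?_, ?_⟩
  · simpa using congrArg (fun L : ℂ →L[ℝ] ℝ => L 1) this
  · simpa using congrArg (fun L : ℂ →L[ℝ] ℝ => L Complex.I) this
lemma dbar (h : HasP F z a b) (h' : HasP G z c d) :
    dbar (fun z => (F z : ℂ) + Complex.I * (G z : ℂ)) z = (((a - d) / 2 : ℝ) : ℂ) + Complex.I * (((b + c)/2 : ℝ) : ℂ) := by
  have h1 := Complex.ofRealCLM.hasFDerivAt.comp z h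
  have h2 := Complex.ofRealCLM.hasFDerivAt.comp z h'
  have h3 : HasFDerivAt (fun z => (F z : ℂ) + Complex.I * (G z : ℂ)) _ z := h1.add (h2.const_mul Complex.I)
  rw [h3.dbar_eq]
  apply Complex.ext <;> simp <;> ring
end HasP

/-- `2/(1+|z|^2)` -/
def tt (z : ℂ) : ℝ := 2 * (1 + (z.re * z.re + z.im * z.im))⁻¹
lemma tt_pos (z : ℂ) : 0 < tt z := by unfold tt; have := mul_self_nonneg z.re; have := mul_self_nonneg z.im; positivity
lemma tt_rel (z : ℂ) : tt z * (1 + (z.re * z.re + z.im * z.im)) = 2 := by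
  unfold tt; have := mul_self_nonneg z.re; have := mul_self_nonneg z.im
  have h : 1 + (z.re * z.re + z.im * z.im) ≠ 0 := by positivity
  field_simp

lemma tt_P (z : ℂ) : HasP tt z (-z.re * tt z ^ 2) (-z.im * tt z ^ 2) := by
  have h : 1 + (z.re * z.re + z.im * z.im) ≠ 0 := by have := tt_rel z; intro h; rw [h] at this; simp at this
  refine HasP.mk' ((HasP.const 2).mul (((HasP.const 1).add ((HasP.re.mul HasP.re).add (HasP.im.mul HasP.im))).inv h)) ?_ ?_ <;>
  · unfold tt; ring

/-- stereographic coordinates -/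
def nS (z : ℂ) : Fin 3 → ℝ := ![z.re * tt z, z.im * tt z, 1 - tt z]
/-- tangent vector -/
def T1 (z : ℂ) : Fin 3 → ℝ := ![tt z - z.re * z.re * tt z ^ 2, -(z.re * z.im * tt z ^ 2), z.re * tt z ^ 2]
/-- tangent vector -/
def T2 (z : ℂ) : Fin 3 → ℝ := ![-(z.re * z.im * tt z ^ 2), tt z - z.im * z.im * tt z ^ 2, z.im * tt z ^ 2]

lemma nS_P (z : ℂ) (k : Fin 3) : HasP (fun z => nS z k) z (T1 z k) (T2 z k) := by
  fin_cases k
  · refine HasP.mk' (HasP.re.mul (tt_P z)) ?_ ?_ <;> simp [T1, T2] <;> ring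
  · refine HasP.mk' (HasP.im.mul (tt_P z)) ?_ ?_ <;> simp [T1, T2] <;> ring
  · refine HasP.mk' ((HasP.const 1).sub (tt_P z)) ?_ ?_ <;> simp [T1, T2]

lemma tt2_P (z : ℂ) : HasP (fun z => tt z ^ 2) z (-2 * z.re * tt z ^ 3) (-2 * z.im * tt z ^ 3) := by
  have := (tt_P z).mul (tt_P z)
  have e : (fun z => tt z ^ 2) = fun z => tt z * tt z := by ext; ring
  rw [e]
  refine this.mk' ?_ ?_ <;> ring

lemma T1_P (z : ℂ) (k : Fin 3) : HasP (fun z => T1 z k) z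
    (-(z.re * tt z) * T1 z k + z.im * tt z * T2 z k - tt z ^ 2 * nS z k) (-(z.im * tt z) * T1 z k - z.re * tt z * T2 z k) := by
  have ht := tt_rel z
  fin_cases k
  · refine HasP.mk' ((tt_P z).sub ((HasP.re.mul HasP.re).mul (tt2_P z))) ?_ ?_ <;> simp [T1, T2, nS]
    · linear_combination (z.re * tt z ^ 2) * ht
    · linear_combination 0 * ht
  · refine HasP.mk' (((HasP.re.mul HasP.im).mul (tt2_P z)).neg) ?_ ?_ <;> simp [T1, T2, nS]
    · linear_combination (z.im * tt z ^ 2) * ht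
    · linear_combination 0 * ht
  · refine HasP.mk' (HasP.re.mul (tt2_P z)) ?_ ?_ <;> simp [T1, T2, nS]
    · linear_combination (-tt z ^ 2) * ht
    · linear_combination 0 * ht

lemma T2_P (z : ℂ) (k : Fin 3) : HasP (fun z => T2 z k) z
    (-(z.im * tt z) * T1 z k - z.re * tt z * T2 z k) (z.re * tt z * T1 z k - z.im * tt z * T2 z k - tt z ^ 2 * nS z k) := by
  have ht := tt_rel z
  fin_cases k
  · refine HasP.mk' (((HasP.re.mul HasP.im).mul (tt2_P z)).neg) ?_ ?_ <;> simp [T1, T2, nS]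
    · linear_combination 0 * ht
    · linear_combination (z.re * tt z ^ 2) * ht
  · refine HasP.mk' ((tt_P z).sub ((HasP.im.mul HasP.im).mul (tt2_P z))) ?_ ?_ <;> simp [T1, T2, nS]
    · linear_combination 0 * ht
    · linear_combination (z.im * tt z ^ 2) * ht
  · refine HasP.mk' (HasP.im.mul (tt2_P z)) ?_ ?_ <;> simp [T1, T2, nS]
    · linear_combination 0 * ht
    · linear_combination (-tt z ^ 2) * ht

/-- dot product -/
def dt (a b : Fin 3 → ℝ) : ℝ := a 0 * b 0 + a 1 * b 1 + a 2 * b 2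

lemma dt_P {A B : ℂ → Fin 3 → ℝ} {z : ℂ} {A1 A2 B1 B2 : Fin 3 → ℝ} (hA : ∀ k, HasP (fun z => A z k) z (A1 k) (A2 k))
    (hB : ∀ k, HasP (fun z => B z k) z (B1 k) (B2 k)) :
    HasP (fun z => dt (A z) (B z)) z (dt A1 (B z) + dt (A z) B1) (dt A2 (B z) + dt (A z) B2) := by
  refine HasP.mk' ((((hA 0).mul (hB 0)).add ((hA 1).mul (hB 1))).add ((hA 2).mul (hB 2))) ?_ ?_ <;>
  · unfold dt; ring

lemma nT1 (z : ℂ) : dt (nS z) (T1 z) = 0 := by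
  have ht := tt_rel z
  simp [dt, nS, T1]; linear_combination (-z.re * tt z ^ 2) * ht
lemma nT2 (z : ℂ) : dt (nS z) (T2 z) = 0 := by
  have ht := tt_rel z
  simp [dt, nS, T2]; linear_combination (-z.im * tt z ^ 2) * ht
lemma nn (z : ℂ) : dt (nS z) (nS z) = 1 := by
  have ht := tt_rel z
  simp [dt, nS]; linear_combination (tt z) * ht
lemma T11 (z : ℂ) : dt (T1 z) (T1 z) = tt z ^ 2 := by
  have ht := tt_rel z
  simp [dt, T1]; linear_combination (z.re ^ 2 * tt z ^ 3) * ht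
lemma T22 (z : ℂ) : dt (T2 z) (T2 z) = tt z ^ 2 := by
  have ht := tt_rel z
  simp [dt, T2]; linear_combination (z.im ^ 2 * tt z ^ 3) * ht
lemma T12 (z : ℂ) : dt (T1 z) (T2 z) = 0 := by
  have ht := tt_rel z
  simp [dt, T1, T2]; linear_combination (z.re * z.im * tt z ^ 3) * ht

lemma proj3 (z : ℂ) (k m : Fin 3) : T1 z k * T1 z m + T2 z k * T2 z m = tt z ^ 2 * ((if k = m then 1 else 0) - nS z k * nS z m) := by
  have ht := tt_rel z
  fin_cases k <;> fin_cases m <;> simp [T1, T2, nS]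
  · linear_combination (z.re * z.re * tt z ^ 3) * ht
  · linear_combination (z.re * z.im * tt z ^ 3) * ht
  · linear_combination (-z.re * tt z ^ 3) * ht
  · linear_combination (z.re * z.im * tt z ^ 3) * ht
  · linear_combination (z.im * z.im * tt z ^ 3) * ht
  · linear_combination (-z.im * tt z ^ 3) * ht
  · linear_combination (-z.re * tt z ^ 3) * ht
  · linear_combination (-z.im * tt z ^ 3) * ht
  · linear_combination (tt z ^ 3) * ht

/-- stereographic chart -/
def Sg (z : ℂ) : V3 := WithLp.toLp 2 (nS z)
lemma Sg_fd (z : ℂ) : HasFDerivAt Sg (Complex.reCLM.smulRight (WithLp.toLp 2 (T1 z) : V3) + Complex.imCLM.smulRight (WithLp.toLp 2 (T2 z) : V3)) z := by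
  rw [← hasFDerivWithinAt_univ, hasFDerivWithinAt_euclidean]
  intro k
  rw [hasFDerivWithinAt_univ]
  refine HasFDerivAt.congr_fderiv (nS_P z k) ?_
  ext <;> simp [mul_comm]

lemma sum_e3 (v : Fin 3 → ℝ) : (WithLp.toLp 2 v : V3) = v 0 • e3 0 + v 1 • e3 1 + v 2 • e3 2 := by
  ext k; fin_cases k <;> simp [e3]

/-- gradient -/
def gr (g : V3 → ℝ) (x : V3) : Fin 3 → ℝ := fun k => pd k g x

lemma chainP {g : V3 → ℝ} {z : ℂ} (h : DifferentiableAt ℝ g (Sg z)) :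
    HasP (fun z => g (Sg z)) z (dt (T1 z) (gr g (Sg z))) (dt (T2 z) (gr g (Sg z))) := by
  refine (HasP.of_fd (h.hasFDerivAt.comp z (Sg_fd z))).mk' ?_ ?_ <;>
  · simp [sum_e3, dt, gr, pd, -map_add]
    simp only [map_add, map_smul, smul_eq_mul]

lemma proj_mat (z : ℂ) (M : Fin 3 → Fin 3 → ℝ) :
    dt (T1 z) (fun m => dt (T1 z) (M m)) + dt (T2 z) (fun m => dt (T2 z) (M m)) =
      tt z ^ 2 * (M 0 0 + M 1 1 + M 2 2 - dt (nS z) (fun m => dt (nS z) (M m))) := by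
  have h := proj3 z
  have h00 := h 0 0; have h01 := h 0 1; have h02 := h 0 2; have h11 := h 1 1; have h12 := h 1 2; have h22 := h 2 2
  simp at h00 h01 h02 h11 h12 h22
  unfold dt
  linear_combination M 0 0 * h00 + (M 0 1 + M 1 0) * h01 + (M 0 2 + M 2 0) * h02 + M 1 1 * h11 + (M 1 2 + M 2 1) * h12 + M 2 2 * h22

lemma proj_vec (z : ℂ) (a b : Fin 3 → ℝ) :
    dt a (T1 z) * dt (T1 z) b + dt a (T2 z) * dt (T2 z) b = tt z ^ 2 * (dt a b - dt a (nS z) * dt (nS z) b) := by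
  have := proj_mat z (fun k m => a k * b m)
  unfold dt at *
  linear_combination this

lemma proj_i (z : ℂ) (a : Fin 3 → ℝ) (i : Fin 3) :
    dt (T1 z) a * T1 z i + dt (T2 z) a * T2 z i = tt z ^ 2 * (a i - dt (nS z) a * nS z i) := by
  have := proj_vec z (Pi.single i 1) a
  have e : ∀ b : Fin 3 → ℝ, dt (Pi.single i 1) b = b i := by
    intro b; unfold dt; fin_cases i <;> simp
  rw [e, e, e, e] at this
  linear_combination this

lemma fd_dt (g : V3 → ℝ) (x v : V3) : fderiv ℝ g x v = dt v (gr g x) := by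
  have : v = WithLp.toLp 2 (fun k => v k) := rfl
  conv_lhs => rw [this, sum_e3, map_add, map_add, map_smul, map_smul, map_smul]
  rfl

lemma euler {g : V3 → ℝ} {x : V3} {φ : ℝ → ℝ} {c : ℝ} (hφ : HasDerivAt φ c 1) (h : ∀ l : ℝ, 0 < l → g (l • x) = φ l * g x)
    (hd : DifferentiableAt ℝ g x) : dt x (gr g x) = c * g x := by
  rw [← fd_dt]
  have h1 : HasDerivAt (fun l : ℝ => l • x) x 1 := by simpa using (hasDerivAt_id (1:ℝ)).smul_const x
  have h2 : HasDerivAt (fun l : ℝ => g (l • x)) (fderiv ℝ g x x) 1 := by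
    refine HasFDerivAt.comp_hasDerivAt (f := fun l : ℝ => l • x) (1:ℝ) ?_ h1
    simpa using hd.hasFDerivAt
  have h3 : HasDerivAt (fun l : ℝ => g (l • x)) (c * g x) 1 := by
    refine (hφ.mul_const (g x)).congr_of_eventuallyEq ?_
    filter_upwards [lt_mem_nhds (zero_lt_one)] with l hl using h l hl
  exact h2.unique h3

/-- Hessian -/
def Hs (g : V3 → ℝ) (x : V3) (k m : Fin 3) : ℝ := pd k (fun y => pd m g y) x

lemma pd_diff {g : V3 → ℝ} {x : V3} (h : ContDiffAt ℝ 2 g x) (m : Fin 3) : ContDiffAt ℝ 1 (fun y => pd m g y) x :=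
  (h.fderiv_right (m := 1) (by norm_num)).clm_apply contDiffAt_const

lemma Hs_symm {g : V3 → ℝ} {x : V3} (h : ContDiffAt ℝ 2 g x) (k m : Fin 3) : Hs g x k m = Hs g x m k := by
  have hs := h.isSymmSndFDerivAt (by simp)
  have hd : DifferentiableAt ℝ (fderiv ℝ g) x := (h.fderiv_right (m := 1) (by norm_num)).differentiableAt (by norm_num)
  have e : ∀ k m, Hs g x k m = fderiv ℝ (fderiv ℝ g) x (e3 k) (e3 m) := by
    intro k m
    unfold Hs pd
    rw [fderiv_clm_apply hd (differentiableAt_const _)]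
    simp
  rw [e, e, hs]

lemma pd_proj (m : Fin 3) (x : V3) : HasFDerivAt (fun y : V3 => y m) (EuclideanSpace.proj m : V3 →L[ℝ] ℝ) x :=
  (EuclideanSpace.proj m : V3 →L[ℝ] ℝ).hasFDerivAt

lemma euler2 {g : V3 → ℝ} {x : V3} (h : ContDiffAt ℝ 2 g x) (he : ∀ᶠ y : V3 in 𝓝 x, dt y (gr g y) = -1 * g y) (k : Fin 3) :
    dt x (fun m => Hs g x k m) = - 2 * pd k g x := by
  have hm := fun m => (pd_diff h m).differentiableAt one_ne_zero |>.hasFDerivAt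
  have h1 := (((pd_proj 0 x).fun_mul (hm 0)).fun_add ((pd_proj 1 x).fun_mul (hm 1))).fun_add ((pd_proj 2 x).fun_mul (hm 2))
  have h2 := ((h.differentiableAt (by norm_num)).hasFDerivAt.const_mul (-1)).congr_of_eventuallyEq he
  have h3 := congrArg (fun L : V3 →L[ℝ] ℝ => L (e3 k)) (h1.unique h2)
  have e : ∀ m, fderiv ℝ (fun y => pd m g y) x (e3 k) = Hs g x k m := fun m => rfl
  have e' : fderiv ℝ g x (e3 k) = pd k g x := rfl
  simp only [add_apply, smul_apply, e, e', smul_eq_mul] at h3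
  have e4 : ∀ m, (EuclideanSpace.proj m : V3 →L[ℝ] ℝ) (e3 k) = if m = k then 1 else 0 := by
    intro m; simp [e3]
  rw [e4, e4, e4] at h3
  unfold dt
  fin_cases k <;> simp at h3 ⊢ <;> linear_combination h3

/-- data -/
structure Dat (D : Set V3) (u : V3 → V3) (p : V3 → ℝ) : Prop where
  op : IsOpen D
  cu : ContDiffOn ℝ 2 u D
  cp : ContDiffOn ℝ 2 p D
  hu : ∀ x ∈ D, ∀ l : ℝ, 0 < l → u (l • x) = l⁻¹ • u x
  hp : ∀ x ∈ D, ∀ l : ℝ, 0 < l → p (l • x) = (l ^ 2)⁻¹ * p x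
  ns : ∀ x ∈ D, NSEq u p x

lemma Dat.ui {D : Set V3} {u : V3 → V3} {p : V3 → ℝ} (H : Dat D u p) {x : V3} (hx : x ∈ D) (i : Fin 3) :
    ContDiffAt ℝ 2 (fun y => u y i) x :=
  contDiffAt_euclidean.1 (H.cu.contDiffAt (H.op.mem_nhds hx)) i

lemma Dat.eu {D : Set V3} {u : V3 → V3} {p : V3 → ℝ} (H : Dat D u p) {x : V3} (hx : x ∈ D) (i : Fin 3) :
    dt x (gr (fun y => u y i) x) = - 1 * u x i := by
  refine euler (φ := fun l => l⁻¹) ?_ (fun l hl => ?_) ((H.ui hx i).differentiableAt (by norm_num))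
  · simpa using hasDerivAt_inv (one_ne_zero (α := ℝ))
  · simp [H.hu x hx l hl]

lemma Dat.ep {D : Set V3} {u : V3 → V3} {p : V3 → ℝ} (H : Dat D u p) {x : V3} (hx : x ∈ D) :
    dt x (gr p x) = - 2 * p x := by
  refine euler (φ := fun l => (l ^ 2)⁻¹) ?_ (fun l hl => H.hp x hx l hl)
    ((H.cp.contDiffAt (H.op.mem_nhds hx)).differentiableAt (by norm_num))
  have := ((hasDerivAt_id (1:ℝ)).fun_pow 2).fun_inv (by simp)
  simpa using this

/-- pulled back field -/
def Uu (u : V3 → V3) (z : ℂ) : Fin 3 → ℝ := fun k => u (Sg z) k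
/-- first derivative -/
def U1 (u : V3 → V3) (z : ℂ) : Fin 3 → ℝ := fun k => dt (T1 z) (gr (fun y => u y k) (Sg z))
/-- first derivative -/
def U2 (u : V3 → V3) (z : ℂ) : Fin 3 → ℝ := fun k => dt (T2 z) (gr (fun y => u y k) (Sg z))

lemma jet {D : Set V3} {u : V3 → V3} {p : V3 → ℝ} (H : Dat D u p) {z : ℂ} (hz : Sg z ∈ D) :
    ∃ U11 U12 U22 : Fin 3 → ℝ, ∃ P1 P2 : ℝ, (∀ k, HasP (fun z => Uu u z k) z (U1 u z k) (U2 u z k)) ∧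
    (∀ k, HasP (fun z => U1 u z k) z (U11 k) (U12 k)) ∧ (∀ k, HasP (fun z => U2 u z k) z (U12 k) (U22 k)) ∧
    HasP (fun z => p (Sg z)) z P1 P2 ∧
    (∀ k, -(U11 k + U22 k) + dt (Uu u z) (T1 z) * U1 u z k + dt (Uu u z) (T2 z) * U2 u z k - tt z ^ 2 * dt (Uu u z) (nS z) * Uu u z k
      + P1 * T1 z k + P2 * T2 z k - 2 * tt z ^ 2 * p (Sg z) * nS z k = 0) ∧
    dt (U1 u z) (T1 z) + dt (U2 u z) (T2 z) = tt z ^ 2 * dt (Uu u z) (nS z) := by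
  set x := Sg z with hx
  have hG : ∀ k m, HasP (fun z => pd m (fun y => u y k) (Sg z)) z (dt (T1 z) (fun j => Hs (fun y => u y k) x j m))
      (dt (T2 z) (fun j => Hs (fun y => u y k) x j m)) := fun k m =>
    chainP ((pd_diff (H.ui hz k) m).differentiableAt one_ne_zero)
  have h1 := fun k => dt_P (T1_P z) (B := fun z => gr (fun y => u y k) (Sg z)) (hG k)
  have h2 := fun k => dt_P (T2_P z) (B := fun z => gr (fun y => u y k) (Sg z)) (hG k)
  have hp := chainP ((H.cp.contDiffAt (H.op.mem_nhds hz)).differentiableAt (by norm_num))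
  refine ⟨_, _, _, _, _, fun k => chainP ((H.ui hz k).differentiableAt (by norm_num)), h1,
    fun k => (h2 k).mk' ?_ rfl, hp, fun k => ?_, ?_⟩
  · simp only [Hs_symm (H.ui hz k) _ 0, Hs_symm (H.ui hz k) 2 1, dt]
    ring
  · have ns := (H.ns x hz).1 k
    simp only [lap3, Fin.sum_univ_three] at ns
    have e1 := H.eu hz k
    have e2 := fun j => euler2 (H.ui hz k) (by filter_upwards [H.op.mem_nhds hz] with y hy using H.eu hy k) j
    have e3' := H.ep hz
    have m1 := proj_mat z (fun m j => Hs (fun y => u y k) x j m)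
    have m2 := proj_vec z (Uu u z) (gr (fun y => u y k) x)
    have m3 := proj_i z (gr p x) k
    have x0 : x 0 = nS z 0 := rfl
    have x1 : x 1 = nS z 1 := rfl
    have x2 : x 2 = nS z 2 := rfl
    have e20 := e2 0; have e21 := e2 1; have e22 := e2 2
    simp only [U1, U2, ← hx]
    have sy := Hs_symm (H.ui hz k)
    have s1 := sy 1 0; have s2 := sy 2 0; have s3 := sy 2 1
    simp only [dt, x0, x1, x2] at e1 e20 e21 e22 e3' m1 m2 m3 ⊢
    simp only [gr, Uu, Hs, ← hx] at *
    linear_combination (-1) * m1 + m2 + m3 + tt z ^ 2 * ns + tt z ^ 2 * (nS z 0 * e20 + nS z 1 * e21 + nS z 2 * e22)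
      - tt z ^ 2 * (u x 0 * nS z 0 + u x 1 * nS z 1 + u x 2 * nS z 2) * e1 - tt z ^ 2 * nS z k * e3'
  · have ns := (H.ns x hz).2
    simp only [Fin.sum_univ_three] at ns
    have m1 := proj_mat z (fun m k => pd m (fun y => u y k) x)
    have e0 := H.eu hz 0
    have e1 := H.eu hz 1
    have e2 := H.eu hz 2
    have x0 : x 0 = nS z 0 := rfl
    have x1 : x 1 = nS z 1 := rfl
    have x2 : x 2 = nS z 2 := rfl
    simp only [dt, x0, x1, x2, gr, U1, U2, Uu, ← hx] at *
    linear_combination m1 + tt z ^ 2 * ns - tt z ^ 2 * nS z 0 * e0 - tt z ^ 2 * nS z 1 * e1 - tt z ^ 2 * nS z 2 * e2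

/-- radial part -/
def fF (u : V3 → V3) (z : ℂ) : ℝ := dt (Uu u z) (nS z)
/-- tangential part -/
def a1 (u : V3 → V3) (z : ℂ) : ℝ := dt (Uu u z) (T1 z)
/-- tangential part -/
def a2 (u : V3 → V3) (z : ℂ) : ℝ := dt (Uu u z) (T2 z)
/-- vorticity -/
def cF (u : V3 → V3) (z : ℂ) : ℝ := dt (U1 u z) (T2 z) - dt (U2 u z) (T1 z)
/-- head -/
def Hh (u : V3 → V3) (p : V3 → ℝ) (z : ℂ) : ℝ := (1/2) * (a1 u z * a1 u z + a2 u z * a2 u z) + tt z ^ 2 * (p (Sg z) - fF u z)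
/-- auxiliary -/
def A1 (u : V3 → V3) (z : ℂ) : ℝ := a1 u z * (fF u z + 1) - dt (U1 u z) (nS z)
/-- auxiliary -/
def A2 (u : V3 → V3) (z : ℂ) : ℝ := a2 u z * (fF u z + 1) - dt (U2 u z) (nS z)

/-- complex unknowns -/
def wc (u : V3 → V3) (z : ℂ) : ℂ := (a1 u z : ℂ) + Complex.I * ((- a2 u z : ℝ) : ℂ)
/-- complex unknowns -/
def fc (u : V3 → V3) (z : ℂ) : ℂ := (fF u z : ℂ) + Complex.I * ((0 : ℝ) : ℂ)
/-- complex unknowns -/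
def hc (u : V3 → V3) (p : V3 → ℝ) (z : ℂ) : ℂ := (Hh u p z : ℂ) + Complex.I * ((- cF u z : ℝ) : ℂ)
/-- complex unknowns -/
def Φc (u : V3 → V3) (z : ℂ) : ℂ := (A1 u z : ℂ) + Complex.I * ((- A2 u z : ℝ) : ℂ)

lemma Ez_tt (z : ℂ) : Ez z = ((tt z ^ 2 : ℝ) : ℂ) := by
  unfold Ez tt
  rw [← Complex.normSq_eq_norm_sq, Complex.normSq_apply]
  congr 1
  rw [mul_pow, inv_pow, div_eq_mul_inv]; norm_num

lemma kz_tt (z : ℂ) : kz z = ((-(tt z) : ℝ) : ℂ) * z := by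
  unfold kz tt
  rw [← Complex.normSq_eq_norm_sq, Complex.normSq_apply]
  congr 2
  rw [div_eq_mul_inv]; ring

lemma dbar_eqs {D : Set V3} {u : V3 → V3} {p : V3 → ℝ} (H : Dat D u p) {z : ℂ} (hz : Sg z ∈ D) :
    dbar (wc u) z = -(1/2) * (Ez z * fc u z - Complex.I * (hc u p z).im) ∧
    dbar (fc u) z = (1/2) * conj (wc u z * (fc u z + 2) - Φc u z) ∧
    dbar (hc u p) z = Complex.I / 2 * (hc u p z).im * conj (wc u z) + kz z * hc u p z ∧
    dbar (Φc u) z = (hc u p z).re - Complex.I / 2 * (-(fc u z + 2) * (hc u p z).im + (wc u z * conj (Φc u z)).im) := by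
  obtain ⟨U11, U12, U22, P1, P2, hU, hU1, hU2, hp, ns, dv⟩ := jet H hz
  have Pf := dt_P hU (nS_P z)
  have Pa1 := dt_P hU (T1_P z)
  have Pa2 := dt_P hU (T2_P z)
  have Pm1 := dt_P hU1 (nS_P z)
  have Pm2 := dt_P hU2 (nS_P z)
  have Ps11 := dt_P hU1 (T1_P z)
  have Ps12 := dt_P hU1 (T2_P z)
  have Ps21 := dt_P hU2 (T1_P z)
  have Ps22 := dt_P hU2 (T2_P z)
  have lin : ∀ (v : Fin 3 → ℝ) (b1 b2 b3 : ℝ), dt v (fun k => b1 * T1 z k + b2 * T2 z k - b3 * nS z k) =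
    b1 * dt v (T1 z) + b2 * dt v (T2 z) - b3 * dt v (nS z) := by intros; unfold dt; ring
  have lin2 : ∀ (v : Fin 3 → ℝ) (b1 b2 b3 : ℝ), dt v (fun k => b1 * T1 z k - b2 * T2 z k - b3 * nS z k) =
    b1 * dt v (T1 z) - b2 * dt v (T2 z) - b3 * dt v (nS z) := by intros; unfold dt; ring
  have lin3 : ∀ (v : Fin 3 → ℝ) (b1 b2 : ℝ), dt v (fun k => b1 * T1 z k - b2 * T2 z k) =
    b1 * dt v (T1 z) - b2 * dt v (T2 z) := by intros; unfold dt; ring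
  simp only [lin, lin2, lin3] at Pa1 Pa2 Ps11 Ps12 Ps21 Ps22
  have dvP : HasP (fun z => dt (U1 u z) (T1 z) + dt (U2 u z) (T2 z)) z _ _ := Ps11.add Ps22
  have hcont : ContinuousAt Sg z := (Sg_fd z).continuousAt
  have ev : (fun z => dt (U1 u z) (T1 z) + dt (U2 u z) (T2 z)) =ᶠ[𝓝 z] fun z => tt z ^ 2 * dt (Uu u z) (nS z) := by
    filter_upwards [hcont.preimage_mem_nhds (H.op.mem_nhds hz)] with y hy
    obtain ⟨_, _, _, _, _, _, _, _, _, _, h⟩ := jet H hy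
    exact h
  obtain ⟨dv1, dv2⟩ := dvP.uniq (((tt2_P z).mul Pf).congr ev)
  have nsd : ∀ v : Fin 3 → ℝ, -(dt U11 v + dt U22 v) + dt (Uu u z) (T1 z) * dt (U1 u z) v + dt (Uu u z) (T2 z) * dt (U2 u z) v
     - tt z ^ 2 * dt (Uu u z) (nS z) * dt (Uu u z) v + P1 * dt (T1 z) v + P2 * dt (T2 z) v - 2 * tt z ^ 2 * p (Sg z) * dt (nS z) v = 0 := by
    intro v
    unfold dt at *
    linear_combination v 0 * ns 0 + v 1 * ns 1 + v 2 * ns 2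
  have n0 := nsd (nS z)
  have n1 := nsd (T1 z)
  have n2 := nsd (T2 z)
  have cm : ∀ a b, dt a b = dt b a := by intros; unfold dt; ring
  rw [nn, cm (T1 z) (nS z), cm (T2 z) (nS z), nT1, nT2] at n0
  rw [nT1, T11, cm (T2 z) (T1 z), T12] at n1
  rw [nT2, T22, T12] at n2
  have Pw := Pa1.dbar Pa2.neg
  have Pfd := Pf.dbar (HasP.const 0)
  have PH := ((HasP.const (1/2)).mul ((Pa1.mul Pa1).add (Pa2.mul Pa2))).add ((tt2_P z).mul (hp.sub Pf))
  have Ph := PH.dbar (Ps12.sub Ps21).neg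
  have PΦ := ((Pa1.mul (Pf.add (HasP.const 1))).sub Pm1).dbar ((Pa2.mul (Pf.add (HasP.const 1))).sub Pm2).neg
  refine ⟨Pw.trans ?_, Pfd.trans ?_, Ph.trans ?_, PΦ.trans ?_⟩ <;> rw [Complex.ext_iff] <;>
    simp [wc, fc, hc, Φc, Ez_tt, kz_tt, fF, a1, a2, cF, Hh, A1, A2, -Complex.ofReal_pow] <;>
    generalize dt (Uu u z) (nS z) = f at * <;> generalize dt (Uu u z) (T1 z) = a at * <;> generalize dt (Uu u z) (T2 z) = b at * <;>
    generalize dt (U1 u z) (nS z) = m1 at * <;> generalize dt (U2 u z) (nS z) = m2 at * <;>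
    generalize dt (U1 u z) (T1 z) = s11 at * <;> generalize dt (U1 u z) (T2 z) = s12 at * <;>
    generalize dt (U2 u z) (T1 z) = s21 at * <;> generalize dt (U2 u z) (T2 z) = s22 at * <;>
    generalize tt z = t at * <;> generalize z.re = x at * <;> generalize z.im = y at * <;>
    clear lin lin2 lin3 nsd cm ns
  · constructor
    · linear_combination (1/2) * dv
    · ring
  · constructor <;> ring
  · constructor
    · linear_combination (1/2) * dv1 + (1/2) * n1 + x * t * dv
    · linear_combination (1/2) * dv2 + (1/2) * n2 + y * t * dv
  · constructor
    · linear_combination (1/2) * n0 + (1/2) * f * dv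
    · ring

lemma unit_cont : ContinuousOn (fun x : V3 => ‖x‖⁻¹ • x) {0}ᶜ := by
  intro x hx
  exact ((continuous_norm.continuousAt.inv₀ (norm_ne_zero_iff.2 hx)).smul continuousAt_id).continuousWithinAt

lemma unit_norm {x : V3} (hx : x ≠ 0) : ‖(‖x‖⁻¹ • x)‖ = 1 := by
  rw [norm_smul, norm_inv, norm_norm, inv_mul_cancel₀ (norm_ne_zero_iff.2 hx)]

lemma mem_capF {δ : ℝ} {x : V3} : x ∈ cone3 (NSCapFull δ) ↔ x ≠ 0 ∧ dist (‖x‖⁻¹ • x) S3 < δ := by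
  unfold cone3 NSCapFull sphere2
  simp only [Set.mem_setOf_eq, Set.mem_inter_iff, mem_sphere, mem_ball, dist_zero_right]
  constructor
  · rintro ⟨h, h1, h2⟩; exact ⟨h, h2⟩
  · rintro ⟨h, h2⟩; exact ⟨h, unit_norm h, h2⟩

lemma mem_cap {δ : ℝ} {x : V3} : x ∈ cone3 (NSCap δ) ↔ x ∈ cone3 (NSCapFull δ) ∧ ‖x‖⁻¹ • x ≠ S3 := by
  unfold cone3 NSCap NSCapFull
  simp only [Set.mem_setOf_eq, Set.mem_diff, Set.mem_singleton_iff]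
  tauto

lemma capF_open (δ : ℝ) : IsOpen (cone3 (NSCapFull δ)) := by
  have := unit_cont.isOpen_inter_preimage isOpen_compl_singleton (isOpen_ball (x := S3) (ε := δ))
  convert this using 1
  ext x; rw [mem_capF]; simp

lemma cap_open (δ : ℝ) : IsOpen (cone3 (NSCap δ)) := by
  have := unit_cont.isOpen_inter_preimage isOpen_compl_singleton ((isOpen_ball (x := S3) (ε := δ)).inter (isOpen_compl_singleton (x := S3)))
  convert this using 1
  ext x; rw [mem_cap, mem_capF]; simp [and_assoc]

lemma S3_0 : S3 0 = 0 := by simp [S3]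
lemma S3_1 : S3 1 = 0 := by simp [S3]
lemma S3_2 : S3 2 = -1 := by simp [S3]
lemma Sg_0 (z : ℂ) : Sg z 0 = z.re * tt z := by simp [Sg, nS]
lemma Sg_1 (z : ℂ) : Sg z 1 = z.im * tt z := by simp [Sg, nS]
lemma Sg_2 (z : ℂ) : Sg z 2 = 1 - tt z := by simp [Sg, nS]

lemma Sg_norm (z : ℂ) : ‖Sg z‖ = 1 := by
  rw [EuclideanSpace.norm_eq, Real.sqrt_eq_one, Fin.sum_univ_three]
  simp only [Real.norm_eq_abs, sq_abs, Sg_0, Sg_1, Sg_2]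
  linear_combination (tt z) * tt_rel z

lemma zsq (z : ℂ) : ‖z‖ ^ 2 = z.re * z.re + z.im * z.im := by
  rw [← Complex.normSq_eq_norm_sq, Complex.normSq_apply]

lemma Sg_dist (z : ℂ) : dist (Sg z) S3 ^ 2 = 2 * tt z * ‖z‖ ^ 2 := by
  rw [EuclideanSpace.dist_eq, Real.sq_sqrt (by positivity), Fin.sum_univ_three]
  simp only [Real.dist_eq, sq_abs, Sg_0, Sg_1, Sg_2, S3_0, S3_1, S3_2, zsq]
  linear_combination (tt z - 2) * tt_rel z

lemma tt_le (z : ℂ) : tt z ≤ 2 := by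
  have := tt_rel z; have := tt_pos z; have := mul_self_nonneg z.re; have := mul_self_nonneg z.im
  nlinarith

lemma tt_ge {z : ℂ} (h : ‖z‖ ≤ 1) : 1 ≤ tt z := by
  have h1 := tt_rel z
  rw [← zsq] at h1
  have := tt_pos z
  have : ‖z‖ ^ 2 ≤ 1 := by nlinarith [norm_nonneg z]
  nlinarith

lemma Sg_dist_le (z : ℂ) : dist (Sg z) S3 ≤ 2 * ‖z‖ := by
  refine le_of_sq_le_sq ?_ (by positivity)
  rw [Sg_dist]; nlinarith [tt_le z, sq_nonneg ‖z‖]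

lemma Sg_dist_ge {z : ℂ} (h : ‖z‖ ≤ 1) : ‖z‖ ≤ dist (Sg z) S3 := by
  refine le_of_sq_le_sq ?_ (by positivity)
  rw [Sg_dist]; nlinarith [tt_ge h, sq_nonneg ‖z‖]

lemma Sg_ne {z : ℂ} (h : z ≠ 0) : Sg z ≠ S3 := by
  intro h0
  have := Sg_dist z
  rw [h0, dist_self] at this
  have h1 := tt_pos z
  have h2 := norm_pos_iff.2 h
  have : 0 < 2 * tt z * ‖z‖ ^ 2 := by positivity
  simp_all

lemma Sg_mem {δ : ℝ} {z : ℂ} (hz : z ∈ pB (δ/2)) : Sg z ∈ cone3 (NSCap δ) := by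
  obtain ⟨h1, h2⟩ := mem_pB.1 hz
  rw [mem_cap, mem_capF, Sg_norm, inv_one, one_smul]
  refine ⟨⟨?_, by linarith [Sg_dist_le z]⟩, Sg_ne h2⟩
  rw [← norm_ne_zero_iff, Sg_norm]; exact one_ne_zero

lemma re_cd : ContDiff ℝ 2 (fun z : ℂ => z.re) := Complex.reCLM.contDiff
lemma im_cd : ContDiff ℝ 2 (fun z : ℂ => z.im) := Complex.imCLM.contDiff
lemma tt_cd : ContDiff ℝ 2 tt := by
  refine contDiff_const.mul ((contDiff_const.add ((re_cd.mul re_cd).add (im_cd.mul im_cd))).inv fun z h => ?_)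
  have := tt_rel z
  simp [h] at this
lemma nS_cd (k : Fin 3) : ContDiff ℝ 2 (fun z => nS z k) := by
  fin_cases k
  · exact re_cd.mul tt_cd
  · exact im_cd.mul tt_cd
  · exact contDiff_const.sub tt_cd
lemma T1_cd (k : Fin 3) : ContDiff ℝ 2 (fun z => T1 z k) := by
  fin_cases k
  · exact tt_cd.sub ((re_cd.mul re_cd).mul (tt_cd.pow 2))
  · exact ((re_cd.mul im_cd).mul (tt_cd.pow 2)).neg
  · exact re_cd.mul (tt_cd.pow 2)
lemma T2_cd (k : Fin 3) : ContDiff ℝ 2 (fun z => T2 z k) := by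
  fin_cases k
  · exact ((re_cd.mul im_cd).mul (tt_cd.pow 2)).neg
  · exact tt_cd.sub ((im_cd.mul im_cd).mul (tt_cd.pow 2))
  · exact im_cd.mul (tt_cd.pow 2)
lemma Sg_cd : ContDiff ℝ 2 Sg := by
  rw [contDiff_euclidean]
  exact nS_cd

lemma dt_cd {n : WithTop ℕ∞} {a b : ℂ → Fin 3 → ℝ} {z : ℂ} (ha : ∀ k, ContDiffAt ℝ n (fun z => a z k) z)
    (hb : ∀ k, ContDiffAt ℝ n (fun z => b z k) z) : ContDiffAt ℝ n (fun z => dt (a z) (b z)) z :=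
  (((ha 0).mul (hb 0)).add ((ha 1).mul (hb 1))).add ((ha 2).mul (hb 2))

lemma cx_cd {E : Type} [NormedAddCommGroup E] [NormedSpace ℝ E] {n : WithTop ℕ∞} {a b : E → ℝ} {z : E} (ha : ContDiffAt ℝ n a z) (hb : ContDiffAt ℝ n b z) :
    ContDiffAt ℝ n (fun z => (a z : ℂ) + Complex.I * (b z : ℂ)) z :=
  (Complex.ofRealCLM.contDiff.contDiffAt.comp z ha).add (contDiffAt_const.mul (Complex.ofRealCLM.contDiff.contDiffAt.comp z hb))

lemma mkSys {δ : ℝ} {u : V3 → V3} {p : V3 → ℝ} (H : Dat (cone3 (NSCap δ)) u p) :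
    Sys (δ/2) (wc u) (fc u) (hc u p) (Φc u) := by
  have one2 : (1 : WithTop ℕ∞) ≤ 2 := by norm_num
  have cS : ∀ z, ContDiffAt ℝ 1 Sg z := fun z => (Sg_cd.of_le one2).contDiffAt
  have cn : ∀ z k, ContDiffAt ℝ 1 (fun z => nS z k) z := fun z k => ((nS_cd k).of_le one2).contDiffAt
  have c1 : ∀ z k, ContDiffAt ℝ 1 (fun z => T1 z k) z := fun z k => ((T1_cd k).of_le one2).contDiffAt
  have c2 : ∀ z k, ContDiffAt ℝ 1 (fun z => T2 z k) z := fun z k => ((T2_cd k).of_le one2).contDiffAt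
  have ct : ∀ z, ContDiffAt ℝ 1 tt z := fun z => (tt_cd.of_le one2).contDiffAt
  have cU : ∀ z ∈ pB (δ/2), ∀ k, ContDiffAt ℝ 1 (fun z => Uu u z k) z := fun z hz k =>
    ContDiffAt.comp z (g := fun y => u y k) ((H.ui (Sg_mem hz) k).of_le one2) (cS z)
  have cpd : ∀ z ∈ pB (δ/2), ∀ k j, ContDiffAt ℝ 1 (fun z => gr (fun y => u y k) (Sg z) j) z := fun z hz k j =>
    ContDiffAt.comp z (g := fun y => pd j (fun y => u y k) y) (pd_diff (H.ui (Sg_mem hz) k) j) (cS z)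
  have cU1 : ∀ z ∈ pB (δ/2), ∀ k, ContDiffAt ℝ 1 (fun z => U1 u z k) z := fun z hz k => dt_cd (c1 z) (cpd z hz k)
  have cU2 : ∀ z ∈ pB (δ/2), ∀ k, ContDiffAt ℝ 1 (fun z => U2 u z k) z := fun z hz k => dt_cd (c2 z) (cpd z hz k)
  have cp : ∀ z ∈ pB (δ/2), ContDiffAt ℝ 1 (fun z => p (Sg z)) z := fun z hz =>
    ContDiffAt.comp z ((H.cp.contDiffAt (H.op.mem_nhds (Sg_mem hz))).of_le one2) (cS z)
  have cf : ∀ z ∈ pB (δ/2), ContDiffAt ℝ 1 (fF u) z := fun z hz => dt_cd (cU z hz) (cn z)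
  have ca1 : ∀ z ∈ pB (δ/2), ContDiffAt ℝ 1 (a1 u) z := fun z hz => dt_cd (cU z hz) (c1 z)
  have ca2 : ∀ z ∈ pB (δ/2), ContDiffAt ℝ 1 (a2 u) z := fun z hz => dt_cd (cU z hz) (c2 z)
  have cc : ∀ z ∈ pB (δ/2), ContDiffAt ℝ 1 (cF u) z := fun z hz => (dt_cd (cU1 z hz) (c2 z)).sub (dt_cd (cU2 z hz) (c1 z))
  have cH : ∀ z ∈ pB (δ/2), ContDiffAt ℝ 1 (Hh u p) z := fun z hz =>
    (contDiffAt_const.mul (((ca1 z hz).mul (ca1 z hz)).add ((ca2 z hz).mul (ca2 z hz)))).add (((ct z).pow 2).mul ((cp z hz).sub (cf z hz)))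
  have cA1 : ∀ z ∈ pB (δ/2), ContDiffAt ℝ 1 (A1 u) z := fun z hz =>
    ((ca1 z hz).mul ((cf z hz).add contDiffAt_const)).sub (dt_cd (cU1 z hz) (cn z))
  have cA2 : ∀ z ∈ pB (δ/2), ContDiffAt ℝ 1 (A2 u) z := fun z hz =>
    ((ca2 z hz).mul ((cf z hz).add contDiffAt_const)).sub (dt_cd (cU2 z hz) (cn z))
  exact ⟨fun z hz => (cx_cd (ca1 z hz) (ca2 z hz).neg).contDiffWithinAt,
    fun z hz => (cx_cd (cf z hz) contDiffAt_const).contDiffWithinAt,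
    fun z hz => (cx_cd (cH z hz) (cc z hz).neg).contDiffWithinAt,
    fun z hz => (cx_cd (cA1 z hz) (cA2 z hz).neg).contDiffWithinAt,
    fun z _ => by simp [fc], fun z hz => (dbar_eqs H (Sg_mem hz)).1, fun z hz => (dbar_eqs H (Sg_mem hz)).2.1,
    fun z hz => (dbar_eqs H (Sg_mem hz)).2.2.1, fun z hz => (dbar_eqs H (Sg_mem hz)).2.2.2⟩

open Asymptotics in
lemma u_lo {u : V3 → V3} (hlim : Tendsto (fun x => ‖u x‖ / Real.log (dist x S3)) (𝓝[sphere2 \ {S3}] S3) (𝓝 0)) :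
    (fun z => u (Sg z)) =o[nz] lg := by
  have S0 : Sg 0 = S3 := by
    rw [← dist_eq_zero, ← sq_eq_zero_iff, Sg_dist]; simp
  have hT : Tendsto Sg nz (𝓝[sphere2 \ {S3}] S3) := by
    apply tendsto_nhdsWithin_of_tendsto_nhds_of_eventually_within
    · rw [← S0]; exact (Sg_cd.continuous.tendsto 0).mono_left nhdsWithin_le_nhds
    · filter_upwards [self_mem_nhdsWithin] with z hz
      exact ⟨by simp [sphere2, Sg_norm], Sg_ne hz⟩
  have h1 := hlim.comp hT
  have ev : ∀ᶠ z in nz, z ≠ 0 ∧ ‖z‖ < 1/2 := by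
    filter_upwards [pB_mem (show (0:ℝ) < 1/2 by norm_num)] with z hz
    have := mem_pB.1 hz
    exact ⟨this.2, this.1⟩
  have h2 : (fun z => ‖u (Sg z)‖) =o[nz] (fun z => Real.log (dist (Sg z) S3)) := by
    refine (isLittleO_iff_tendsto' ?_).2 h1
    filter_upwards [ev] with z hz h0
    have hp := norm_pos_iff.2 hz.1
    have := Real.log_neg (x := dist (Sg z) S3) (by linarith [Sg_dist_ge (z := z) (by linarith [hz.2])]) (by linarith [Sg_dist_le z, hz.2])
    linarith
  refine (h2.norm_left.trans_isBigO (IsBigO.of_bound 1 ?_)).of_norm_left.of_norm_left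
  filter_upwards [ev] with z hz
  have hp := norm_pos_iff.2 hz.1
  have hd := Sg_dist_ge (z := z) (by linarith [hz.2])
  have := Real.log_neg (x := dist (Sg z) S3) (by linarith) (by linarith [Sg_dist_le z, hz.2])
  have h4 := Real.log_le_log hp hd
  rw [one_mul, lg, Complex.norm_real, Real.norm_eq_abs, Real.norm_eq_abs, abs_of_neg this, abs_of_neg (by linarith)]
  linarith

lemma dt_le {u : V3 → V3} {z : ℂ} {b : Fin 3 → ℝ} (hb : dt b b ≤ 4) : |dt (Uu u z) b| ≤ 6 * ‖u (Sg z)‖ := by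
  have hU : ∀ k, |Uu u z k| ≤ ‖u (Sg z)‖ := fun k => PiLp.norm_apply_le (u (Sg z)) k
  have hb' : ∀ k, |b k| ≤ 2 := by
    intro k
    apply abs_le_of_sq_le_sq _ (by norm_num)
    unfold dt at hb
    fin_cases k <;> simp <;> nlinarith [mul_self_nonneg (b 0), mul_self_nonneg (b 1), mul_self_nonneg (b 2)]
  have h : ∀ k, |Uu u z k * b k| ≤ ‖u (Sg z)‖ * 2 := fun k => by
    rw [abs_mul]; exact mul_le_mul (hU k) (hb' k) (abs_nonneg _) (norm_nonneg _)
  unfold dt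
  refine (abs_add_three _ _ _).trans ?_
  linarith [h 0, h 1, h 2]

lemma wf_lo {u : V3 → V3} (hlim : Tendsto (fun x => ‖u x‖ / Real.log (dist x S3)) (𝓝[sphere2 \ {S3}] S3) (𝓝 0)) :
    wc u =o[nz] lg ∧ fc u =o[nz] lg := by
  have hu := u_lo hlim
  have ht : ∀ z, tt z ^ 2 ≤ 4 := fun z => by nlinarith [tt_le z, tt_pos z]
  constructor
  · refine (Asymptotics.IsBigO.of_bound 12 (Eventually.of_forall fun z => ?_)).trans_isLittleO hu
    have h1 : |a1 u z| ≤ _ := dt_le ((T11 z).trans_le (ht z))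
    have h2 : |a2 u z| ≤ _ := dt_le ((T22 z).trans_le (ht z))
    refine (norm_add_le _ _).trans ?_
    rw [norm_mul, Complex.norm_I, one_mul, Complex.norm_real, Complex.norm_real, norm_neg, Real.norm_eq_abs, Real.norm_eq_abs]
    linarith
  · refine (Asymptotics.IsBigO.of_bound 6 (Eventually.of_forall fun z => ?_)).trans_isLittleO hu
    have h1 : |fF u z| ≤ _ := dt_le ((nn z).trans_le (by norm_num))
    simpa [fc] using h1

lemma ext_chart {δ : ℝ} (hδ : 0 < δ) {u : V3 → V3} {p : V3 → ℝ} (H : Dat (cone3 (NSCap δ)) u p)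
    (hlim : Tendsto (fun x => ‖u x‖ / Real.log (dist x S3)) (𝓝[sphere2 \ {S3}] S3) (𝓝 0)) :
    ∃ r, 0 < r ∧ r ≤ δ/2 ∧ ∃ (U : ℂ → V3) (P : ℂ → ℝ), ContDiffOn ℝ 2 U (ball 0 r) ∧ ContDiffOn ℝ 2 P (ball 0 r) ∧
      ∀ z ∈ pB r, U z = u (Sg z) ∧ P z = p (Sg z) := by
  obtain ⟨r, hr, hrd, w, f, h, cw, cf, ch, e⟩ := core (half_pos hδ) (mkSys H) (wf_lo hlim).1 (wf_lo hlim).2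
  have rc : ∀ {g : ℂ → ℂ}, ContDiffOn ℝ 2 g (ball 0 r) → ContDiffOn ℝ 2 (fun z => (g z).re) (ball 0 r) := fun hg =>
    Complex.reCLM.contDiff.comp_contDiffOn hg
  have ic : ∀ {g : ℂ → ℂ}, ContDiffOn ℝ 2 g (ball 0 r) → ContDiffOn ℝ 2 (fun z => (g z).im) (ball 0 r) := fun hg =>
    Complex.imCLM.contDiff.comp_contDiffOn hg
  have ti : ContDiffOn ℝ 2 (fun z => (tt z ^ 2)⁻¹) (ball 0 r) :=
    ((tt_cd.pow 2).inv fun z => pow_ne_zero 2 (tt_pos z).ne').contDiffOn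
  refine ⟨r, hr, hrd, fun z => WithLp.toLp 2 fun k => (f z).re * nS z k + (tt z ^ 2)⁻¹ * ((w z).re * T1 z k + -(w z).im * T2 z k),
    fun z => (f z).re + (tt z ^ 2)⁻¹ * ((h z).re - (1/2) * ((w z).re * (w z).re + (w z).im * (w z).im)), ?_, ?_, ?_⟩
  · rw [contDiffOn_euclidean]
    intro k
    exact ((rc cf).mul (nS_cd k).contDiffOn).add (ti.mul (((rc cw).mul (T1_cd k).contDiffOn).add ((ic cw).neg.mul (T2_cd k).contDiffOn)))
  · exact (rc cf).add (ti.mul ((rc ch).sub (contDiffOn_const.mul (((rc cw).mul (rc cw)).add ((ic cw).mul (ic cw))))))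
  · intro z hz
    obtain ⟨e1, e2, e3⟩ := e z hz
    have ht : tt z ^ 2 ≠ 0 := pow_ne_zero 2 (tt_pos z).ne'
    simp only [e1, e2, e3]
    constructor
    · ext k
      have := proj_i z (Uu u z) k
      have cm : ∀ a b, dt a b = dt b a := by intros; unfold dt; ring
      simp [fc, wc, fF, a1, a2]
      rw [cm _ (T1 z), cm _ (T2 z), this, cm _ (nS z), inv_mul_cancel_left₀ ht]
      unfold Uu; ring
    · have s1 : (fc u z).re = fF u z := by simp [fc]
      have s2 : (wc u z).re = a1 u z := by simp [wc]
      have s3 : (wc u z).im = - a2 u z := by simp [wc]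
      have s4 : (hc u p z).re = Hh u p z := by simp [hc]
      have hi := inv_mul_cancel₀ ht
      rw [s1, s2, s3, s4, Hh]
      linear_combination (p (Sg z) - fF u z) * hi

/-- the chart -/
def zx (x : V3) : ℂ := ⟨x 0 / (‖x‖ - x 2), x 1 / (‖x‖ - x 2)⟩

lemma nsq (x : V3) : ‖x‖ ^ 2 = x 0 ^ 2 + x 1 ^ 2 + x 2 ^ 2 := by
  rw [EuclideanSpace.norm_sq_eq, Fin.sum_univ_three]; simp

lemma Sg_zx {x : V3} (h : x 2 < ‖x‖) : ‖x‖ • Sg (zx x) = x := by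
  have hd : ‖x‖ - x 2 ≠ 0 := by linarith [sub_pos.2 h]
  have hx : ‖x‖ ≠ 0 := by
    intro h0; rw [h0] at h; rw [norm_eq_zero] at h0; rw [h0] at h; simp at h
  have ht : tt (zx x) = (‖x‖ - x 2) / ‖x‖ := by
    have h1 := tt_rel (zx x)
    have h2 : 1 + ((zx x).re * (zx x).re + (zx x).im * (zx x).im) = 2 * ‖x‖ / (‖x‖ - x 2) := by
      simp only [zx]; field_simp; linear_combination -nsq x
    rw [h2] at h1
    field_simp at h1 ⊢
    linarith
  ext k
  fin_cases k
  · simp [Sg_0, ht]; simp only [zx]; field_simp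
  · simp [Sg_1, ht]; simp only [zx]; field_simp
  · simp [Sg_2, ht]; field_simp; ring

lemma co_cd (k : Fin 3) : ContDiff ℝ 2 (fun x : V3 => x k) := (EuclideanSpace.proj k : V3 →L[ℝ] ℝ).contDiff

lemma zx_cd {x : V3} (h : x 2 < ‖x‖) : ContDiffAt ℝ 2 zx x := by
  have hx : x ≠ 0 := by rintro rfl; simp at h
  have hd : ‖x‖ - x 2 ≠ 0 := by linarith [sub_pos.2 h]
  have cd : ContDiffAt ℝ 2 (fun x : V3 => ‖x‖ - x 2) x := (contDiffAt_norm ℝ hx).sub (co_cd 2).contDiffAt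
  refine (cx_cd ((co_cd 0).contDiffAt.div cd hd) ((co_cd 1).contDiffAt.div cd hd)).congr_of_eventuallyEq (Eventually.of_forall fun y => ?_)
  apply Complex.ext <;> simp [zx, -Complex.ofReal_div]

lemma ray_iff {x : V3} (hx : x ≠ 0) : ‖x‖⁻¹ • x = S3 ↔ (x 0 = 0 ∧ x 1 = 0 ∧ x 2 < 0) := by
  have hn := norm_pos_iff.2 hx
  constructor
  · intro h
    have : x = ‖x‖ • S3 := by rw [← h, smul_smul, mul_inv_cancel₀ hn.ne', one_smul]
    refine ⟨?_, ?_, ?_⟩ <;> rw [this] <;> simp [S3_0, S3_1, S3_2, hx]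
  · rintro ⟨h0, h1, h2⟩
    have h3 : ‖x‖ = - x 2 := by
      have := nsq x
      rw [h0, h1] at this
      nlinarith
    ext k
    fin_cases k
    · simp [h0, S3_0]
    · simp [h1, S3_1]
    · simp [h3, S3_2]; exact inv_mul_cancel₀ h2.ne

lemma zx_0 {x : V3} (h : x 2 < ‖x‖) (h0 : zx x = 0) : x 0 = 0 ∧ x 1 = 0 ∧ x 2 < 0 := by
  have hx : x ≠ 0 := by rintro rfl; simp at h
  rw [← ray_iff hx]
  have := Sg_zx h
  rw [h0] at this
  have S0 : Sg 0 = S3 := by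
    rw [← dist_eq_zero, ← sq_eq_zero_iff, Sg_dist]; simp
  rw [S0] at this
  nth_rw 2 [← this]
  rw [smul_smul, inv_mul_cancel₀ (norm_ne_zero_iff.2 hx), one_smul]

lemma pd_congr {f g : V3 → ℝ} {x : V3} (h : f =ᶠ[𝓝 x] g) (j : Fin 3) : pd j f x = pd j g x := by
  unfold pd; rw [h.fderiv_eq]

lemma NS_congr {u v : V3 → V3} {p q : V3 → ℝ} {x : V3} (hu : v =ᶠ[𝓝 x] u) (hp : q =ᶠ[𝓝 x] p) (h : NSEq u p x) : NSEq v q x := by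
  have c : ∀ i, (fun z => v z i) =ᶠ[𝓝 x] fun z => u z i := fun i => by filter_upwards [hu] with y hy; rw [hy]
  have l : ∀ i, lap3 (fun z => v z i) x = lap3 (fun z => u z i) x := fun i => by
    unfold lap3
    refine Finset.sum_congr rfl fun j _ => pd_congr ?_ j
    filter_upwards [(c i).eventuallyEq_nhds] with y hy using pd_congr hy j
  refine ⟨fun i => ?_, ?_⟩
  · rw [← h.1 i, l, pd_congr hp, hu.eq_of_nhds]
    simp only [pd_congr (c i)]
  · rw [← h.2]
    exact Finset.sum_congr rfl fun j _ => pd_congr (c j) j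

lemma pd_cont {g : V3 → ℝ} {x : V3} (h : ContDiffAt ℝ 1 g x) (m : Fin 3) : ContinuousAt (fun y => pd m g y) x :=
  (h.continuousAt_fderiv one_ne_zero).clm_apply continuousAt_const

lemma NS_lim {v : V3 → V3} {q : V3 → ℝ} {x : V3} (hv : ContDiffAt ℝ 2 v x) (hq : ContDiffAt ℝ 2 q x)
    {l : Filter V3} [l.NeBot] (hl : l ≤ 𝓝 x) (h : ∀ᶠ y in l, NSEq v q y) : NSEq v q x := by
  have ci := fun i => contDiffAt_euclidean.1 hv i
  have pc : ∀ i j, ContinuousAt (fun y => pd j (fun z => v z i) y) x := fun i j => (pd_diff (ci i) j).continuousAt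
  have z0 : ∀ {F : V3 → ℝ}, ContinuousAt F x → (∀ᶠ y in l, F y = 0) → F x = 0 := fun {F} hF h0 =>
    tendsto_nhds_unique (hF.mono_left hl) (tendsto_const_nhds.congr' (h0.mono fun y hy => hy.symm))
  refine ⟨fun i => z0 (F := fun x => - lap3 (fun z => v z i) x + (∑ j, v x j * pd j (fun z => v z i) x) + pd i q x) ?_
    (h.mono fun y hy => hy.1 i), z0 (F := fun x => ∑ j, pd j (fun z => v z j) x) ?_ (h.mono fun y hy => hy.2)⟩
  · refine ((ContinuousAt.neg ?_).add ?_).add (pd_diff hq i).continuousAt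
    · exact tendsto_finsetSum _ fun j _ => pd_cont (pd_diff (ci i) j) j
    · exact tendsto_finsetSum _ fun j _ => (ci j).continuousAt.mul (pc i j)
  · exact tendsto_finsetSum _ fun j _ => pc j j

/-- removable singularity for `(-1)`-homogeneous solutions near the south pole. -/
theorem removable_singularity (δ : ℝ) (hδ : 0 < δ) (u : V3 → V3) (p : V3 → ℝ)
    (hu_hom : ∀ x ∈ cone3 (NSCap δ), ∀ lam : ℝ, 0 < lam → u (lam • x) = lam⁻¹ • u x)
    (hp_hom : ∀ x ∈ cone3 (NSCap δ), ∀ lam : ℝ, 0 < lam → p (lam • x) = (lam ^ 2)⁻¹ * p x)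
    (hu_reg : ContDiffOn ℝ 2 u (cone3 (NSCap δ)))
    (hp_reg : ContDiffOn ℝ 2 p (cone3 (NSCap δ)))
    (hNS : ∀ x ∈ cone3 (NSCap δ), NSEq u p x)
    (hlim : Tendsto (fun x => ‖u x‖ / Real.log (dist x S3))
      (𝓝[sphere2 \ {S3}] S3) (𝓝 0)) :
    ∃ (v : V3 → V3) (q : V3 → ℝ),
      (∀ x ∈ cone3 (NSCap δ), v x = u x ∧ q x = p x) ∧
      (∀ x ∈ cone3 (NSCapFull δ), ∀ lam : ℝ, 0 < lam →
        v (lam • x) = lam⁻¹ • v x ∧ q (lam • x) = (lam ^ 2)⁻¹ * q x) ∧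
      ContDiffOn ℝ 2 v (cone3 (NSCapFull δ)) ∧
      ContDiffOn ℝ 2 q (cone3 (NSCapFull δ)) ∧
      (∀ x ∈ cone3 (NSCapFull δ), NSEq v q x) := by
  have H : Dat (cone3 (NSCap δ)) u p := ⟨cap_open δ, hu_reg, hp_reg, hu_hom, hp_hom, hNS⟩
  obtain ⟨r, hr, hrd, U, P, cU, cP, e⟩ := ext_chart hδ H hlim
  classical
  let V : V3 → V3 := fun x => ‖x‖⁻¹ • U (zx x)
  let Q : V3 → ℝ := fun x => (‖x‖ ^ 2)⁻¹ * P (zx x)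
  let v : V3 → V3 := fun x => if x 0 = 0 ∧ x 1 = 0 ∧ x 2 < 0 then V x else u x
  let q : V3 → ℝ := fun x => if x 0 = 0 ∧ x 1 = 0 ∧ x 2 < 0 then Q x else p x
  have vr : ∀ {x : V3}, (x 0 = 0 ∧ x 1 = 0 ∧ x 2 < 0) → v x = V x ∧ q x = Q x := fun h => ⟨if_pos h, if_pos h⟩
  have vu : ∀ x ∈ cone3 (NSCap δ), v x = u x ∧ q x = p x := by
    intro x hx
    have h := (mem_cap.1 hx).2
    rw [Ne, ray_iff (mem_capF.1 (mem_cap.1 hx).1).1] at h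
    exact ⟨if_neg h, if_neg h⟩
  have vV : ∀ x : V3, x 2 < ‖x‖ → ‖zx x‖ < r → v x = V x ∧ q x = Q x := by
    intro x hx hz
    by_cases h : x 0 = 0 ∧ x 1 = 0 ∧ x 2 < 0
    · exact vr h
    · have hz : zx x ∈ pB r := mem_pB.2 ⟨hz, fun h0 => h (zx_0 hx h0)⟩
      have hm := Sg_mem (pB_mono hrd hz)
      have hn : 0 < ‖x‖ := norm_pos_iff.2 (by rintro rfl; simp at hx)
      have h1 : v x = u x := if_neg h
      have h2 : q x = p x := if_neg h
      rw [h1, h2]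
      constructor
      · conv_lhs => rw [← Sg_zx hx, hu_hom _ hm _ hn, ← (e _ hz).1]
      · conv_lhs => rw [← Sg_zx hx, hp_hom _ hm _ hn, ← (e _ hz).2]
  have ray : ∀ {x : V3}, (x 0 = 0 ∧ x 1 = 0 ∧ x 2 < 0) → x 2 < ‖x‖ ∧ zx x = 0 := by
    intro x h
    refine ⟨h.2.2.trans_le (norm_nonneg x), ?_⟩
    apply Complex.ext <;> simp [zx, h.1, h.2.1]
  have rayc : ∀ {x : V3}, (x 0 = 0 ∧ x 1 = 0 ∧ x 2 < 0) → ContDiffAt ℝ 2 v x ∧ ContDiffAt ℝ 2 q x := by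
    intro x h
    obtain ⟨h1, h2⟩ := ray h
    have hx : x ≠ 0 := by rintro rfl; simp at h1
    have hn := norm_ne_zero_iff.2 hx
    have cz := zx_cd h1
    have ev : ∀ᶠ y in 𝓝 x, v y = V y ∧ q y = Q y := by
      have e1 : ∀ᶠ y : V3 in 𝓝 x, y 2 < ‖y‖ :=
        (co_cd 2).continuous.continuousAt.eventually_lt continuous_norm.continuousAt h1
      have e2 : ∀ᶠ y : V3 in 𝓝 x, ‖zx y‖ < r :=
        cz.continuousAt.norm.eventually_lt continuousAt_const (by simpa [h2] using hr)
      filter_upwards [e1, e2] with y h3 h4 using vV y h3 h4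
    have hb : ball (0:ℂ) r ∈ 𝓝 (zx x) := by rw [h2]; exact ball_mem_nhds _ hr
    have cn : ContDiffAt ℝ 2 (fun x : V3 => ‖x‖) x := contDiffAt_norm ℝ hx
    refine ⟨ContDiffAt.congr_of_eventuallyEq (f := V) ?_ (ev.mono fun y hy => hy.1),
      ContDiffAt.congr_of_eventuallyEq (f := Q) ?_ (ev.mono fun y hy => hy.2)⟩
    · exact (cn.inv hn).smul ((cU.contDiffAt hb).comp x cz)
    · exact ((cn.pow 2).inv (pow_ne_zero 2 hn)).mul ((cP.contDiffAt hb).comp x cz)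
  have evc : ∀ x ∈ cone3 (NSCap δ), v =ᶠ[𝓝 x] u ∧ q =ᶠ[𝓝 x] p := by
    intro x hx
    constructor <;> filter_upwards [(cap_open δ).mem_nhds hx] with y hy
    · exact (vu y hy).1
    · exact (vu y hy).2
  have split : ∀ x ∈ cone3 (NSCapFull δ), x ∈ cone3 (NSCap δ) ∨ (x 0 = 0 ∧ x 1 = 0 ∧ x 2 < 0) := by
    intro x hx
    by_cases h : ‖x‖⁻¹ • x = S3
    · exact Or.inr ((ray_iff (mem_capF.1 hx).1).1 h)
    · exact Or.inl (mem_cap.2 ⟨hx, h⟩)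
  have reg : ∀ x ∈ cone3 (NSCapFull δ), ContDiffAt ℝ 2 v x ∧ ContDiffAt ℝ 2 q x := by
    intro x hx
    rcases split x hx with h | h
    · exact ⟨(hu_reg.contDiffAt ((cap_open δ).mem_nhds h)).congr_of_eventuallyEq (evc x h).1,
        (hp_reg.contDiffAt ((cap_open δ).mem_nhds h)).congr_of_eventuallyEq (evc x h).2⟩
    · exact rayc h
  have nsc : ∀ x ∈ cone3 (NSCap δ), NSEq v q x := fun x h => NS_congr (evc x h).1 (evc x h).2 (hNS x h)
  refine ⟨v, q, vu, ?_, fun x hx => (reg x hx).1.contDiffWithinAt, fun x hx => (reg x hx).2.contDiffWithinAt, ?_⟩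
  · intro x hx l hl
    have hx0 := (mem_capF.1 hx).1
    rcases split x hx with h | h
    · have hlx : l • x ∈ cone3 (NSCap δ) := by
        have e1 : ‖l • x‖⁻¹ • l • x = ‖x‖⁻¹ • x := by
          rw [norm_smul, Real.norm_eq_abs, abs_of_pos hl, smul_smul]
          congr 1
          field_simp
        refine ⟨smul_ne_zero hl.ne' hx0, ?_⟩
        rw [e1]; exact h.2
      rw [(vu _ hlx).1, (vu _ hlx).2, (vu _ h).1, (vu _ h).2]
      exact ⟨hu_hom x h l hl, hp_hom x h l hl⟩
    · have h' : (l • x) 0 = 0 ∧ (l • x) 1 = 0 ∧ (l • x) 2 < 0 := by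
        simp [h.1, h.2.1, mul_neg_of_pos_of_neg hl h.2.2]
      rw [(vr h).1, (vr h).2, (vr h').1, (vr h').2]
      simp only [V, Q, (ray h).2, (ray h').2, norm_smul, Real.norm_eq_abs, abs_of_pos hl]
      refine ⟨?_, ?_⟩
      · rw [smul_smul, mul_inv]
      · rw [mul_pow, mul_inv, mul_assoc]
  · intro x hx
    rcases split x hx with h | h
    · exact nsc x h
    · have hc : Continuous (fun s : ℝ => x + s • e3 0) := by fun_prop
      have ht : Tendsto (fun s : ℝ => x + s • e3 0) (𝓝[≠] 0) (𝓝 x) := by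
        have := hc.tendsto 0
        simp only [zero_smul, add_zero] at this
        exact this.mono_left nhdsWithin_le_nhds
      refine NS_lim (reg x hx).1 (reg x hx).2 (l := map (fun s : ℝ => x + s • e3 0) (𝓝[≠] 0)) ht ?_
      rw [eventually_map]
      filter_upwards [ht.eventually ((capF_open δ).mem_nhds hx), self_mem_nhdsWithin] with s hs h0
      rcases split _ hs with h1 | h1
      · exact nsc _ h1
      · exact absurd h1.1 (by simpa [e3, h.1] using h0)
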